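/- Let q > 1 with spq < n. Let μ be a Borel measure with finite total mass whose restriction to Ω has a density in L^q_loc(Ω), g ∈ W^{s,p}_loc(ℝⁿ) ∩ L^{p−1}_{sp}(ℝⁿ), and let u be a SOLA of the Dirichlet problem −L_Φ u = μ in Ω, u = g on ℝⁿ∖Ω. Then u ∈ L^{nq(p−1)/(n−spq)}_loc(Ω). -/

import Mathlib

noncomputable section

open MeasureTheory Metric Set Filter Topology
open scoped ENNReal NNReal

/-- Euclidean space `ℝⁿ`. -/
abbrev Rn (n : ℕ) : Type := EuclideanSpace ℝ (Fin n)

/-- `q_* = max {1, p-1}`. -/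
def qStar (p : ℝ) : ℝ := max 1 (p - 1)

/-- `q̄ = min {n(p-1)/(n-s), p}`. -/
def qBar (n : ℕ) (s p : ℝ) : ℝ := min ((n : ℝ) * (p - 1) / ((n : ℝ) - s)) p

/-- Gagliardo seminorm raised to the power `p`, as an `ℝ≥0∞`-valued double integral. -/
def gagliardo (n : ℕ) (s p : ℝ) (O : Set (Rn n)) (v : Rn n → ℝ) : ℝ≥0∞ :=
  ∫⁻ x in O, ∫⁻ y in O, ENNReal.ofReal (|v x - v y| ^ p / ‖x - y‖ ^ ((n : ℝ) + s * p))

/-- `v ∈ W^{s,p}(O)`. -/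
def memWsp (n : ℕ) (s p : ℝ) (O : Set (Rn n)) (v : Rn n → ℝ) : Prop :=
  AEMeasurable v (volume.restrict O) ∧
    (∫⁻ x in O, ENNReal.ofReal (|v x| ^ p)) < ⊤ ∧ gagliardo n s p O v < ⊤

/-- `Tail(v; x₀, r)`. -/
def tailFn (n : ℕ) (s p : ℝ) (v : Rn n → ℝ) (x₀ : Rn n) (r : ℝ) : ℝ≥0∞ :=
  (ENNReal.ofReal (r ^ (s * p)) *
      ∫⁻ x in (ball x₀ r)ᶜ,
        ENNReal.ofReal (|v x| ^ (p - 1) / ‖x - x₀‖ ^ ((n : ℝ) + s * p))) ^ (1 / (p - 1))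

/-- `v ∈ L^{p-1}_{sp}(ℝⁿ)`. -/
def memTailSpace (n : ℕ) (s p : ℝ) (v : Rn n → ℝ) : Prop :=
  AEMeasurable v (volume : Measure (Rn n)) ∧
    (∀ R : ℝ, (∫⁻ x in ball (0 : Rn n) R, ENNReal.ofReal (|v x| ^ (p - 1))) < ⊤) ∧
    ∀ z : Rn n, ∀ r : ℝ, 0 < r → tailFn n s p v z r < ⊤

/-- `φ ∈ C_0^∞(O)`. -/
def IsTestFun (n : ℕ) (O : Set (Rn n)) (φ : Rn n → ℝ) : Prop :=
  ContDiff ℝ (⊤ : ℕ∞) φ ∧ HasCompactSupport φ ∧ tsupport φ ⊆ O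

/-- The nonlocal form `⟨-L_Φ u, φ⟩`. -/
def nonlocalForm (n : ℕ) (Φ : ℝ → ℝ) (K : Rn n → Rn n → ℝ) (u φ : Rn n → ℝ) : ℝ :=
  ∫ x : Rn n, ∫ y : Rn n, Φ (u x - u y) * (φ x - φ y) * K x y

/-- Ellipticity/coercivity bounds on the kernel `K`. -/
def KernelBounds (n : ℕ) (Λ s p : ℝ) (K : Rn n → Rn n → ℝ) : Prop :=
  Measurable (Function.uncurry K) ∧
    ∀ x y : Rn n, x ≠ y →
      1 / (Λ * ‖x - y‖ ^ ((n : ℝ) + s * p)) ≤ K x y ∧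
        K x y ≤ Λ / ‖x - y‖ ^ ((n : ℝ) + s * p)

/-- Structure conditions on `Φ`. -/
def PhiBounds (Λ p : ℝ) (Φ : ℝ → ℝ) : Prop :=
  Continuous Φ ∧ Φ 0 = 0 ∧
    ∀ t : ℝ, |t| ^ p / Λ ≤ Φ t * t ∧ Φ t * t ≤ Λ * |t| ^ p

/-- `∫ φ dμ` for a signed measure `μ`. -/
def sintegral (n : ℕ) (μ : MeasureTheory.SignedMeasure (Rn n)) (φ : Rn n → ℝ) : ℝ :=
  (∫ x, φ x ∂μ.toJordanDecomposition.posPart) -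
    ∫ x, φ x ∂μ.toJordanDecomposition.negPart

/-- Weak (energy) solution of `-L_Φ u = f` in `Ω`, `u = g` on `ℝⁿ ∖ Ω`. -/
def WeakSol (n : ℕ) (Φ : ℝ → ℝ) (K : Rn n → Rn n → ℝ) (s p : ℝ)
    (Ω : Set (Rn n)) (f g u : Rn n → ℝ) : Prop :=
  memWsp n s p univ u ∧ (∀ᵐ x : Rn n, x ∉ Ω → u x = g x) ∧
    ∀ φ : Rn n → ℝ, IsTestFun n Ω φ → nonlocalForm n Φ K u φ = ∫ x : Rn n, φ x * f x

/-- Weak subsolution of the homogeneous equation `-L_Φ w = 0` in `Ω`. -/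
def WeakSubSol (n : ℕ) (Φ : ℝ → ℝ) (K : Rn n → Rn n → ℝ) (s p : ℝ)
    (Ω : Set (Rn n)) (w : Rn n → ℝ) : Prop :=
  memWsp n s p univ w ∧
    ∀ φ : Rn n → ℝ, IsTestFun n Ω φ → (∀ x, 0 ≤ φ x) → nonlocalForm n Φ K w φ ≤ 0

/-- The approximation properties required of a SOLA. -/
def SOLAApprox (n : ℕ) (Φ : ℝ → ℝ) (K : Rn n → Rn n → ℝ) (s p : ℝ)
    (Ω : Set (Rn n)) (μ : MeasureTheory.SignedMeasure (Rn n)) (g u : Rn n → ℝ)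
    (uj μj gj : ℕ → Rn n → ℝ) : Prop :=
  (∀ j, ContDiff ℝ (⊤ : ℕ∞) (μj j) ∧ HasCompactSupport (μj j)) ∧
  (∀ j, ContDiff ℝ (⊤ : ℕ∞) (gj j) ∧ HasCompactSupport (gj j)) ∧
  (∀ j, WeakSol n Φ K s p Ω (μj j) (gj j) (uj j)) ∧
  (∀ᵐ x : Rn n, Tendsto (fun j => uj j x) atTop (𝓝 (u x))) ∧
  (∀ q : ℝ, qStar p ≤ q → q < qBar n s p → ∀ z : Rn n, ∀ r : ℝ, 0 < r →
    Tendsto (fun j => ∫⁻ x in ball z r, ENNReal.ofReal (|uj j x - u x| ^ q)) atTop (𝓝 0)) ∧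
  (∀ φ : Rn n → ℝ, Continuous φ → HasCompactSupport φ → tsupport φ ⊆ Ω →
    Tendsto (fun j => ∫ x : Rn n, φ x * μj j x) atTop (𝓝 (sintegral n μ φ))) ∧
  (∀ z : Rn n, ∀ r : ℝ, 0 < r →
    Filter.limsup (fun j => ∫⁻ x in ball z r, ENNReal.ofReal |μj j x|) atTop
      ≤ μ.totalVariation (closedBall z r)) ∧
  (∀ z : Rn n, ∀ r : ℝ, 0 < r →
    Tendsto (fun j =>
        (∫⁻ x in ball z r, ENNReal.ofReal (|gj j x - g x| ^ p)) +
          gagliardo n s p (ball z r) (fun x => gj j x - g x)) atTop (𝓝 0) ∧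
      Tendsto (fun j => tailFn n s p (fun x => gj j x - g x) z r) atTop (𝓝 0))

/-- SOLA of the Dirichlet problem `-L_Φ u = μ` in `Ω`, `u = g` on `ℝⁿ ∖ Ω`. -/
def IsSOLA (n : ℕ) (Φ : ℝ → ℝ) (K : Rn n → Rn n → ℝ) (s p : ℝ)
    (Ω : Set (Rn n)) (μ : MeasureTheory.SignedMeasure (Rn n)) (g u : Rn n → ℝ) : Prop :=
  (∀ h q : ℝ, 0 < h → h < s → qStar p ≤ q → q < qBar n s p → memWsp n h q Ω u) ∧
  (∀ φ : Rn n → ℝ, IsTestFun n Ω φ → nonlocalForm n Φ K u φ = sintegral n μ φ) ∧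
  (∀ᵐ x : Rn n, x ∉ Ω → u x = g x) ∧
  ∃ uj μj gj : ℕ → Rn n → ℝ, SOLAApprox n Φ K s p Ω μ g u uj μj gj

/-- Truncated Wolff potential `W^ν_{s,p}(x₀, r)`. -/
def wolff (n : ℕ) (s p : ℝ) (ν : Measure (Rn n)) (x₀ : Rn n) (r : ℝ) : ℝ≥0∞ :=
  ∫⁻ ρ in Ioc (0 : ℝ) r,
    (ν (ball x₀ ρ) / ENNReal.ofReal (ρ ^ ((n : ℝ) - s * p))) ^ (1 / (p - 1)) /
      ENNReal.ofReal ρ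

/-- Integral average of `u` over `B_r(x₀)`. -/
def ballAvg (n : ℕ) (u : Rn n → ℝ) (x₀ : Rn n) (r : ℝ) : ℝ :=
  ⨍ x in ball x₀ r, u x

/-- Local excess `A(f; x₀, r)`. -/
def locExcess (n : ℕ) (p : ℝ) (f : Rn n → ℝ) (x₀ : Rn n) (r : ℝ) : ℝ≥0∞ :=
  ((volume (ball x₀ r))⁻¹ *
      ∫⁻ x in ball x₀ r, ENNReal.ofReal (|f x - ballAvg n f x₀ r| ^ qStar p)) ^ (1 / qStar p)

/-- Global excess `E(f; x₀, r)`. -/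
def excess (n : ℕ) (s p : ℝ) (f : Rn n → ℝ) (x₀ : Rn n) (r : ℝ) : ℝ≥0∞ :=
  locExcess n p f x₀ r + tailFn n s p (fun x => f x - ballAvg n f x₀ r) x₀ r

/-- `g ∈ W^{s,p}_loc(ℝⁿ) ∩ L^{p-1}_{sp}(ℝⁿ)`. -/
def BoundaryDatum (n : ℕ) (s p : ℝ) (g : Rn n → ℝ) : Prop :=
  (∀ z : Rn n, ∀ r : ℝ, 0 < r → memWsp n s p (ball z r) g) ∧ memTailSpace n s p g

/-- Symmetric measurable kernel with ellipticity bounds. -/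
def SymKernel (n : ℕ) (Λ s p : ℝ) (Kt : Rn n → Rn n → ℝ) : Prop :=
  KernelBounds n Λ s p Kt ∧ ∀ x y : Rn n, Kt x y = Kt y x

/-- Weak solution of the kernel-`Kt` fractional `p`-Laplace equation with datum `f` in `O`. -/
def WeakSolP (n : ℕ) (Kt : Rn n → Rn n → ℝ) (s p : ℝ) (O : Set (Rn n))
    (f u : Rn n → ℝ) : Prop :=
  memWsp n s p univ u ∧
    ∀ φ : Rn n → ℝ, IsTestFun n O φ →
      (∫ x : Rn n, ∫ y : Rn n,
          |u x - u y| ^ (p - 2) * (u x - u y) * (φ x - φ y) * Kt x y) =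
        ∫ x : Rn n, φ x * f x

/-! ### Elementary inequalities -/

lemma add_rpow_le_two_rpow_mul {t x y : ℝ} (ht : 0 ≤ t) (hx : 0 ≤ x) (hy : 0 ≤ y) :
    (x + y) ^ t ≤ 2 ^ t * (x ^ t + y ^ t) := by
  have hx' := Real.rpow_nonneg hx t
  have hy' := Real.rpow_nonneg hy t
  have h2 : (0 : ℝ) ≤ 2 ^ t := by positivity
  rcases le_total x y with h | h
  · calc (x + y) ^ t ≤ (2 * y) ^ t := Real.rpow_le_rpow (by positivity) (by linarith) ht
      _ = 2 ^ t * y ^ t := Real.mul_rpow (by norm_num) hy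
      _ ≤ _ := by gcongr; linarith
  · calc (x + y) ^ t ≤ (2 * x) ^ t := Real.rpow_le_rpow (by positivity) (by linarith) ht
      _ = 2 ^ t * x ^ t := Real.mul_rpow (by norm_num) hx
      _ ≤ _ := by gcongr; linarith

lemma one_add_mul_one_sub_le_rpow_neg {x τ : ℝ} (hx : 0 < x) (hτ : 0 ≤ τ) :
    1 + τ * (1 - x) ≤ x ^ (-τ) := by
  rw [Real.rpow_def_of_pos hx]
  have h1 := Real.add_one_le_exp (Real.log x * -τ)
  have h2 := Real.log_le_sub_one_of_pos hx
  nlinarith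

lemma rpow_sub_rpow_le {p e f : ℝ} (hp : 1 ≤ p) (he : 0 ≤ e) (hef : e ≤ f) :
    f ^ p - e ^ p ≤ p * f ^ (p - 1) * (f - e) := by
  rcases hef.eq_or_lt with rfl | hlt
  · simp
  have hf : 0 < f := he.trans_lt hlt
  have h := one_add_mul_self_le_rpow_one_add (s := e / f - 1)
    (by have := div_nonneg he hf.le; linarith) hp
  have h1 : 1 + (e / f - 1) = e / f := by ring
  rw [h1, Real.div_rpow he hf.le, le_div_iff₀ (Real.rpow_pos_of_pos hf p)] at h
  have h2 : f ^ p = f ^ (p - 1) * f := by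
    conv_rhs => rw [← Real.rpow_add_one hf.ne' (p - 1)]
    ring_nf
  have h3 : (1 + p * (e / f - 1)) * f ^ p = f ^ p - p * f ^ (p - 1) * (f - e) := by
    rw [h2]; field_simp; ring
  linarith

/-- The bounded concave truncation used as a test function. -/
def truncH (τ t : ℝ) : ℝ := 1 - (1 + max t 0) ^ (-τ)

/-- The power whose energy is controlled by testing with `truncH`. -/
def powW (θ t : ℝ) : ℝ := (1 + max t 0) ^ θ - 1

/-- The growth function appearing on the right of the energy estimate. -/
def growG (m t : ℝ) : ℝ := if 0 < t then (1 + t) ^ m else 0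

lemma growG_nonneg (m t : ℝ) : 0 ≤ growG m t := by
  unfold growG; split_ifs <;> positivity

lemma truncH_nonneg {τ : ℝ} (hτ : 0 ≤ τ) (t : ℝ) : 0 ≤ truncH τ t := by
  have : (1 + max t 0) ^ (-τ) ≤ 1 :=
    Real.rpow_le_one_of_one_le_of_nonpos (by simp) (by linarith)
  unfold truncH; linarith

lemma truncH_le_one (τ t : ℝ) : truncH τ t ≤ 1 := by
  have : 0 ≤ (1 + max t 0) ^ (-τ) := by positivity
  unfold truncH; linarith

lemma truncH_of_nonpos (τ : ℝ) {t : ℝ} (ht : t ≤ 0) : truncH τ t = 0 := by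
  simp [truncH, ht]

lemma powW_of_nonpos (θ : ℝ) {t : ℝ} (ht : t ≤ 0) : powW θ t = 0 := by
  simp [powW, ht]

lemma powW_nonneg {θ : ℝ} (hθ : 0 ≤ θ) (t : ℝ) : 0 ≤ powW θ t := by
  have : 1 ≤ (1 + max t 0) ^ θ := Real.one_le_rpow (by simp) hθ
  unfold powW; linarith

lemma powW_mono {θ : ℝ} (hθ : 0 ≤ θ) {a b : ℝ} (hab : b ≤ a) : powW θ b ≤ powW θ a := by
  unfold powW
  have : (1 + max b 0) ^ θ ≤ (1 + max a 0) ^ θ :=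
    Real.rpow_le_rpow (by positivity) (by gcongr) hθ
  linarith

lemma mul_sub_le_truncH_sub {τ : ℝ} (hτ : 0 ≤ τ) (a b : ℝ) :
    τ * (1 + max a 0) ^ (-τ) * ((max a 0 - max b 0) / (1 + max a 0)) ≤
      truncH τ a - truncH τ b := by
  have hA : 0 < 1 + max a 0 := by positivity
  have hB : 0 < 1 + max b 0 := by positivity
  have h := one_add_mul_one_sub_le_rpow_neg (div_pos hB hA) hτ
  rw [Real.div_rpow hB.le hA.le, le_div_iff₀ (by positivity)] at h
  have : 1 - (1 + max b 0) / (1 + max a 0) = (max a 0 - max b 0) / (1 + max a 0) := by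
    field_simp; ring
  rw [this] at h
  unfold truncH
  nlinarith

lemma truncH_mono {τ a b : ℝ} (hτ : 0 ≤ τ) (hab : b ≤ a) : truncH τ b ≤ truncH τ a := by
  have h := mul_sub_le_truncH_sub hτ a b
  have : 0 ≤ τ * (1 + max a 0) ^ (-τ) * ((max a 0 - max b 0) / (1 + max a 0)) := by
    have : max b 0 ≤ max a 0 := by gcongr
    have : 0 ≤ max a 0 - max b 0 := by linarith
    positivity
  linarith

lemma powW_sub_rpow_le {p τ a b : ℝ} (hp : 1 < p) (hτ : 0 < τ) (hτp : τ < p - 1)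
    (hab : b ≤ a) :
    τ * (powW ((p - 1 - τ) / p) a - powW ((p - 1 - τ) / p) b) ^ p ≤
      (a - b) ^ (p - 1) * (truncH τ a - truncH τ b) := by
  set θ := (p - 1 - τ) / p with hθ
  have hp0 : 0 < p := by linarith
  have hθ0 : 0 < θ := by apply div_pos <;> linarith
  have hθ1 : θ ≤ 1 := by rw [hθ, div_le_one hp0]; linarith
  set A := 1 + max a 0 with hA_def
  set B := 1 + max b 0 with hB_def
  have hA : 0 < A := by positivity
  have hB : 0 < B := by positivity
  have hBA : B ≤ A := by rw [hA_def, hB_def]; gcongr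
  have hD : A - B ≤ a - b := by
    rw [hA_def, hB_def]
    rcases le_total a 0 with h1 | h1 <;> rcases le_total b 0 with h2 | h2 <;>
      simp [h1, h2] <;> linarith
  have h1 := mul_sub_le_truncH_sub hτ.le a b
  rw [← hA_def] at h1
  have hAB : max a 0 - max b 0 = A - B := by rw [hA_def, hB_def]; ring
  rw [hAB] at h1
  -- the increment of `powW`
  have hx0 : 0 < B / A := by positivity
  have hx1 : B / A ≤ 1 := by rw [div_le_one hA]; exact hBA
  have h2 : powW θ a - powW θ b ≤ A ^ θ * ((A - B) / A) := by
    have h3 : B / A ≤ (B / A) ^ θ := by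
      simpa using Real.rpow_le_rpow_of_exponent_ge hx0 hx1 hθ1
    rw [Real.div_rpow hB.le hA.le] at h3
    have h4 : powW θ a - powW θ b = A ^ θ * (1 - B ^ θ / A ^ θ) := by
      unfold powW
      rw [← hA_def, ← hB_def]
      have : A ^ θ ≠ 0 := by positivity
      field_simp; ring
    rw [h4]
    have h5 : (A - B) / A = 1 - B / A := by field_simp
    rw [h5]; gcongr
  have h0 : 0 ≤ powW θ a - powW θ b := by linarith [powW_mono hθ0.le hab]
  have hy : 0 ≤ (A - B) / A := div_nonneg (by linarith) hA.le
  set y := (A - B) / A with hy_def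
  have hAy : A * y = A - B := by rw [hy_def]; field_simp
  calc τ * (powW θ a - powW θ b) ^ p ≤ τ * (A ^ θ * y) ^ p := by gcongr
    _ = τ * ((A ^ (p - 1) * A ^ (-τ)) * (y ^ (p - 1) * y)) := by
        rw [Real.mul_rpow (by positivity) hy, ← Real.rpow_mul hA.le, ← Real.rpow_add hA]
        congr 2
        · congr 1; rw [hθ]; field_simp; ring
        · rcases hy.eq_or_lt with h | h
          · rw [← h]; simp [hp0.ne']
          · rw [← Real.rpow_add_one h.ne']; ring_nf
    _ = (A * y) ^ (p - 1) * (τ * A ^ (-τ) * y) := by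
        rw [Real.mul_rpow hA.le hy]; ring
    _ ≤ (a - b) ^ (p - 1) * (truncH τ a - truncH τ b) := by
        rw [hAy]
        have : 0 ≤ A - B := by linarith
        gcongr

set_option maxHeartbeats 1000000 in
/-- Pointwise energy inequality, ordered version. -/
lemma energy_pointwise_of_le {Λ p τ m a b e f P : ℝ} (hΛ : 1 ≤ Λ) (hp : 1 < p) (hτ : 0 < τ)
    (hτp : τ < p - 1) (hm : (1 + τ) * (p - 1) ≤ m) (he : 0 ≤ e)
    (hf : 0 ≤ f) (hab : b ≤ a) (hP1 : (a - b) ^ (p - 1) / Λ ≤ P)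
    (hP2 : P ≤ Λ * (a - b) ^ (p - 1)) :
    τ / (2 * Λ * 2 ^ p) *
        |powW ((p - 1 - τ) / p) a * e - powW ((p - 1 - τ) / p) b * f| ^ p ≤
      P * (truncH τ a * e ^ p - truncH τ b * f ^ p) +
        (τ / (2 * Λ) + Λ * p * (2 * p / τ) ^ (p - 1)) * (growG m a + growG m b) * |e - f| ^ p := by
  set θ := (p - 1 - τ) / p with hθ
  have hp0 : 0 < p := by linarith
  have hθ0 : 0 < θ := by apply div_pos <;> linarith
  have hΛ0 : 0 < Λ := by linarith
  have hab0 : 0 ≤ a - b := by linarith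
  have hP0 : 0 ≤ P := le_trans (by positivity) hP1
  have hWa := powW_nonneg hθ0.le a
  have hWb := powW_nonneg hθ0.le b
  have hWab := powW_mono hθ0.le hab
  have hHa := truncH_nonneg hτ.le a
  have hHb := truncH_nonneg hτ.le b
  have hHab := truncH_mono hτ.le hab
  have hHa1 := truncH_le_one τ a
  have hGa := growG_nonneg m a
  have hGb := growG_nonneg m b
  have hcore := powW_sub_rpow_le hp hτ hτp hab
  rw [← hθ] at hcore
  have hWG : ∀ t, powW θ t ^ p ≤ growG m t := by
    intro t
    rcases le_or_gt t 0 with ht | ht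
    · rw [powW_of_nonpos θ ht, Real.zero_rpow hp0.ne']; exact growG_nonneg m t
    · unfold growG
      rw [if_pos ht]
      calc powW θ t ^ p ≤ ((1 + t) ^ θ) ^ p := by
            apply Real.rpow_le_rpow (powW_nonneg hθ0.le t) _ hp0.le
            unfold powW; rw [max_eq_left ht.le]; linarith
        _ = (1 + t) ^ (θ * p) := by rw [← Real.rpow_mul (by linarith)]
        _ ≤ (1 + t) ^ m := by
            apply Real.rpow_le_rpow_of_exponent_le (by linarith)
            have : θ * p = p - 1 - τ := by rw [hθ]; field_simp
            rw [this]; nlinarith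
  have hgood : ∀ g : ℝ, 0 ≤ g →
      τ / Λ * ((powW θ a - powW θ b) * g) ^ p ≤ P * (truncH τ a - truncH τ b) * g ^ p := by
    intro g hg
    rw [Real.mul_rpow (by linarith) hg, ← mul_assoc]
    have : τ / Λ * (powW θ a - powW θ b) ^ p ≤ P * (truncH τ a - truncH τ b) := by
      calc τ / Λ * (powW θ a - powW θ b) ^ p = (τ * (powW θ a - powW θ b) ^ p) / Λ := by ring
        _ ≤ ((a - b) ^ (p - 1) * (truncH τ a - truncH τ b)) / Λ := by gcongr
        _ = (a - b) ^ (p - 1) / Λ * (truncH τ a - truncH τ b) := by ring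
        _ ≤ _ := by
          have : 0 ≤ truncH τ a - truncH τ b := by linarith
          gcongr
    have := Real.rpow_nonneg hg p
    gcongr
  have h2p : (0 : ℝ) < 2 ^ p := by positivity
  set C2 := Λ * p * (2 * p / τ) ^ (p - 1) with hC2
  have hC2' : 0 ≤ C2 := by positivity
  have hsplit : ∀ g h : ℝ, 0 ≤ g → 0 ≤ h → 
      ∀ X, X ≤ (powW θ a - powW θ b) * g + h → 0 ≤ X →
      τ / (2 * Λ * 2 ^ p) * X ^ p ≤
        1 / 2 * (P * (truncH τ a - truncH τ b) * g ^ p) + τ / (2 * Λ) * h ^ p := by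
    intro g h hg hh X hX hX0
    have h1 : 0 ≤ (powW θ a - powW θ b) * g := mul_nonneg (by linarith) hg
    have h2 := add_rpow_le_two_rpow_mul hp0.le h1 hh
    have h3 := hgood g hg
    calc τ / (2 * Λ * 2 ^ p) * X ^ p ≤ τ / (2 * Λ * 2 ^ p) *
          (2 ^ p * (((powW θ a - powW θ b) * g) ^ p + h ^ p)) := by
          gcongr
          exact (Real.rpow_le_rpow hX0 hX hp0.le).trans h2
      _ = 1 / 2 * (τ / Λ * ((powW θ a - powW θ b) * g) ^ p) + τ / (2 * Λ) * h ^ p := by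
          field_simp
      _ ≤ _ := by gcongr
  rcases le_total f e with hfe | hef
  · -- case `f ≤ e`
    have habs : |e - f| = e - f := abs_of_nonneg (by linarith)
    have hW : |powW θ a * e - powW θ b * f| = powW θ a * e - powW θ b * f :=
      abs_of_nonneg (by nlinarith)
    have hef0 : 0 ≤ e - f := by linarith
    have h1 := hsplit e (powW θ b * (e - f)) he (by positivity)
      (|powW θ a * e - powW θ b * f|) (by rw [hW]; nlinarith) (abs_nonneg _)
    rw [Real.mul_rpow hWb hef0] at h1
    rw [habs]
    have h2 : P * (truncH τ a - truncH τ b) * e ^ p ≤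
        P * (truncH τ a * e ^ p - truncH τ b * f ^ p) := by
      have : f ^ p ≤ e ^ p := Real.rpow_le_rpow hf hfe hp0.le
      rw [mul_assoc]
      gcongr
      nlinarith
    have h3 : 0 ≤ P * (truncH τ a - truncH τ b) * e ^ p := by
      have : 0 ≤ truncH τ a - truncH τ b := by linarith
      positivity
    have h4 : powW θ b ^ p * (e - f) ^ p ≤ (growG m a + growG m b) * (e - f) ^ p := by
      have := hWG b
      gcongr
      linarith
    have h5 : 0 ≤ C2 * ((growG m a + growG m b) * (e - f) ^ p) := by positivity
    have h6 : τ / (2 * Λ) * (powW θ b ^ p * (e - f) ^ p) ≤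
      τ / (2 * Λ) * ((growG m a + growG m b) * (e - f) ^ p) := by gcongr
    linarith
  · -- case `e ≤ f`
    have habs : |e - f| = f - e := by rw [abs_sub_comm]; exact abs_of_nonneg (by linarith)
    have hfe0 : 0 ≤ f - e := by linarith
    rw [habs]
    rcases le_or_gt b 0 with hb | hb
    · have hWb0 := powW_of_nonpos θ hb
      have hHb0 := truncH_of_nonpos τ hb
      have h1 := hsplit e 0 he le_rfl (|powW θ a * e - powW θ b * f|)
        (by rw [hWb0]; simp [abs_of_nonneg (mul_nonneg hWa he)]) (abs_nonneg _)
      rw [Real.zero_rpow hp0.ne'] at h1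
      have h3 : 0 ≤ P * (truncH τ a - truncH τ b) * e ^ p := by
        have : 0 ≤ truncH τ a - truncH τ b := by linarith
        positivity
      rw [hHb0] at h1 h3 ⊢
      have h5 : 0 ≤ (τ / (2 * Λ) + C2) * (growG m a + growG m b) * (f - e) ^ p := by positivity
      linarith
    · have ha : 0 < a := hb.trans_le hab
      have hW : |powW θ a * e - powW θ b * f| ≤
          (powW θ a - powW θ b) * f + powW θ a * (f - e) := by
        rw [abs_le]; constructor <;> nlinarith
      have h1 := hsplit f (powW θ a * (f - e)) hf (by positivity)
        (|powW θ a * e - powW θ b * f|) hW (abs_nonneg _)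
      rw [Real.mul_rpow hWa hfe0] at h1
      have hdiff := rpow_sub_rpow_le hp.le he hef
      have h4 : powW θ a ^ p * (f - e) ^ p ≤ (growG m a + growG m b) * (f - e) ^ p := by
        have := hWG a
        gcongr
        linarith
      have h6 : τ / (2 * Λ) * (powW θ a ^ p * (f - e) ^ p) ≤
        τ / (2 * Λ) * ((growG m a + growG m b) * (f - e) ^ p) := by gcongr
      have hid : P * (truncH τ a * e ^ p - truncH τ b * f ^ p) =
        P * (truncH τ a - truncH τ b) * f ^ p - P * truncH τ a * (f ^ p - e ^ p) := by ring
      have hbad : P * truncH τ a * (f ^ p - e ^ p) ≤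
          P * truncH τ a * (p * f ^ (p - 1) * (f - e)) := by gcongr
      have hf2 : f ^ p = f ^ (p - 1) * f := by
        rcases hf.eq_or_lt with h | h
        · rw [← h]; simp [hp0.ne']
        · rw [← Real.rpow_add_one h.ne']; ring_nf
      have hfp1 : 0 ≤ f ^ (p - 1) := by positivity
      have h5 : 0 ≤ C2 * ((growG m a + growG m b) * (f - e) ^ p) := by positivity
      have hgd : 0 ≤ P * (truncH τ a - truncH τ b) * f ^ p := by
        have : 0 ≤ truncH τ a - truncH τ b := by linarith
        positivity
      rcases le_or_gt (truncH τ a * p * (f - e)) (1 / 2 * ((truncH τ a - truncH τ b) * f))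
        with hc | hc
      · have h7 : P * truncH τ a * (p * f ^ (p - 1) * (f - e)) ≤
            1 / 2 * (P * (truncH τ a - truncH τ b) * f ^ p) := by
          rw [hf2]
          have := mul_le_mul_of_nonneg_left hc (mul_nonneg hP0 hfp1)
          linarith
        linarith
      · have h8 : f * (a - b) ≤ (2 * p / τ) * (1 + a) ^ (1 + τ) * (f - e) := by
          have h9 := mul_sub_le_truncH_sub hτ.le a b
          rw [max_eq_left ha.le, max_eq_left hb.le] at h9
          have hA : 0 < 1 + a := by linarith
          have h10 : τ * (1 + a) ^ (-τ) * ((a - b) / (1 + a)) * f ≤ 2 * p * (f - e) := by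
            have : truncH τ a * p * (f - e) ≤ 1 * p * (f - e) := by gcongr
            have := mul_le_mul_of_nonneg_right h9 hf
            nlinarith
          have h11 : (1 + a) ^ (1 + τ) * (1 + a) ^ (-τ) = 1 + a := by
            rw [← Real.rpow_add hA]; simp
          have h12 := mul_le_mul_of_nonneg_left h10
            (show 0 ≤ (1 + a) ^ (1 + τ) / τ by positivity)
          have h13 : (1 + a) ^ (1 + τ) / τ * (τ * (1 + a) ^ (-τ) * ((a - b) / (1 + a)) * f) =
              f * (a - b) := by
            calc _ = ((1 + a) ^ (1 + τ) * (1 + a) ^ (-τ)) * ((a - b) / (1 + a)) * f := by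
                  field_simp
              _ = _ := by rw [h11]; field_simp
          rw [h13] at h12
          calc _ ≤ _ := h12
            _ = _ := by ring
        have h14 : f ^ (p - 1) * (a - b) ^ (p - 1) ≤
            (2 * p / τ) ^ (p - 1) * growG m a * (f - e) ^ (p - 1) := by
          rw [← Real.mul_rpow hf hab0]
          calc (f * (a - b)) ^ (p - 1) ≤ ((2 * p / τ) * (1 + a) ^ (1 + τ) * (f - e)) ^ (p - 1) :=
                Real.rpow_le_rpow (by positivity) h8 (by linarith)
            _ = (2 * p / τ) ^ (p - 1) * (1 + a) ^ ((1 + τ) * (p - 1)) * (f - e) ^ (p - 1) := by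
                rw [Real.mul_rpow (by positivity) hfe0, Real.mul_rpow (by positivity)
                  (by positivity), ← Real.rpow_mul (by linarith)]
            _ ≤ _ := by
                unfold growG
                rw [if_pos ha]
                gcongr
                linarith
        have hef2 : (f - e) ^ p = (f - e) ^ (p - 1) * (f - e) := by
          rcases hfe0.eq_or_lt with h | h
          · rw [← h]; simp [hp0.ne']
          · rw [← Real.rpow_add_one h.ne']; ring_nf
        have h15 : P * truncH τ a * (p * f ^ (p - 1) * (f - e)) ≤
            C2 * ((growG m a + growG m b) * (f - e) ^ p) := by
          calc P * truncH τ a * (p * f ^ (p - 1) * (f - e))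
              ≤ (Λ * (a - b) ^ (p - 1)) * 1 * (p * f ^ (p - 1) * (f - e)) := by gcongr
            _ = Λ * p * (f ^ (p - 1) * (a - b) ^ (p - 1)) * (f - e) := by ring
            _ ≤ Λ * p * ((2 * p / τ) ^ (p - 1) * growG m a * (f - e) ^ (p - 1)) * (f - e) := by
                gcongr
            _ = C2 * (growG m a * (f - e) ^ p) := by rw [hef2, hC2]; ring
            _ ≤ _ := by gcongr; linarith
        linarith

lemma PhiBounds.bounds_of_nonneg {Λ p t : ℝ} {Φ : ℝ → ℝ} (hΦ : PhiBounds Λ p Φ) (hp : 1 < p)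
    (ht : 0 ≤ t) : t ^ (p - 1) / Λ ≤ Φ t ∧ Φ t ≤ Λ * t ^ (p - 1) := by
  rcases ht.eq_or_lt with rfl | ht
  · simp [hΦ.2.1, Real.zero_rpow (by linarith : p - 1 ≠ 0)]
  obtain ⟨h1, h2⟩ := hΦ.2.2 t
  have h3 : |t| ^ p = t ^ (p - 1) * t := by
    rw [abs_of_pos ht, ← Real.rpow_add_one ht.ne']; ring_nf
  rw [h3] at h1 h2
  constructor
  · refine le_of_mul_le_mul_right ?_ ht
    calc _ = t ^ (p - 1) * t / Λ := by ring
      _ ≤ _ := h1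
  · refine le_of_mul_le_mul_right ?_ ht
    linarith

/-- The structure conditions are invariant under reflection. -/
lemma PhiBounds.neg_comp_neg {Λ p : ℝ} {Φ : ℝ → ℝ} (hΦ : PhiBounds Λ p Φ) :
    PhiBounds Λ p (fun t => -Φ (-t)) := by
  refine ⟨(hΦ.1.comp continuous_neg).neg, by simp [hΦ.2.1], fun t => ?_⟩
  have := hΦ.2.2 (-t)
  rw [abs_neg] at this
  constructor <;> linarith [this.1, this.2]

/-- The structure conditions are invariant under the natural scaling. -/
lemma PhiBounds.scale {Λ p δ : ℝ} {Φ : ℝ → ℝ} (hΦ : PhiBounds Λ p Φ) (hδ : 0 < δ) :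
    PhiBounds Λ p (fun t => δ ^ (1 - p) * Φ (δ * t)) := by
  refine ⟨by have := hΦ.1; fun_prop, by simp [hΦ.2.1], fun t => ?_⟩
  obtain ⟨h1, h2⟩ := hΦ.2.2 (δ * t)
  have h3 : |δ * t| ^ p = δ ^ p * |t| ^ p := by
    rw [abs_mul, abs_of_pos hδ, Real.mul_rpow hδ.le (abs_nonneg _)]
  rw [h3] at h1 h2
  have h4 : δ ^ (1 - p) = δ * (δ ^ p)⁻¹ := by
    rw [Real.rpow_sub hδ, Real.rpow_one]; rfl
  have h5 : 0 < δ ^ p := by positivity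
  have h6 : δ ^ (1 - p) * Φ (δ * t) * t = (δ ^ p)⁻¹ * (Φ (δ * t) * (δ * t)) := by
    rw [h4]; ring
  rw [h6]
  constructor
  · calc |t| ^ p / Λ = (δ ^ p)⁻¹ * (δ ^ p * |t| ^ p / Λ) := by field_simp
      _ ≤ _ := by gcongr
  · calc _ ≤ (δ ^ p)⁻¹ * (Λ * (δ ^ p * |t| ^ p)) := by gcongr
      _ = _ := by field_simp

lemma PhiBounds.abs_le {Λ p : ℝ} {Φ : ℝ → ℝ} (hΦ : PhiBounds Λ p Φ) (hp : 1 < p)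
    (hΛ : 1 ≤ Λ) (t : ℝ) : |Φ t| ≤ Λ * |t| ^ (p - 1) := by
  rcases le_total 0 t with ht | ht
  · obtain ⟨h1, h2⟩ := hΦ.bounds_of_nonneg hp ht
    rw [abs_of_nonneg (le_trans (by positivity) h1), abs_of_nonneg ht]; exact h2
  · obtain ⟨h1, h2⟩ := hΦ.neg_comp_neg.bounds_of_nonneg hp (neg_nonneg.2 ht)
    rw [neg_neg] at h1 h2
    rw [← abs_neg, abs_of_nonneg (le_trans (by have := neg_nonneg.2 ht; positivity) h1),
      abs_of_nonpos ht]; exact h2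

lemma growG_one_le {m t : ℝ} (hm : 0 ≤ m) (ht : 0 < t) : 1 ≤ growG m t := by
  unfold growG; rw [if_pos ht]; exact Real.one_le_rpow (by linarith) hm

lemma powW_rpow_le_growG {p τ m : ℝ} (hp : 1 < p) (hτ : 0 < τ) (hτp : τ < p - 1)
    (hm : (1 + τ) * (p - 1) ≤ m) (t : ℝ) :
    powW ((p - 1 - τ) / p) t ^ p ≤ growG m t := by
  have hp0 : 0 < p := by linarith
  have hθ0 : 0 < (p - 1 - τ) / p := by apply div_pos <;> linarith
  rcases le_or_gt t 0 with ht | ht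
  · rw [powW_of_nonpos _ ht, Real.zero_rpow hp0.ne']; exact growG_nonneg m t
  · unfold growG
    rw [if_pos ht]
    calc powW ((p - 1 - τ) / p) t ^ p ≤ ((1 + t) ^ ((p - 1 - τ) / p)) ^ p := by
          apply Real.rpow_le_rpow (powW_nonneg hθ0.le t) _ hp0.le
          unfold powW; rw [max_eq_left ht.le]; linarith
      _ = (1 + t) ^ ((p - 1 - τ) / p * p) := by rw [← Real.rpow_mul (by linarith)]
      _ ≤ (1 + t) ^ m := by
          apply Real.rpow_le_rpow_of_exponent_le (by linarith)
          have : (p - 1 - τ) / p * p = p - 1 - τ := by field_simp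
          rw [this]; nlinarith

lemma energy_pointwise_far {Λ p τ m a b e : ℝ} {Φ : ℝ → ℝ} (hΦ : PhiBounds Λ p Φ)
    (hΛ : 1 ≤ Λ) (hp : 1 < p) (hτ : 0 < τ) (hτp : τ < p - 1) (hm : (1 + τ) * (p - 1) ≤ m)
    (he : 0 ≤ e) (he1 : e ≤ 1) :
    |powW ((p - 1 - τ) / p) a * e| ^ p ≤
      Φ (a - b) * (truncH τ a * e ^ p) + Λ * growG m a * (1 + max b 0 ^ (p - 1)) := by
  have hp0 : 0 < p := by linarith
  have hθ0 : 0 < (p - 1 - τ) / p := by apply div_pos <;> linarith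
  have hG := growG_nonneg m a
  have hm0 : 0 ≤ m := by nlinarith
  have hep : e ^ p ≤ 1 := Real.rpow_le_one he he1 hp0.le
  have hep0 : 0 ≤ e ^ p := by positivity
  have hH0 := truncH_nonneg hτ.le a
  have hH1 := truncH_le_one τ a
  have h1 : |powW ((p - 1 - τ) / p) a * e| ^ p ≤ growG m a := by
    rw [abs_of_nonneg (mul_nonneg (powW_nonneg hθ0.le a) he),
      Real.mul_rpow (powW_nonneg hθ0.le a) he]
    calc _ ≤ growG m a * 1 := by
          gcongr
          exact powW_rpow_le_growG hp hτ hτp hm a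
      _ = _ := mul_one _
  have h2 : -(Λ * growG m a * max b 0 ^ (p - 1)) ≤ Φ (a - b) * (truncH τ a * e ^ p) := by
    rcases le_or_gt a 0 with ha | ha
    · rw [truncH_of_nonpos τ ha]
      have : 0 ≤ Λ * growG m a * max b 0 ^ (p - 1) := by positivity
      linarith
    · have hG1 : 1 ≤ growG m a := growG_one_le hm0 ha
      have hX0 : 0 ≤ truncH τ a * e ^ p := by positivity
      have hX1 : truncH τ a * e ^ p ≤ 1 := by
        calc _ ≤ 1 * 1 := by gcongr
          _ = (1 : ℝ) := by norm_num
      rcases le_total b a with hab | hab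
      · have h3 := (hΦ.bounds_of_nonneg hp (sub_nonneg.2 hab)).1
        have h4 : 0 ≤ Φ (a - b) :=
          le_trans (div_nonneg (Real.rpow_nonneg (by linarith) _) (by linarith)) h3
        have h5 : 0 ≤ Λ * growG m a * max b 0 ^ (p - 1) := by positivity
        nlinarith [mul_nonneg h4 hX0]
      · have h3 := (hΦ.neg_comp_neg.bounds_of_nonneg hp (sub_nonneg.2 hab)).2
        have h3' := (hΦ.neg_comp_neg.bounds_of_nonneg hp (sub_nonneg.2 hab)).1
        rw [neg_sub] at h3 h3'
        have h4 : (b - a) ^ (p - 1) ≤ max b 0 ^ (p - 1) :=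
          Real.rpow_le_rpow (by linarith) (le_trans (by linarith) (le_max_left _ _))
            (by linarith)
        have h6 : 0 ≤ -Φ (a - b) :=
          le_trans (div_nonneg (Real.rpow_nonneg (by linarith) _) (by linarith)) h3'
        have h5 : -Φ (a - b) * (truncH τ a * e ^ p) ≤ Λ * growG m a * max b 0 ^ (p - 1) := by
          calc -Φ (a - b) * (truncH τ a * e ^ p) ≤ -Φ (a - b) * 1 := by gcongr
            _ ≤ Λ * max b 0 ^ (p - 1) := by
              rw [mul_one]; exact h3.trans (by gcongr)
            _ = Λ * 1 * max b 0 ^ (p - 1) := by ring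
            _ ≤ _ := by gcongr
        linarith
  nlinarith

/-- Pointwise energy inequalities: near pairs and pairs one of whose members lies outside the
support of the cutoff. -/
lemma exists_energy_pointwise {Λ p τ m : ℝ} (hΛ : 1 ≤ Λ) (hp : 1 < p) (hτ : 0 < τ)
    (hτp : τ < p - 1) (hm : (1 + τ) * (p - 1) ≤ m) :
    ∃ c C : ℝ, 0 < c ∧ 0 < C ∧ ∀ Φ : ℝ → ℝ, PhiBounds Λ p Φ → ∀ a b e f : ℝ,
      0 ≤ e → e ≤ 1 → 0 ≤ f → f ≤ 1 →
      (c * |powW ((p - 1 - τ) / p) a * e - powW ((p - 1 - τ) / p) b * f| ^ p ≤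
        Φ (a - b) * (truncH τ a * e ^ p - truncH τ b * f ^ p) +
          C * ((growG m a + growG m b) * |e - f| ^ p)) ∧
      (f = 0 → c * |powW ((p - 1 - τ) / p) a * e - powW ((p - 1 - τ) / p) b * f| ^ p ≤
        Φ (a - b) * (truncH τ a * e ^ p - truncH τ b * f ^ p) +
          C * (growG m a * (1 + max b 0 ^ (p - 1)))) ∧
      (e = 0 → c * |powW ((p - 1 - τ) / p) a * e - powW ((p - 1 - τ) / p) b * f| ^ p ≤
        Φ (a - b) * (truncH τ a * e ^ p - truncH τ b * f ^ p) +
          C * (growG m b * (1 + max a 0 ^ (p - 1)))) := by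
  have hp0 : 0 < p := by linarith
  have hΛ0 : 0 < Λ := by linarith
  set c₁ := τ / (2 * Λ * 2 ^ p) with hc₁
  set C₁ := τ / (2 * Λ) + Λ * p * (2 * p / τ) ^ (p - 1) with hC₁
  have hc₁0 : 0 < c₁ := by positivity
  have hC₁0 : 0 < C₁ := by positivity
  refine ⟨min c₁ 1, C₁ + Λ, by positivity, by positivity, ?_⟩
  intro Φ hΦ a b e f he he1 hf hf1
  have hfar : ∀ {X Y Z : ℝ}, 0 ≤ X → 0 ≤ Z → X ≤ Y + Λ * Z →
      min c₁ 1 * X ≤ Y + (C₁ + Λ) * Z := by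
    intro X Y Z hX hZ h
    have h1 : min c₁ 1 * X ≤ 1 * X := by gcongr; exact min_le_right _ _
    have h2 : 0 ≤ C₁ * Z := by positivity
    linarith
  have hnear : ∀ {X Y Z : ℝ}, 0 ≤ X → 0 ≤ Z → c₁ * X ≤ Y + C₁ * Z →
      min c₁ 1 * X ≤ Y + (C₁ + Λ) * Z := by
    intro X Y Z hX hZ h
    have h1 : min c₁ 1 * X ≤ c₁ * X := by gcongr; exact min_le_left _ _
    have h2 : 0 ≤ Λ * Z := by positivity
    linarith
  have hGa := growG_nonneg m a
  have hGb := growG_nonneg m b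
  refine ⟨?_, ?_, ?_⟩
  · apply hnear (by positivity) (by positivity)
    rcases le_total b a with hab | hab
    · obtain ⟨h1, h2⟩ := hΦ.bounds_of_nonneg hp (sub_nonneg.2 hab)
      have := energy_pointwise_of_le hΛ hp hτ hτp hm he hf hab h1 h2
      linarith
    · obtain ⟨h1, h2⟩ := hΦ.neg_comp_neg.bounds_of_nonneg hp (sub_nonneg.2 hab)
      have := energy_pointwise_of_le hΛ hp hτ hτp hm hf he hab h1 h2
      rw [neg_sub, abs_sub_comm, abs_sub_comm f e] at this
      linarith
  · rintro rfl
    apply hfar (by positivity) (by positivity)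
    have := energy_pointwise_far (b := b) hΦ hΛ hp hτ hτp hm he he1 (a := a)
    simp only [mul_zero, sub_zero, Real.zero_rpow hp0.ne']
    linarith
  · rintro rfl
    apply hfar (by positivity) (by positivity)
    have := energy_pointwise_far (b := a) hΦ.neg_comp_neg hΛ hp hτ hτp hm hf hf1 (a := b)
    simp only [mul_zero, zero_sub, Real.zero_rpow hp0.ne', abs_neg]
    rw [neg_sub] at this
    linarith

/-! ### Integrals of powers of the norm -/

lemma lintegral_radial {n : ℕ} (hn : 2 ≤ n) {g : ℝ → ℝ} (hg0 : ∀ t, 0 ≤ g t)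
    (hg : IntegrableOn (fun y : ℝ => y ^ (n - 1) * g y) (Ioi 0)) :
    ∫⁻ z : Rn n, ENNReal.ofReal (g ‖z‖) =
      ENNReal.ofReal (n * volume.real (ball (0 : Rn n) 1) *
        ∫ y in Ioi (0 : ℝ), y ^ (n - 1) * g y) := by
  have : Nonempty (Fin n) := ⟨⟨0, by omega⟩⟩
  have : Nontrivial (Rn n) := inferInstance
  have hdim : Module.finrank ℝ (Rn n) = n := by simp
  have h1 : Integrable (fun z : Rn n => g ‖z‖) := by
    rw [integrable_fun_norm_addHaar (volume : Measure (Rn n)) (f := g), hdim]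
    simpa using hg
  rw [← ofReal_integral_eq_lintegral_ofReal h1 (ae_of_all _ fun z => hg0 _),
    integral_fun_norm_addHaar (volume : Measure (Rn n)) g, hdim]
  simp [mul_assoc]

lemma lintegral_ball_norm_rpow {n : ℕ} (hn : 2 ≤ n) {e : ℝ} (he : 0 < e) :
    ∃ C : ℝ, 0 < C ∧ ∀ R : ℝ, 0 < R → ∀ x : Rn n,
      ∫⁻ y in ball x R, ENNReal.ofReal (‖x - y‖ ^ (e - n)) ≤ ENNReal.ofReal (C * R ^ e) := by
  have hb : 0 ≤ volume.real (ball (0 : Rn n) 1) := measureReal_nonneg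
  refine ⟨n * volume.real (ball (0 : Rn n) 1) / e + 1, by positivity, fun R hR x => ?_⟩
  have hn0 : (0 : ℝ) < n := by positivity
  set g : ℝ → ℝ := (Ioo 0 R).indicator (fun t => t ^ (e - n)) with hg
  have hpow : ∀ y : ℝ, 0 < y → y ^ (n - 1) * y ^ (e - n) = y ^ (e - 1) := by
    intro y hy
    rw [← Real.rpow_natCast, ← Real.rpow_add hy]
    congr 1
    rw [Nat.cast_sub (by omega)]; push_cast; ring
  have hfun : (fun y : ℝ => y ^ (n - 1) * g y) = (Ioo 0 R).indicator (fun y => y ^ (e - 1)) := by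
    ext y
    by_cases hy : y ∈ Ioo 0 R
    · simp [hg, hy, hpow y hy.1]
    · simp [hg, hy]
  have hInt : IntegrableOn (fun y : ℝ => y ^ (e - 1)) (Ioo 0 R) := by
    have := (intervalIntegral.intervalIntegrable_rpow' (a := 0) (b := R)
      (by linarith : -1 < e - 1)).1
    exact this.mono_set Ioo_subset_Ioc_self
  have hval : ∫ y in Ioo 0 R, y ^ (e - 1) = R ^ e / e := by
    rw [← integral_Ioc_eq_integral_Ioo, ← intervalIntegral.integral_of_le hR.le,
      integral_rpow (Or.inl (by linarith))]
    simp [he.ne']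
  have hg0 : ∀ t, 0 ≤ g t := by
    intro t
    apply indicator_nonneg
    intro t ht
    exact Real.rpow_nonneg ht.1.le _
  have hgi : IntegrableOn (fun y : ℝ => y ^ (n - 1) * g y) (Ioi 0) := by
    rw [hfun]
    exact (hInt.integrable_indicator measurableSet_Ioo).integrableOn
  have h1 := lintegral_radial hn hg0 hgi
  have h2 : ∫ y in Ioi (0 : ℝ), y ^ (n - 1) * g y = R ^ e / e := by
    rw [hfun, setIntegral_indicator measurableSet_Ioo, ← hval]
    congr 2
    ext y; simp only [mem_inter_iff, mem_Ioi, mem_Ioo]; tauto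
  rw [h2] at h1
  calc ∫⁻ y in ball x R, ENNReal.ofReal (‖x - y‖ ^ (e - n))
      = ∫⁻ y, (ball x R).indicator (fun y => ENNReal.ofReal (‖x - y‖ ^ (e - n))) y := by
        rw [lintegral_indicator measurableSet_ball]
    _ ≤ ∫⁻ y, ENNReal.ofReal (g ‖x - y‖) := by
        apply lintegral_mono_ae
        have : Nonempty (Fin n) := ⟨⟨0, by omega⟩⟩
        have : Nontrivial (Rn n) := inferInstance
        have : ∀ᵐ y : Rn n, y ≠ x := by
          simp [ae_iff]
        filter_upwards [this] with y hyx
        by_cases hy : y ∈ ball x R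
        · rw [indicator_of_mem hy, hg, indicator_of_mem]
          have h3 : x - y ≠ 0 := sub_ne_zero.2 hyx.symm
          exact ⟨norm_pos_iff.2 h3, by rwa [mem_ball, dist_comm, dist_eq_norm] at hy⟩
        · rw [indicator_of_notMem hy]; exact zero_le
    _ = ∫⁻ z, ENNReal.ofReal (g ‖z‖) :=
        lintegral_sub_left_eq_self (fun z : Rn n => ENNReal.ofReal (g ‖z‖)) x
    _ ≤ _ := by
        rw [h1]
        apply ENNReal.ofReal_le_ofReal
        have : 0 ≤ R ^ e := by positivity
        calc _ = n * volume.real (ball (0 : Rn n) 1) / e * R ^ e := by ring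
          _ ≤ _ := by gcongr; linarith

lemma lintegral_compl_ball_norm_rpow {n : ℕ} (hn : 2 ≤ n) {e : ℝ} (he : 0 < e) :
    ∃ C : ℝ, 0 < C ∧ ∀ R : ℝ, 0 < R → ∀ x : Rn n,
      ∫⁻ y in (ball x R)ᶜ, ENNReal.ofReal (‖x - y‖ ^ (-(n + e))) ≤
        ENNReal.ofReal (C * R ^ (-e)) := by
  have hb : 0 ≤ volume.real (ball (0 : Rn n) 1) := measureReal_nonneg
  refine ⟨n * volume.real (ball (0 : Rn n) 1) / e * 2 ^ e + 1, by positivity, fun R hR x => ?_⟩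
  have hR2 : 0 < R / 2 := by positivity
  set g : ℝ → ℝ := (Ioi (R / 2)).indicator (fun t => t ^ (-(n + e))) with hg
  have hpow : ∀ y : ℝ, 0 < y → y ^ (n - 1) * y ^ (-(n + e)) = y ^ (-e - 1) := by
    intro y hy
    rw [← Real.rpow_natCast, ← Real.rpow_add hy]
    congr 1
    rw [Nat.cast_sub (by omega)]; push_cast; ring
  have hfun : (fun y : ℝ => y ^ (n - 1) * g y) =
      (Ioi (R / 2)).indicator (fun y => y ^ (-e - 1)) := by
    ext y
    by_cases hy : y ∈ Ioi (R / 2)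
    · simp only [hg, hy, indicator_of_mem]
      exact hpow y (hR2.trans hy)
    · simp [hg, hy]
  have hInt : IntegrableOn (fun y : ℝ => y ^ (-e - 1)) (Ioi (R / 2)) :=
    integrableOn_Ioi_rpow_of_lt (by linarith) hR2
  have hval : ∫ y in Ioi (R / 2), y ^ (-e - 1) = (R / 2) ^ (-e) / e := by
    rw [integral_Ioi_rpow_of_lt (by linarith) hR2]
    simp [neg_div_neg_eq]
  have hg0 : ∀ t, 0 ≤ g t := by
    intro t
    apply indicator_nonneg
    intro t ht
    exact Real.rpow_nonneg (hR2.le.trans (le_of_lt ht)) _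
  have hgi : IntegrableOn (fun y : ℝ => y ^ (n - 1) * g y) (Ioi 0) := by
    rw [hfun]
    exact (hInt.integrable_indicator measurableSet_Ioi).integrableOn
  have h1 := lintegral_radial hn hg0 hgi
  have h2 : ∫ y in Ioi (0 : ℝ), y ^ (n - 1) * g y = (R / 2) ^ (-e) / e := by
    rw [hfun, setIntegral_indicator measurableSet_Ioi, ← hval]
    congr 2
    ext y; simp only [mem_inter_iff, mem_Ioi]
    exact ⟨fun h => h.2, fun h => ⟨hR2.trans h, h⟩⟩
  rw [h2] at h1
  calc ∫⁻ y in (ball x R)ᶜ, ENNReal.ofReal (‖x - y‖ ^ (-(n + e)))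
      = ∫⁻ y, (ball x R)ᶜ.indicator (fun y => ENNReal.ofReal (‖x - y‖ ^ (-(n + e)))) y := by
        rw [lintegral_indicator measurableSet_ball.compl]
    _ ≤ ∫⁻ y, ENNReal.ofReal (g ‖x - y‖) := by
        apply lintegral_mono
        intro y
        by_cases hy : y ∈ (ball x R)ᶜ
        · beta_reduce
          rw [indicator_of_mem hy, hg, indicator_of_mem]
          rw [mem_compl_iff, mem_ball, dist_comm, dist_eq_norm, not_lt] at hy
          rw [mem_Ioi]; linarith
        · beta_reduce
          rw [indicator_of_notMem hy]; exact zero_le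
    _ = ∫⁻ z, ENNReal.ofReal (g ‖z‖) :=
        lintegral_sub_left_eq_self (fun z : Rn n => ENNReal.ofReal (g ‖z‖)) x
    _ ≤ _ := by
        rw [h1]
        apply ENNReal.ofReal_le_ofReal
        have h3 : (R / 2) ^ (-e) = 2 ^ e * R ^ (-e) := by
          rw [Real.div_rpow hR.le (by norm_num), Real.rpow_neg (by norm_num : (0:ℝ) ≤ 2)]
          field_simp
        have : 0 ≤ R ^ (-e) := by positivity
        rw [h3]
        calc _ = n * volume.real (ball (0 : Rn n) 1) / e * 2 ^ e * R ^ (-e) := by ring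
          _ ≤ _ := by gcongr; linarith

/-! ### A weak Sobolev inequality of Nash type -/

lemma nash_inner_lower {n : ℕ} (hn : 2 ≤ n) {s p a : ℝ} (hs : 0 < s) (hp : 0 < p)
    (ha : 0 < a) {w : Rn n → ℝ} (hw : Measurable w)
    {N : ℝ} (hN : 0 < N) (hwN : ∫⁻ x, ENNReal.ofReal (w x ^ a) ≤ ENNReal.ofReal N)
    {x : Rn n} (hx : 0 < w x) :
    ENNReal.ofReal (w x ^ (p + a * (s * p / n))) ≤
      ENNReal.ofReal (2 ^ (p + (1 + s * p / n) + a * (s * p / n)) *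
          volume.real (ball (0 : Rn n) 1) ^ (-(1 + s * p / n)) * N ^ (s * p / n)) *
        ∫⁻ y, ENNReal.ofReal (|w x - w y| ^ p / ‖x - y‖ ^ ((n : ℝ) + s * p)) := by
  have : Nonempty (Fin n) := ⟨⟨0, by omega⟩⟩
  have : Nontrivial (Rn n) := inferInstance
  have hn0 : (0 : ℝ) < n := by positivity
  set β := s * p / n with hβ
  have hβ0 : 0 < β := by positivity
  set ω := volume.real (ball (0 : Rn n) 1) with hω
  have hω0 : 0 < ω := by
    rw [hω, measureReal_def]
    exact ENNReal.toReal_pos (measure_ball_pos _ _ one_pos).ne' measure_ball_lt_top.ne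
  set t := w x with ht
  set S := {y | t / 2 < w y} with hS
  have hSm : MeasurableSet S := measurableSet_lt measurable_const hw
  set V := N / (t / 2) ^ a with hV
  have hV0 : 0 < V := by positivity
  have hSV : volume S ≤ ENNReal.ofReal V := by
    have h1 := mul_meas_ge_le_lintegral₀ (μ := (volume : Measure (Rn n)))
      (f := fun y => ENNReal.ofReal (w y ^ a))
      (by fun_prop : AEMeasurable (fun y => ENNReal.ofReal (w y ^ a)) volume)
      (ENNReal.ofReal ((t / 2) ^ a))
    have h2 : volume S ≤ volume {y | ENNReal.ofReal ((t / 2) ^ a) ≤ ENNReal.ofReal (w y ^ a)} := by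
      apply measure_mono
      intro y hy
      simp only [hS, mem_ofPred_eq] at hy ⊢
      gcongr
    rw [hV, ENNReal.ofReal_div_of_pos (by positivity),
      ENNReal.le_div_iff_mul_le (Or.inl (by simp; positivity)) (Or.inl ENNReal.ofReal_ne_top)]
    calc volume S * ENNReal.ofReal ((t / 2) ^ a) ≤ _ := by rw [mul_comm]; gcongr
      _ ≤ _ := h1.trans hwN
  set ρ := (2 * V / ω) ^ (1 / (n : ℝ)) with hρ
  have hρ0 : 0 < ρ := by positivity
  have hρn : ρ ^ (n : ℝ) = 2 * V / ω := by
    rw [hρ, ← Real.rpow_mul (by positivity)]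
    simp [hn0.ne']
  have hball : volume (ball x ρ) = ENNReal.ofReal (2 * V) := by
    rw [Measure.addHaar_ball _ _ hρ0.le]
    have : volume (ball (0 : Rn n) 1) = ENNReal.ofReal ω := by
      rw [hω, measureReal_def, ENNReal.ofReal_toReal measure_ball_lt_top.ne]
    rw [this, ← ENNReal.ofReal_mul (by positivity)]
    congr 1
    rw [finrank_euclideanSpace, Fintype.card_fin, ← Real.rpow_natCast, hρn]
    field_simp
  have hdiff : ENNReal.ofReal V ≤ volume (ball x ρ \ S) := by
    calc ENNReal.ofReal V = ENNReal.ofReal (2 * V) - ENNReal.ofReal V := by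
          rw [← ENNReal.ofReal_sub _ hV0.le]; ring_nf
      _ ≤ volume (ball x ρ) - volume S := by rw [hball]; gcongr
      _ ≤ _ := le_measure_sdiff
  have hinner : ENNReal.ofReal ((t / 2) ^ p / ρ ^ ((n : ℝ) + s * p)) * ENNReal.ofReal V ≤
      ∫⁻ y, ENNReal.ofReal (|t - w y| ^ p / ‖x - y‖ ^ ((n : ℝ) + s * p)) := by
    calc _ ≤ ENNReal.ofReal ((t / 2) ^ p / ρ ^ ((n : ℝ) + s * p)) * volume (ball x ρ \ S) := by
          gcongr
      _ = ∫⁻ y in ball x ρ \ S, ENNReal.ofReal ((t / 2) ^ p / ρ ^ ((n : ℝ) + s * p)) := by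
          rw [setLIntegral_const]
      _ ≤ ∫⁻ y in ball x ρ \ S,
          ENNReal.ofReal (|t - w y| ^ p / ‖x - y‖ ^ ((n : ℝ) + s * p)) := by
          apply setLIntegral_mono' (measurableSet_ball.diff hSm)
          intro y hy
          have hy2 : w y ≤ t / 2 := not_lt.1 hy.2
          have hyx : y ≠ x := by
            rintro rfl
            rw [← ht] at hy2; linarith
          have h3 : 0 < ‖x - y‖ := norm_pos_iff.2 (sub_ne_zero.2 hyx.symm)
          have h4 : ‖x - y‖ ≤ ρ := by
            have := hy.1; rw [mem_ball, dist_comm, dist_eq_norm] at this; exact this.le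
          have h5 : t / 2 ≤ |t - w y| := by
            rw [abs_of_nonneg (by linarith)]; linarith
          gcongr
      _ ≤ _ := setLIntegral_le_lintegral _ _
  refine le_trans (le_of_eq ?_) (mul_le_mul_right hinner _)
  rw [← ENNReal.ofReal_mul (by positivity), ← ENNReal.ofReal_mul (by positivity)]
  congr 1
  have e1 : ρ ^ ((n : ℝ) + s * p) = (2 * V / ω) ^ (1 + β) := by
    rw [← hρn, ← Real.rpow_mul hρ0.le]
    congr 1; rw [hβ]; field_simp
  rw [e1]
  have e2 : (2 * V / ω) ^ (1 + β) = 2 ^ (1 + β) * (V * V ^ β) * ω ^ (-(1 + β)) := by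
    rw [Real.div_rpow (by positivity) hω0.le, Real.mul_rpow (by norm_num) hV0.le,
      Real.rpow_add hV0, Real.rpow_one, Real.rpow_neg hω0.le]
    rfl
  have e3 : V ^ β = N ^ β * 2 ^ (a * β) / t ^ (a * β) := by
    rw [hV, Real.div_rpow hN.le (by positivity), ← Real.rpow_mul (by positivity),
      Real.div_rpow hx.le (by norm_num)]
    field_simp
  rw [e2, e3, Real.div_rpow hx.le (by norm_num), Real.rpow_add hx, Real.rpow_add (by norm_num),
    Real.rpow_add (by norm_num)]
  field_simp

lemma nash_inequality {n : ℕ} (hn : 2 ≤ n) {s p a : ℝ} (hs : 0 < s) (hp : 0 < p)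
    (ha : 0 < a) :
    ∃ C : ℝ, 0 < C ∧ ∀ w : Rn n → ℝ, Measurable w → (∀ x, 0 ≤ w x) → ∀ N : ℝ, 0 < N →
      ∫⁻ x, ENNReal.ofReal (w x ^ a) ≤ ENNReal.ofReal N →
      ∫⁻ x, ENNReal.ofReal (w x ^ (p + a * (s * p / n))) ≤
        ENNReal.ofReal (C * N ^ (s * p / n)) * gagliardo n s p univ w := by
  have hω0 : 0 < volume.real (ball (0 : Rn n) 1) := by
    rw [measureReal_def]
    exact ENNReal.toReal_pos (measure_ball_pos _ _ one_pos).ne' measure_ball_lt_top.ne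
  refine ⟨2 ^ (p + (1 + s * p / n) + a * (s * p / n)) *
          volume.real (ball (0 : Rn n) 1) ^ (-(1 + s * p / n)), by positivity, ?_⟩
  intro w hw hw0 N hN hwN
  unfold gagliardo
  simp only [Measure.restrict_univ]
  rw [← lintegral_const_mul' _ _ ENNReal.ofReal_ne_top]
  apply lintegral_mono
  intro x
  rcases (hw0 x).eq_or_lt with h | h
  · have : 0 < p + a * (s * p / n) := by positivity
    beta_reduce
    rw [← h, Real.zero_rpow this.ne']; simp
  · exact nash_inner_lower hn hs hp ha hw hN hwN h

/-! ### The Gagliardo energy as an integral on the product space -/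

lemma measurable_gagliardo_integrand {n : ℕ} {s p : ℝ} {v : Rn n → ℝ} (hv : Measurable v) :
    Measurable (fun z : Rn n × Rn n =>
      |v z.1 - v z.2| ^ p / ‖z.1 - z.2‖ ^ ((n : ℝ) + s * p)) := by
  fun_prop

lemma gagliardo_univ_eq {n : ℕ} {s p : ℝ} {v : Rn n → ℝ} (hv : Measurable v) :
    gagliardo n s p univ v = ∫⁻ z : Rn n × Rn n,
      ENNReal.ofReal (|v z.1 - v z.2| ^ p / ‖z.1 - z.2‖ ^ ((n : ℝ) + s * p)) := by
  unfold gagliardo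
  simp only [Measure.restrict_univ]
  rw [Measure.volume_eq_prod, lintegral_prod]
  exact (measurable_gagliardo_integrand hv).ennreal_ofReal.aemeasurable

lemma measurePreserving_add_diag {n : ℕ} (c : Rn n) :
    MeasurePreserving (fun z : Rn n × Rn n => z + (c, c)) volume volume :=
  (measurePreserving_add_right (volume : Measure (Rn n)) c).prod
    (measurePreserving_add_right (volume : Measure (Rn n)) c)

lemma gagliardo_univ_comp_add {n : ℕ} {s p : ℝ} {v : Rn n → ℝ} (hv : Measurable v) (c : Rn n) :
    gagliardo n s p univ (fun x => v (x + c)) = gagliardo n s p univ v := by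
  rw [gagliardo_univ_eq hv, gagliardo_univ_eq (by fun_prop)]
  have := (measurePreserving_add_diag c).lintegral_comp
    (measurable_gagliardo_integrand (s := s) (p := p) hv).ennreal_ofReal
  rw [← this]
  simp

lemma rpow_sub_one_mul_le {p δ x y : ℝ} (hp : 1 < p) (hδ : 0 < δ) (hx : 0 ≤ x) (hy : 0 ≤ y) :
    x ^ (p - 1) * y ≤ δ * x ^ p + δ ^ (1 - p) * y ^ p := by
  have h0 : ∀ t : ℝ, 0 ≤ t → t ^ p = t ^ (p - 1) * t := by
    intro t ht
    rcases ht.eq_or_lt with rfl | ht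
    · rw [Real.zero_rpow (by linarith)]; simp
    · rw [← Real.rpow_add_one ht.ne']; ring_nf
  rcases le_total y (δ * x) with h | h
  · have : x ^ (p - 1) * y ≤ x ^ (p - 1) * (δ * x) := by gcongr
    have h2 : 0 ≤ δ ^ (1 - p) * y ^ p := by positivity
    rw [h0 x hx]; linarith
  · have h1 : x ≤ δ⁻¹ * y := by rw [inv_mul_eq_div, le_div_iff₀ hδ]; linarith
    have h2 : x ^ (p - 1) ≤ (δ⁻¹ * y) ^ (p - 1) := by gcongr
    rw [Real.mul_rpow (by positivity) hy, Real.inv_rpow hδ.le, ← Real.rpow_neg hδ.le, neg_sub] at h2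
    have h3 : x ^ (p - 1) * y ≤ δ ^ (1 - p) * y ^ (p - 1) * y := by gcongr
    have h4 : 0 ≤ δ * x ^ p := by positivity
    rw [h0 y hy]; linarith

/-- The integrand of the nonlocal form. -/
def formInt {n : ℕ} (Φ : ℝ → ℝ) (K : Rn n → Rn n → ℝ) (U φ : Rn n → ℝ) (z : Rn n × Rn n) : ℝ :=
  Φ (U z.1 - U z.2) * (φ z.1 - φ z.2) * K z.1 z.2

lemma KernelBounds.nonneg {n : ℕ} {Λ s p : ℝ} {K : Rn n → Rn n → ℝ} (hK : KernelBounds n Λ s p K)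
    (hΛ : 1 ≤ Λ) {x y : Rn n} (hxy : x ≠ y) : 0 ≤ K x y :=
  le_trans (by positivity) (hK.2 x y hxy).1

lemma measurable_formInt {n : ℕ} {Λ s p : ℝ} {Φ : ℝ → ℝ} {K : Rn n → Rn n → ℝ}
    (hΦ : PhiBounds Λ p Φ) (hK : KernelBounds n Λ s p K) {U φ : Rn n → ℝ}
    (hU : Measurable U) (hφ : Measurable φ) : Measurable (formInt Φ K U φ) := by
  unfold formInt
  have h1 : Measurable fun z : Rn n × Rn n => K z.1 z.2 := hK.1
  have h2 : Measurable fun z : Rn n × Rn n => Φ (U z.1 - U z.2) :=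
    hΦ.1.measurable.comp (by fun_prop)
  exact (h2.mul (by fun_prop)).mul h1

lemma abs_formInt_le {n : ℕ} {Λ s p δ : ℝ} {Φ : ℝ → ℝ} {K : Rn n → Rn n → ℝ}
    (hp : 1 < p) (hΛ : 1 ≤ Λ) (hΦ : PhiBounds Λ p Φ) (hK : KernelBounds n Λ s p K) (hδ : 0 < δ)
    (U φ : Rn n → ℝ) (z : Rn n × Rn n) :
    |formInt Φ K U φ z| ≤
      Λ ^ 2 * (δ * (|U z.1 - U z.2| ^ p / ‖z.1 - z.2‖ ^ ((n : ℝ) + s * p)) +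
        δ ^ (1 - p) * (|φ z.1 - φ z.2| ^ p / ‖z.1 - z.2‖ ^ ((n : ℝ) + s * p))) := by
  obtain ⟨x, y⟩ := z
  unfold formInt
  dsimp only
  rcases eq_or_ne x y with rfl | hxy
  · simp only [sub_self, hΦ.2.1, zero_mul, abs_zero]
    positivity
  · have hk := hK.nonneg hΛ hxy
    have h1 := (hK.2 x y hxy).2
    have h2 := hΦ.abs_le hp hΛ (U x - U y)
    have h3 := rpow_sub_one_mul_le hp hδ (abs_nonneg (U x - U y)) (abs_nonneg (φ x - φ y))
    rw [abs_mul, abs_mul, abs_of_nonneg hk]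
    have hN : 0 < ‖x - y‖ := norm_pos_iff.2 (sub_ne_zero.2 hxy)
    calc |Φ (U x - U y)| * |φ x - φ y| * K x y
        ≤ Λ * |U x - U y| ^ (p - 1) * |φ x - φ y| * (Λ / ‖x - y‖ ^ ((n : ℝ) + s * p)) := by gcongr
      _ = Λ ^ 2 / ‖x - y‖ ^ ((n : ℝ) + s * p) * (|U x - U y| ^ (p - 1) * |φ x - φ y|) := by ring
      _ ≤ Λ ^ 2 / ‖x - y‖ ^ ((n : ℝ) + s * p) *
          (δ * |U x - U y| ^ p + δ ^ (1 - p) * |φ x - φ y| ^ p) := by gcongr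
      _ = _ := by ring

lemma lintegral_abs_formInt_le {n : ℕ} {Λ s p δ : ℝ} {Φ : ℝ → ℝ} {K : Rn n → Rn n → ℝ}
    (hp : 1 < p) (hΛ : 1 ≤ Λ) (hΦ : PhiBounds Λ p Φ) (hK : KernelBounds n Λ s p K) (hδ : 0 < δ)
    {U φ : Rn n → ℝ} (hU : Measurable U) (hφ : Measurable φ) :
    ∫⁻ z, ‖formInt Φ K U φ z‖ₑ ≤ ENNReal.ofReal (Λ ^ 2 * δ) * gagliardo n s p univ U +
      ENNReal.ofReal (Λ ^ 2 * δ ^ (1 - p)) * gagliardo n s p univ φ := by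
  rw [gagliardo_univ_eq hU, gagliardo_univ_eq hφ,
    ← lintegral_const_mul' _ _ ENNReal.ofReal_ne_top,
    ← lintegral_const_mul' _ _ ENNReal.ofReal_ne_top, ← lintegral_add_left]
  · apply lintegral_mono
    intro z
    beta_reduce
    rw [← ENNReal.ofReal_mul (by positivity), ← ENNReal.ofReal_mul (by positivity),
      ← ENNReal.ofReal_add (by positivity) (by positivity), Real.enorm_eq_ofReal_abs]
    apply ENNReal.ofReal_le_ofReal
    refine (abs_formInt_le hp hΛ hΦ hK hδ U φ z).trans (le_of_eq ?_)
    ring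
  · have := measurable_gagliardo_integrand (s := s) (p := p) hU
    fun_prop

lemma integrable_formInt {n : ℕ} {Λ s p : ℝ} {Φ : ℝ → ℝ} {K : Rn n → Rn n → ℝ}
    (hp : 1 < p) (hΛ : 1 ≤ Λ) (hΦ : PhiBounds Λ p Φ) (hK : KernelBounds n Λ s p K)
    {U φ : Rn n → ℝ} (hU : Measurable U) (hφ : Measurable φ)
    (hUg : gagliardo n s p univ U < ⊤) (hφg : gagliardo n s p univ φ < ⊤) :
    Integrable (formInt Φ K U φ) := by
  refine ⟨(measurable_formInt hΦ hK hU hφ).aestronglyMeasurable, ?_⟩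
  refine (lintegral_abs_formInt_le hp hΛ hΦ hK one_pos hU hφ).trans_lt ?_
  exact ENNReal.add_lt_top.2 ⟨ENNReal.mul_lt_top ENNReal.ofReal_lt_top hUg,
    ENNReal.mul_lt_top ENNReal.ofReal_lt_top hφg⟩

lemma nonlocalForm_eq {n : ℕ} {Φ : ℝ → ℝ} {K : Rn n → Rn n → ℝ} {U φ : Rn n → ℝ}
    (h : Integrable (formInt Φ K U φ)) :
    nonlocalForm n Φ K U φ = ∫ z, formInt Φ K U φ z := by
  rw [Measure.volume_eq_prod] at h ⊢
  rw [integral_prod _ h]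
  rfl

lemma tendsto_gagliardo_translate {n : ℕ} {s p : ℝ} (hp : 1 < p) {φ : Rn n → ℝ}
    (hφ : Measurable φ) (hφg : gagliardo n s p univ φ < ⊤) :
    Tendsto (fun c : Rn n => gagliardo n s p univ (fun x => φ (x + c) - φ x)) (𝓝 0) (𝓝 0) := by
  have hp0 : 0 < p := by linarith
  have : Fact (1 ≤ ENNReal.ofReal p) := ⟨by rw [ENNReal.one_le_ofReal]; exact hp.le⟩
  have hpR : (ENNReal.ofReal p).toReal = p := ENNReal.toReal_ofReal hp0.le
  set Ψ : Rn n × Rn n → ℝ := fun z => (φ z.1 - φ z.2) / ‖z.1 - z.2‖ ^ (((n : ℝ) + s * p) / p)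
    with hΨ
  have hΨm : Measurable Ψ := by fun_prop
  have hpow : ∀ t : ℝ, ∀ z : Rn n × Rn n, ‖t / ‖z.1 - z.2‖ ^ (((n : ℝ) + s * p) / p)‖ₑ ^ p =
      ENNReal.ofReal (|t| ^ p / ‖z.1 - z.2‖ ^ ((n : ℝ) + s * p)) := by
    intro t z
    rw [Real.enorm_eq_ofReal_abs, ENNReal.ofReal_rpow_of_nonneg (abs_nonneg _) hp0.le, abs_div,
      Real.div_rpow (abs_nonneg _) (abs_nonneg _), abs_of_nonneg (a := ‖_‖ ^ _) (by positivity),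
      ← Real.rpow_mul (norm_nonneg _), div_mul_cancel₀ _ hp0.ne']
  have hΨL : MemLp Ψ (ENNReal.ofReal p) := by
    refine ⟨hΨm.aestronglyMeasurable, ?_⟩
    rw [eLpNorm_lt_top_iff_lintegral_rpow_enorm_lt_top (by simpa using hp0) ENNReal.ofReal_ne_top,
      hpR]
    rw [gagliardo_univ_eq hφ] at hφg
    refine lt_of_eq_of_lt ?_ hφg
    exact lintegral_congr fun z => hpow _ z
  have hmp : ∀ c : Rn n, MeasurePreserving
      (⟨fun z : Rn n × Rn n => z + (c, c), by fun_prop⟩ : C(Rn n × Rn n, Rn n × Rn n))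
      volume volume := measurePreserving_add_diag
  have hcont : Continuous (fun c : Rn n =>
      (⟨fun z : Rn n × Rn n => z + (c, c), by fun_prop⟩ : C(Rn n × Rn n, Rn n × Rn n))) := by
    apply ContinuousMap.continuous_of_continuous_uncurry
    simp only [Function.uncurry_def, ContinuousMap.coe_mk]
    fun_prop
  have hlim := (continuous_const (y := hΨL.toLp Ψ)).compMeasurePreservingLp hcont hmp
    ENNReal.ofReal_ne_top
  have hlim0 := hlim.tendsto 0
  rw [Lp.tendsto_Lp_iff_tendsto_eLpNorm'] at hlim0
  have hkey : ∀ c : Rn n, gagliardo n s p univ (fun x => φ (x + c) - φ x) =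
      eLpNorm (⇑(Lp.compMeasurePreserving _ (hmp c) (hΨL.toLp Ψ)) -
        ⇑(Lp.compMeasurePreserving _ (hmp 0) (hΨL.toLp Ψ))) (ENNReal.ofReal p) volume ^ p := by
    intro c
    rw [eLpNorm_eq_lintegral_rpow_enorm_toReal (by simpa using hp0) ENNReal.ofReal_ne_top, hpR,
      ← ENNReal.rpow_mul, one_div, inv_mul_cancel₀ hp0.ne', ENNReal.rpow_one,
      gagliardo_univ_eq (by fun_prop)]
    apply lintegral_congr_ae
    rw [Lp.toLp_compMeasurePreserving hΨL (hmp c), Lp.toLp_compMeasurePreserving hΨL (hmp 0)]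
    filter_upwards [MemLp.coeFn_toLp (hΨL.comp_measurePreserving (hmp c)),
      MemLp.coeFn_toLp (hΨL.comp_measurePreserving (hmp 0))] with z h1 h2
    rw [Pi.sub_apply, h1, h2, ← hpow]
    simp only [Function.comp, hΨ, ContinuousMap.coe_mk, Prod.fst_add, Prod.snd_add, add_zero,
      add_sub_add_right_eq_sub]
    rw [← sub_div]
    congr 3
    ring
  simp_rw [hkey]
  have h0 : (0 : ℝ≥0∞) = 0 ^ p := by rw [ENNReal.zero_rpow_of_pos hp0]
  rw [h0]
  exact hlim0.ennrpow_const p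

/-! ### Extension of the class of test functions -/

lemma tendsto_lintegral_formInt_translate {n : ℕ} {Λ s p : ℝ} {Φ : ℝ → ℝ}
    {K : Rn n → Rn n → ℝ} (hp : 1 < p) (hΛ : 1 ≤ Λ) (hΦ : PhiBounds Λ p Φ)
    (hK : KernelBounds n Λ s p K) {U φ : Rn n → ℝ} (hU : Measurable U) (hφ : Measurable φ)
    (hUg : gagliardo n s p univ U < ⊤) (hφg : gagliardo n s p univ φ < ⊤) :
    Tendsto (fun c : Rn n => ∫⁻ z, ‖formInt Φ K U (fun x => φ (x + c) - φ x) z‖ₑ)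
      (𝓝 0) (𝓝 0) := by
  rw [ENNReal.tendsto_nhds_zero]
  intro ε hε
  obtain ⟨δ, hδ, hδε⟩ : ∃ δ : ℝ, 0 < δ ∧
      ENNReal.ofReal (Λ ^ 2 * δ) * gagliardo n s p univ U ≤ ε / 2 := by
    have h1 : Tendsto (fun δ : ℝ => ENNReal.ofReal (Λ ^ 2 * δ) * gagliardo n s p univ U)
        (𝓝[>] 0) (𝓝 0) := by
      have h2 : Tendsto (fun δ : ℝ => ENNReal.ofReal (Λ ^ 2 * δ)) (𝓝 0) (𝓝 0) := by
        have : Continuous fun δ : ℝ => ENNReal.ofReal (Λ ^ 2 * δ) :=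
          ENNReal.continuous_ofReal.comp (by fun_prop)
        simpa using this.tendsto 0
      have h3 := ENNReal.Tendsto.mul_const (b := gagliardo n s p univ U) h2 (Or.inr hUg.ne)
      rw [zero_mul] at h3
      exact h3.mono_left nhdsWithin_le_nhds
    have h4 := (ENNReal.tendsto_nhds_zero.1 h1) (ε / 2) (by simpa using hε.ne')
    obtain ⟨δ, hδ1, hδ2⟩ := (h4.and self_mem_nhdsWithin).exists
    exact ⟨δ, hδ2, hδ1⟩
  have h5 : Tendsto (fun c : Rn n => ENNReal.ofReal (Λ ^ 2 * δ ^ (1 - p)) *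
      gagliardo n s p univ (fun x => φ (x + c) - φ x)) (𝓝 0) (𝓝 0) := by
    have := ENNReal.Tendsto.const_mul (a := ENNReal.ofReal (Λ ^ 2 * δ ^ (1 - p)))
      (tendsto_gagliardo_translate hp hφ hφg) (Or.inr ENNReal.ofReal_ne_top)
    simpa using this
  filter_upwards [(ENNReal.tendsto_nhds_zero.1 h5) (ε / 2) (by simpa using hε.ne')] with c hc
  calc _ ≤ _ := lintegral_abs_formInt_le hp hΛ hΦ hK hδ hU (by fun_prop)
    _ ≤ ε / 2 + ε / 2 := add_le_add hδε hc
    _ = ε := ENNReal.add_halves ε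

lemma continuousAt_integral_formInt_translate {n : ℕ} {Λ s p : ℝ} {Φ : ℝ → ℝ}
    {K : Rn n → Rn n → ℝ} (hp : 1 < p) (hΛ : 1 ≤ Λ) (hΦ : PhiBounds Λ p Φ)
    (hK : KernelBounds n Λ s p K) {U φ : Rn n → ℝ} (hU : Measurable U) (hφ : Measurable φ)
    (hUg : gagliardo n s p univ U < ⊤) (hφg : gagliardo n s p univ φ < ⊤) :
    ContinuousAt (fun c : Rn n => ∫ z, formInt Φ K U (fun x => φ (x + c)) z) 0 := by
  rw [ContinuousAt, tendsto_iff_edist_tendsto_0]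
  refine tendsto_of_tendsto_of_tendsto_of_le_of_le tendsto_const_nhds
    (tendsto_lintegral_formInt_translate hp hΛ hΦ hK hU hφ hUg hφg) (fun _ => zero_le) ?_
  intro c
  have hi : ∀ c : Rn n, Integrable (formInt Φ K U (fun x => φ (x + c))) := fun c =>
    integrable_formInt hp hΛ hΦ hK hU (by fun_prop) hUg (by rwa [gagliardo_univ_comp_add hφ])
  beta_reduce
  rw [edist_eq_enorm_sub, ← integral_sub (hi c) (hi 0)]
  refine (enorm_integral_le_lintegral_enorm _).trans (le_of_eq ?_)
  congr 1
  ext z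
  congr 1
  simp only [formInt, add_zero]
  ring

lemma continuousAt_integral_mul_translate {n : ℕ} {φ m : Rn n → ℝ}
    (hφ : Integrable φ) (hm : Continuous m) (hmc : HasCompactSupport m) :
    ContinuousAt (fun c : Rn n => ∫ x, φ (x + c) * m x) 0 := by
  obtain ⟨B, hB⟩ := hm.bounded_above_of_compact_support hmc
  have h1 : (fun c : Rn n => ∫ x, φ (x + c) * m x) = fun c => ∫ x, φ x * m (x - c) := by
    ext c
    rw [← integral_add_right_eq_self (fun x => φ x * m (x - c)) c]
    simp
  rw [h1]
  apply continuousAt_of_dominated (bound := fun x => |φ x| * B)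
  · exact Eventually.of_forall fun c =>
      hφ.aestronglyMeasurable.mul (by fun_prop : Continuous fun x => m (x - c)).aestronglyMeasurable
  · refine Eventually.of_forall fun c => ae_of_all _ fun x => ?_
    rw [norm_mul, Real.norm_eq_abs]
    gcongr
    exact hB _
  · exact hφ.abs.mul_const B
  · exact ae_of_all _ fun x => (by fun_prop : Continuous fun c => φ x * m (x - c)).continuousAt

lemma integral_formInt_eq {n : ℕ} {Λ s p M : ℝ} {Φ : ℝ → ℝ} {K : Rn n → Rn n → ℝ}
    {Ω Kc : Set (Rn n)} (hp : 1 < p) (hΛ : 1 ≤ Λ) (hΦ : PhiBounds Λ p Φ)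
    (hK : KernelBounds n Λ s p K) {U φ m : Rn n → ℝ} (hU : Measurable U) (hφ : Measurable φ)
    (hUg : gagliardo n s p univ U < ⊤) (hφg : gagliardo n s p univ φ < ⊤)
    (hm : Continuous m) (hmc : HasCompactSupport m) (hΩ : IsOpen Ω)
    (hKc : IsCompact Kc) (hKΩ : Kc ⊆ Ω) (hφM : ∀ x, |φ x| ≤ M) (hφK : ∀ x, x ∉ Kc → φ x = 0)
    (heq : ∀ ψ : Rn n → ℝ, IsTestFun n Ω ψ → nonlocalForm n Φ K U ψ = ∫ x, ψ x * m x) :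
    ∫ z, formInt Φ K U φ z = ∫ x, φ x * m x := by
  have hφs : HasCompactSupport φ := HasCompactSupport.intro hKc hφK
  have hφi : Integrable φ := by
    have : IntegrableOn φ Kc :=
      Measure.integrableOn_of_bounded hKc.measure_lt_top.ne hφ.aestronglyMeasurable (M := M)
        (ae_of_all _ fun x => by rw [Real.norm_eq_abs]; exact hφM x)
    rwa [integrableOn_iff_integrable_of_support_subset] at this
    intro x hx
    by_contra h
    exact hx (hφK x h)
  set D : Rn n → ℝ := fun c => (∫ z, formInt Φ K U (fun x => φ (x + c)) z) -
    ∫ x, φ (x + c) * m x with hD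
  have hDc : ContinuousAt D 0 :=
    (continuousAt_integral_formInt_translate hp hΛ hΦ hK hU hφ hUg hφg).sub
      (continuousAt_integral_mul_translate hφi hm hmc)
  have hjoint : Measurable fun w : Rn n × (Rn n × Rn n) =>
      formInt Φ K U (fun x => φ (x + w.1)) w.2 := by
    unfold formInt
    have h1 : Measurable fun z : Rn n × Rn n => K z.1 z.2 := hK.1
    have h2 : Measurable fun z : Rn n × Rn n => Φ (U z.1 - U z.2) :=
      hΦ.1.measurable.comp (by fun_prop)
    exact ((h2.comp measurable_snd).mul (by fun_prop)).mul (h1.comp measurable_snd)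
  have hjoint2 : Measurable fun w : Rn n × Rn n => φ (w.2 + w.1) * m w.2 := by
    have := hm.measurable
    fun_prop
  have hDm : AEStronglyMeasurable D volume :=
    (hjoint.stronglyMeasurable.integral_prod_right'.sub
      hjoint2.stronglyMeasurable.integral_prod_right').aestronglyMeasurable
  suffices h : ∀ ε > 0, |D 0| ≤ ε by
    have h0 : D 0 = 0 := abs_nonpos_iff.1 (le_of_forall_pos_le_add fun ε hε => by
      rw [zero_add]; exact h ε hε)
    simp only [hD, add_zero] at h0
    linarith
  intro ε hε
  obtain ⟨δ₁, hδ₁, hD1⟩ := Metric.continuousAt_iff.1 hDc ε hε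
  obtain ⟨δ₂, hδ₂, hKδ⟩ := hKc.exists_cthickening_subset_open hΩ hKΩ
  set δ := min δ₁ δ₂ with hδ
  have hδ0 : 0 < δ := lt_min hδ₁ hδ₂
  let ρ : ContDiffBump (0 : Rn n) := ⟨δ / 2, δ, by positivity, by linarith⟩
  have hρD := ρ.dist_normed_convolution_le (μ := volume) (x₀ := 0) (ε := ε) hDm
    (fun x hx => (hD1 (lt_of_lt_of_le hx (min_le_left _ _))).le)
  set w : Rn n → ℝ := ρ.normed volume with hw
  have hwc : Continuous w := ρ.continuous_normed
  have hwi : Integrable w := ρ.integrable_normed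
  set ψ : Rn n → ℝ := fun x => ∫ t, w t * φ (x - t) with hψ
  have hψconv : ψ = MeasureTheory.convolution w φ (ContinuousLinearMap.lsmul ℝ ℝ) volume := by
    ext x; rfl
  have hψtest : IsTestFun n Ω ψ := by
    refine ⟨?_, ?_, ?_⟩
    · rw [hψconv]
      exact ρ.hasCompactSupport_normed.contDiff_convolution_left _ ρ.contDiff_normed
        hφi.locallyIntegrable
    · rw [hψconv]
      exact ρ.hasCompactSupport_normed.convolution _ hφs
    · refine (closure_minimal ?_ isClosed_cthickening).trans hKδ
      intro x hx
      rw [hψconv] at hx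
      obtain ⟨a, ha, b, hb, rfl⟩ := support_convolution_subset _ hx
      have hb' : b ∈ Kc := by
        by_contra h
        exact hb (hφK b h)
      rw [hw, ρ.support_normed_eq, mem_ball_zero_iff] at ha
      apply mem_cthickening_of_dist_le _ b _ _ hb'
      rw [dist_eq_norm, add_sub_cancel_right]
      exact ha.le.trans (min_le_right _ _)
  have hF : Integrable (fun v : Rn n × (Rn n × Rn n) =>
      w v.1 * formInt Φ K U (fun x => φ (x + -v.1)) v.2) (volume.prod volume) := by
    have hmeas : Measurable (fun v : Rn n × (Rn n × Rn n) =>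
      w v.1 * formInt Φ K U (fun x => φ (x + -v.1)) v.2) :=
      (hwc.measurable.comp measurable_fst).mul
        (hjoint.comp (measurable_fst.neg.prodMk measurable_snd))
    refine ⟨hmeas.aestronglyMeasurable, ?_⟩
    rw [HasFiniteIntegral, lintegral_prod _ hmeas.enorm.aemeasurable]
    set B := ENNReal.ofReal (Λ ^ 2 * 1) * gagliardo n s p univ U +
      ENNReal.ofReal (Λ ^ 2 * 1 ^ (1 - p)) * gagliardo n s p univ φ with hB
    have hBt : B < ⊤ := ENNReal.add_lt_top.2 ⟨ENNReal.mul_lt_top ENNReal.ofReal_lt_top hUg,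
      ENNReal.mul_lt_top ENNReal.ofReal_lt_top hφg⟩
    calc _ ≤ ∫⁻ t, ‖w t‖ₑ * B := by
          apply lintegral_mono
          intro t
          simp only [enorm_mul]
          rw [lintegral_const_mul' _ _ enorm_ne_top]
          gcongr
          refine (lintegral_abs_formInt_le hp hΛ hΦ hK one_pos hU (by fun_prop)).trans ?_
          rw [gagliardo_univ_comp_add hφ]
      _ = (∫⁻ t, ‖w t‖ₑ) * B := lintegral_mul_const' _ _ hBt.ne
      _ < ⊤ := ENNReal.mul_lt_top hwi.2 hBt
  have hG : Integrable (fun v : Rn n × Rn n => w v.1 * (φ (v.2 + -v.1) * m v.2))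
      (volume.prod volume) := by
    have hmi : Integrable m := hm.integrable_of_hasCompactSupport hmc
    refine ((hwi.norm.mul_prod (hmi.norm.const_mul M))).mono' ?_ ?_
    · have := hm.measurable
      have := hwc.measurable
      exact (by fun_prop : Measurable _).aestronglyMeasurable
    · refine ae_of_all _ fun v => ?_
      rw [norm_mul, norm_mul, Real.norm_eq_abs (φ _)]
      gcongr
      exact hφM _
  have hFψ : ∀ z, ∫ t, w t * formInt Φ K U (fun x => φ (x + -t)) z = formInt Φ K U ψ z := by
    intro z
    have hInt : ∀ x, Integrable fun t => w t * φ (x - t) := fun x => by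
      have h1 : Integrable fun t => φ (x - t) := hφi.comp_sub_left x
      obtain ⟨B, hB⟩ := hwc.bounded_above_of_compact_support ρ.hasCompactSupport_normed
      exact h1.bdd_mul hwc.aestronglyMeasurable (ae_of_all _ hB)
    simp only [formInt, hψ]
    rw [← integral_sub (hInt _) (hInt _), ← integral_const_mul, ← integral_mul_const]
    congr 1
    ext t
    rw [← sub_eq_add_neg, ← sub_eq_add_neg]
    ring
  have hψint : Integrable (formInt Φ K U ψ) := by
    have := hF.integral_prod_right
    simpa only [hFψ] using this
  have e1 : ∫ z, formInt Φ K U ψ z =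
      ∫ t, w t * ∫ z, formInt Φ K U (fun x => φ (x + -t)) z := by
    have := integral_integral_swap (f := fun t z =>
      w t * formInt Φ K U (fun x => φ (x + -t)) z) hF
    simp only [integral_const_mul, hFψ] at this
    exact this.symm
  have e2 : ∫ x, ψ x * m x = ∫ t, w t * ∫ x, φ (x + -t) * m x := by
    have := integral_integral_swap (f := fun t x => w t * (φ (x + -t) * m x)) hG
    simp only [integral_const_mul] at this
    rw [this]
    congr 1
    ext x
    simp only [hψ]
    rw [← integral_mul_const]
    congr 1
    ext t
    rw [← sub_eq_add_neg]
    ring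
  have hzero : MeasureTheory.convolution w D (ContinuousLinearMap.lsmul ℝ ℝ) volume 0 = 0 := by
    rw [convolution_lsmul]
    simp only [zero_sub, smul_eq_mul, hD, mul_sub]
    rw [integral_sub, ← e1, ← e2, ← nonlocalForm_eq hψint, heq ψ hψtest, sub_self]
    · have := hF.integral_prod_left
      simpa only [integral_const_mul] using this
    · have := hG.integral_prod_left
      simpa only [integral_const_mul] using this
  rw [hzero, dist_comm, Real.dist_eq, sub_zero] at hρD
  exact hρD

/-! ### Cutoff functions and admissible test functions -/

lemma measurable_truncH (τ : ℝ) : Measurable (truncH τ) := by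
  unfold truncH; fun_prop

lemma measurable_powW (θ : ℝ) : Measurable (powW θ) := by
  unfold powW; fun_prop

lemma measurable_growG (m : ℝ) : Measurable (growG m) := by
  unfold growG
  exact Measurable.ite measurableSet_Ioi (by fun_prop) measurable_const

lemma abs_truncH_sub_le {τ : ℝ} (hτ : 0 ≤ τ) (a b : ℝ) :
    |truncH τ a - truncH τ b| ≤ τ * |a - b| := by
  wlog hab : b ≤ a generalizing a b
  · rw [abs_sub_comm, abs_sub_comm a b]
    exact this b a (le_of_not_ge hab)
  have hm := truncH_mono hτ hab
  rw [abs_of_nonneg (by linarith), abs_of_nonneg (by linarith)]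
  unfold truncH
  set A := 1 + max a 0 with hA
  set B := 1 + max b 0 with hB
  have hB1 : 1 ≤ B := by simp [hB]
  have hA1 : 1 ≤ A := by simp [hA]
  have hB0 : 0 < B := by linarith
  have hA0 : 0 < A := by linarith
  have hAB : A - B ≤ a - b := by
    have : max a 0 ≤ max b 0 + (a - b) := by
      apply max_le
      · have := le_max_left b 0; linarith
      · have := le_max_right b 0; linarith
    rw [hA, hB]; linarith
  have hAB0 : 0 ≤ A - B := by
    have : max b 0 ≤ max a 0 := by gcongr
    rw [hA, hB]; linarith
  have h := one_add_mul_one_sub_le_rpow_neg (div_pos hA0 hB0) hτ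
  rw [Real.div_rpow hA0.le hB0.le, le_div_iff₀ (by positivity)] at h
  have h1 : B ^ (-τ) ≤ 1 := Real.rpow_le_one_of_one_le_of_nonpos hB1 (by linarith)
  have h2 : 1 - A / B = -((A - B) / B) := by field_simp; ring
  rw [h2] at h
  have h3 : (A - B) / B ≤ A - B := div_le_self hAB0 hB1
  have h4 : τ * ((A - B) / B) * B ^ (-τ) ≤ τ * (a - b) * 1 := by
    have : 0 ≤ (A - B) / B := by positivity
    gcongr
    exact h3.trans hAB
  nlinarith

/-- A Lipschitz cutoff, equal to `1` on `B_{r/4}(x₀)` and supported in `B_{r/2}(x₀)`. -/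
def cutoff {n : ℕ} (x₀ : Rn n) (r : ℝ) (x : Rn n) : ℝ := max 0 (min 1 (2 - 4 / r * ‖x - x₀‖))

section cutoff

variable {n : ℕ} {x₀ : Rn n} {r : ℝ}

lemma cutoff_nonneg (x : Rn n) : 0 ≤ cutoff x₀ r x := le_max_left _ _

lemma cutoff_le_one (x : Rn n) : cutoff x₀ r x ≤ 1 := max_le zero_le_one (min_le_left _ _)

lemma cutoff_eq_one (hr : 0 < r) {x : Rn n} (hx : ‖x - x₀‖ ≤ r / 4) : cutoff x₀ r x = 1 := by
  have : 4 / r * ‖x - x₀‖ ≤ 1 := by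
    rw [div_mul_eq_mul_div, div_le_one hr]; linarith
  unfold cutoff
  rw [min_eq_left (by linarith)]; simp

lemma cutoff_eq_zero (hr : 0 < r) {x : Rn n} (hx : r / 2 ≤ ‖x - x₀‖) : cutoff x₀ r x = 0 := by
  have : 2 ≤ 4 / r * ‖x - x₀‖ := by
    rw [div_mul_eq_mul_div, le_div_iff₀ hr]; linarith
  unfold cutoff
  exact max_eq_left ((min_le_right _ _).trans (by linarith))

lemma measurable_cutoff : Measurable (cutoff x₀ r) := by
  unfold cutoff; fun_prop

lemma abs_cutoff_sub_le (hr : 0 < r) (x y : Rn n) :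
    |cutoff x₀ r x - cutoff x₀ r y| ≤ 4 / r * ‖x - y‖ := by
  have h1 : |max 0 (min 1 (2 - 4 / r * ‖x - x₀‖)) - max 0 (min 1 (2 - 4 / r * ‖y - x₀‖))| ≤
      |(2 - 4 / r * ‖x - x₀‖) - (2 - 4 / r * ‖y - x₀‖)| := by
    refine (abs_max_sub_max_le_max _ _ _ _).trans ?_
    simp only [sub_self, abs_zero]
    refine max_le (abs_nonneg _) ((abs_min_sub_min_le_max _ _ _ _).trans ?_)
    simp
  refine h1.trans ?_
  have h2 : (2 - 4 / r * ‖x - x₀‖) - (2 - 4 / r * ‖y - x₀‖) =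
      4 / r * (‖y - x₀‖ - ‖x - x₀‖) := by ring
  rw [h2, abs_mul, abs_of_pos (by positivity : 0 < 4 / r)]
  gcongr
  refine (abs_norm_sub_norm_le _ _).trans ?_
  rw [sub_sub_sub_cancel_right, norm_sub_rev]

end cutoff

lemma rpow_div_rpow_le_of_lipschitz {n : ℕ} {s p L : ℝ} (hp : 1 < p)
    {v : Rn n → ℝ} (hL : ∀ x y, |v x - v y| ≤ L * ‖x - y‖) (hL0 : 0 ≤ L) (x y : Rn n) :
    |v x - v y| ^ p / ‖x - y‖ ^ ((n : ℝ) + s * p) ≤ L ^ p * ‖x - y‖ ^ ((p - s * p) - n) := by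
  rcases eq_or_ne x y with rfl | hxy
  · rw [sub_self, abs_zero, Real.zero_rpow (by linarith), zero_div]
    positivity
  · have h3 : 0 < ‖x - y‖ := norm_pos_iff.2 (sub_ne_zero.2 hxy)
    rw [div_le_iff₀ (by positivity), mul_assoc, ← Real.rpow_add h3]
    have : p - s * p - n + (n + s * p) = p := by ring
    rw [this, ← Real.mul_rpow hL0 h3.le]
    have := hL x y
    gcongr

lemma lintegral_cutoff_near {n : ℕ} (hn : 2 ≤ n) {s p : ℝ} (hs1 : s < 1) (hp : 1 < p) :
    ∃ C : ℝ, 0 < C ∧ ∀ r : ℝ, 0 < r → ∀ x₀ x : Rn n,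
      ∫⁻ y in ball x (2 * r),
        ENNReal.ofReal (|cutoff x₀ r x - cutoff x₀ r y| ^ p / ‖x - y‖ ^ ((n : ℝ) + s * p)) ≤
        ENNReal.ofReal (C * r ^ (-(s * p))) := by
  have he : 0 < p - s * p := by nlinarith
  obtain ⟨C, hC, h⟩ := lintegral_ball_norm_rpow hn he
  refine ⟨4 ^ p * C * 2 ^ (p - s * p), by positivity, fun r hr x₀ x => ?_⟩
  calc _ ≤ ∫⁻ y in ball x (2 * r),
        ENNReal.ofReal ((4 / r) ^ p) * ENNReal.ofReal (‖x - y‖ ^ ((p - s * p) - n)) := by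
        apply lintegral_mono
        intro y
        beta_reduce
        rw [← ENNReal.ofReal_mul (by positivity)]
        exact ENNReal.ofReal_le_ofReal (rpow_div_rpow_le_of_lipschitz hp
          (abs_cutoff_sub_le hr) (by positivity) x y)
    _ ≤ ENNReal.ofReal ((4 / r) ^ p) * ENNReal.ofReal (C * (2 * r) ^ (p - s * p)) := by
        rw [lintegral_const_mul' _ _ ENNReal.ofReal_ne_top]
        gcongr
        exact h _ (by positivity) x
    _ = _ := by
        rw [← ENNReal.ofReal_mul (by positivity)]
        congr 1
        rw [Real.div_rpow (by norm_num) hr.le, Real.mul_rpow (by norm_num) hr.le,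
          Real.rpow_sub hr, Real.rpow_neg hr.le]
        have := (Real.rpow_pos_of_pos hr p).ne'
        field_simp

lemma gagliardo_lt_top_of_lipschitz {n : ℕ} (hn : 2 ≤ n) {s p L R : ℝ} (hs : 0 < s) (hs1 : s < 1)
    (hp : 1 < p) {v : Rn n → ℝ} (hv : Measurable v) (hL0 : 0 ≤ L)
    (hL : ∀ x y, |v x - v y| ≤ L * ‖x - y‖) (hv1 : ∀ x, |v x| ≤ 1) {x₀ : Rn n}
    (hvR : ∀ x, x ∉ ball x₀ R → v x = 0) : gagliardo n s p univ v < ⊤ := by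
  have he : 0 < p - s * p := by nlinarith
  have hp0 : 0 < p := by linarith
  have hsp : 0 < s * p := by positivity
  obtain ⟨C₁, hC₁, h₁⟩ := lintegral_ball_norm_rpow hn he
  obtain ⟨C₂, hC₂, h₂⟩ := lintegral_compl_ball_norm_rpow hn hsp
  set k : Rn n → Rn n → ℝ≥0∞ := fun x y =>
    ENNReal.ofReal (|v x - v y| ^ p / ‖x - y‖ ^ ((n : ℝ) + s * p)) with hk
  have hkm : Measurable (Function.uncurry k) :=
    (measurable_gagliardo_integrand hv).ennreal_ofReal
  have hsym : ∀ x y, k x y = k y x := fun x y => by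
    simp only [hk]; rw [abs_sub_comm, norm_sub_rev]
  set A : ℝ≥0∞ := ENNReal.ofReal (L ^ p) * ENNReal.ofReal (C₁ * 1 ^ (p - s * p)) +
    ENNReal.ofReal (2 ^ p) * ENNReal.ofReal (C₂ * 1 ^ (-(s * p))) with hA
  have hAt : A < ⊤ := by
    simp only [hA]
    exact ENNReal.add_lt_top.2 ⟨ENNReal.mul_lt_top ENNReal.ofReal_lt_top ENNReal.ofReal_lt_top,
      ENNReal.mul_lt_top ENNReal.ofReal_lt_top ENNReal.ofReal_lt_top⟩
  have hkA : ∀ x, ∫⁻ y, k x y ≤ A := by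
    intro x
    rw [← lintegral_add_compl _ (measurableSet_ball (x := x) (ε := 1))]
    apply add_le_add
    · calc _ ≤ ∫⁻ y in ball x 1,
            ENNReal.ofReal (L ^ p) * ENNReal.ofReal (‖x - y‖ ^ ((p - s * p) - n)) := by
            apply lintegral_mono
            intro y
            beta_reduce
            rw [← ENNReal.ofReal_mul (by positivity)]
            exact ENNReal.ofReal_le_ofReal (rpow_div_rpow_le_of_lipschitz hp hL hL0 x y)
        _ ≤ _ := by
            rw [lintegral_const_mul' _ _ ENNReal.ofReal_ne_top]
            gcongr
            exact h₁ 1 one_pos x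
    · calc _ ≤ ∫⁻ y in (ball x 1)ᶜ,
            ENNReal.ofReal (2 ^ p) * ENNReal.ofReal (‖x - y‖ ^ (-(n + s * p))) := by
            apply lintegral_mono
            intro y
            beta_reduce
            rw [← ENNReal.ofReal_mul (by positivity), Real.rpow_neg (norm_nonneg _),
              ← div_eq_mul_inv]
            apply ENNReal.ofReal_le_ofReal
            gcongr
            have := abs_sub (v x) (v y)
            linarith [hv1 x, hv1 y]
        _ ≤ _ := by
            rw [lintegral_const_mul' _ _ ENNReal.ofReal_ne_top]
            gcongr
            exact h₂ 1 one_pos x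
  have hle : ∀ x y, k x y ≤ (ball x₀ R).indicator (fun x => k x y) x +
      (ball x₀ R).indicator (fun y => k y x) y := by
    intro x y
    by_cases hx : x ∈ ball x₀ R
    · rw [indicator_of_mem hx]; exact le_self_add
    by_cases hy : y ∈ ball x₀ R
    · rw [indicator_of_mem hy, hsym x y]; exact le_add_self
    · simp only [hk]
      rw [hvR x hx, hvR y hy, sub_self, abs_zero, Real.zero_rpow hp0.ne']
      simp
  have hm1 : Measurable fun z : Rn n × Rn n => (ball x₀ R).indicator (fun x => k x z.2) z.1 := by
    have h3 : MeasurableSet {z : Rn n × Rn n | z.1 ∈ ball x₀ R} :=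
      measurableSet_ball.preimage measurable_fst
    have e : (fun z : Rn n × Rn n => (ball x₀ R).indicator (fun x => k x z.2) z.1) =
        {z : Rn n × Rn n | z.1 ∈ ball x₀ R}.indicator (Function.uncurry k) := by
      funext z
      by_cases hz : z.1 ∈ ball x₀ R
      · rw [indicator_of_mem hz, indicator_of_mem (by exact hz)]; rfl
      · rw [indicator_of_notMem hz, indicator_of_notMem (by exact hz)]
    rw [e]
    exact hkm.indicator h3
  have hm2 : Measurable fun z : Rn n × Rn n => (ball x₀ R).indicator (fun y => k y z.1) z.2 :=
    by simpa only [Function.comp_def, Prod.fst_swap, Prod.snd_swap] using hm1.comp measurable_swap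
  have hone : ∫⁻ x, ∫⁻ y, (ball x₀ R).indicator (fun x => k x y) x ≤ A * volume (ball x₀ R) := by
    calc _ = ∫⁻ x, (ball x₀ R).indicator (fun x => ∫⁻ y, k x y) x := by
          congr 1; ext x
          by_cases hx : x ∈ ball x₀ R <;> simp [hx]
      _ = ∫⁻ x in ball x₀ R, ∫⁻ y, k x y := lintegral_indicator measurableSet_ball _
      _ ≤ ∫⁻ x in ball x₀ R, A := lintegral_mono fun x => hkA x
      _ = _ := setLIntegral_const _ _
  have hfin : A * volume (ball x₀ R) < ⊤ := ENNReal.mul_lt_top hAt measure_ball_lt_top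
  have : gagliardo n s p univ v ≤ A * volume (ball x₀ R) + A * volume (ball x₀ R) := by
    unfold gagliardo
    simp only [Measure.restrict_univ]
    calc ∫⁻ x, ∫⁻ y, k x y ≤ ∫⁻ x, ((∫⁻ y, (ball x₀ R).indicator (fun x => k x y) x) +
          ∫⁻ y, (ball x₀ R).indicator (fun y => k y x) y) := by
          apply lintegral_mono
          intro x
          beta_reduce
          have hmx : Measurable fun y => (ball x₀ R).indicator (fun x => k x y) x := by
            by_cases hx : x ∈ ball x₀ R
            · simp only [indicator_of_mem hx]
              exact hkm.of_uncurry_left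
            · simp only [indicator_of_notMem hx]
              exact measurable_const
          rw [← lintegral_add_left hmx]
          exact lintegral_mono fun y => hle x y
      _ = (∫⁻ x, ∫⁻ y, (ball x₀ R).indicator (fun x => k x y) x) +
          ∫⁻ x, ∫⁻ y, (ball x₀ R).indicator (fun y => k y x) y := by
          rw [lintegral_add_left]
          exact hm1.lintegral_prod_right'
      _ ≤ _ := by
          apply add_le_add hone
          rw [lintegral_lintegral_swap (f := fun x y => (ball x₀ R).indicator (fun y => k y x) y)
            hm2.aemeasurable]
          exact hone
  exact this.trans_lt (ENNReal.add_lt_top.2 ⟨hfin, hfin⟩)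

lemma gagliardo_test_lt_top {n : ℕ} (hn : 2 ≤ n) {s p τ r : ℝ} (hs : 0 < s) (hs1 : s < 1)
    (hp : 1 < p) (hτ : 0 < τ) (hr : 0 < r) {U : Rn n → ℝ} (hU : Measurable U)
    (hUg : gagliardo n s p univ U < ⊤) (x₀ : Rn n) :
    gagliardo n s p univ (fun x => truncH τ (U x) * cutoff x₀ r x ^ p) < ⊤ := by
  have hp0 : 0 < p := by linarith
  have hcp : Measurable fun x => cutoff x₀ r x ^ p := measurable_cutoff.pow_const p
  have hT : Measurable fun x => truncH τ (U x) := (measurable_truncH τ).comp hU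
  have hc : gagliardo n s p univ (fun x => cutoff x₀ r x ^ p) < ⊤ := by
    apply gagliardo_lt_top_of_lipschitz hn hs hs1 hp hcp (L := p * (4 / r)) (R := r)
      (by positivity) (x₀ := x₀)
    · intro x y
      have key : ∀ e f : ℝ, 0 ≤ e → e ≤ f → f ≤ 1 → f ^ p - e ^ p ≤ p * (f - e) := by
        intro e f he hef hf
        have h1 := rpow_sub_rpow_le hp.le he hef
        have h2 : f ^ (p - 1) ≤ 1 := Real.rpow_le_one (he.trans hef) hf (by linarith)
        have h3 : p * f ^ (p - 1) * (f - e) ≤ p * 1 * (f - e) := by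
          have : 0 ≤ f - e := by linarith
          gcongr
        linarith
      have h4 : |cutoff x₀ r x ^ p - cutoff x₀ r y ^ p| ≤
          p * |cutoff x₀ r x - cutoff x₀ r y| := by
        rcases le_total (cutoff x₀ r x) (cutoff x₀ r y) with h | h
        · have h5 : cutoff x₀ r x ^ p ≤ cutoff x₀ r y ^ p :=
            Real.rpow_le_rpow (cutoff_nonneg x) h hp0.le
          rw [abs_sub_comm, abs_of_nonneg (by linarith), abs_sub_comm, abs_of_nonneg (by linarith)]
          exact key _ _ (cutoff_nonneg x) h (cutoff_le_one y)
        · have h5 : cutoff x₀ r y ^ p ≤ cutoff x₀ r x ^ p :=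
            Real.rpow_le_rpow (cutoff_nonneg y) h hp0.le
          rw [abs_of_nonneg (by linarith), abs_of_nonneg (by linarith)]
          exact key _ _ (cutoff_nonneg y) h (cutoff_le_one x)
      have h6 := abs_cutoff_sub_le (x₀ := x₀) hr x y
      calc _ ≤ p * |cutoff x₀ r x - cutoff x₀ r y| := h4
        _ ≤ p * (4 / r * ‖x - y‖) := by gcongr
        _ = _ := by ring
    · intro x
      rw [abs_of_nonneg (Real.rpow_nonneg (cutoff_nonneg x) p)]
      exact Real.rpow_le_one (cutoff_nonneg x) (cutoff_le_one x) hp0.le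
    · intro x hx
      rw [mem_ball, not_lt, dist_eq_norm] at hx
      rw [cutoff_eq_zero hr (by linarith), Real.zero_rpow hp0.ne']
  rw [gagliardo_univ_eq (v := fun x => truncH τ (U x) * cutoff x₀ r x ^ p) (hT.mul hcp)]
  rw [gagliardo_univ_eq hcp] at hc
  rw [gagliardo_univ_eq hU] at hUg
  calc _ ≤ ∫⁻ z : Rn n × Rn n, (ENNReal.ofReal (2 ^ p * τ ^ p) * ENNReal.ofReal
          (|U z.1 - U z.2| ^ p / ‖z.1 - z.2‖ ^ ((n : ℝ) + s * p)) +
        ENNReal.ofReal (2 ^ p) * ENNReal.ofReal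
          (|cutoff x₀ r z.1 ^ p - cutoff x₀ r z.2 ^ p| ^ p /
            ‖z.1 - z.2‖ ^ ((n : ℝ) + s * p))) := by
        apply lintegral_mono
        rintro ⟨x, y⟩
        dsimp only
        rw [← ENNReal.ofReal_mul (by positivity), ← ENNReal.ofReal_mul (by positivity),
          ← ENNReal.ofReal_add (by positivity) (by positivity)]
        apply ENNReal.ofReal_le_ofReal
        rw [← mul_div_assoc, ← mul_div_assoc, ← add_div]
        gcongr
        have h1 := abs_truncH_sub_le hτ.le (U x) (U y)
        have hc0 : 0 ≤ cutoff x₀ r x ^ p := Real.rpow_nonneg (cutoff_nonneg x) p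
        have hc1 : cutoff x₀ r x ^ p ≤ 1 :=
          Real.rpow_le_one (cutoff_nonneg x) (cutoff_le_one x) hp0.le
        have hH0 := truncH_nonneg hτ.le (U y)
        have hH1 := truncH_le_one τ (U y)
        have h2 : |truncH τ (U x) * cutoff x₀ r x ^ p - truncH τ (U y) * cutoff x₀ r y ^ p| ≤
            τ * |U x - U y| + |cutoff x₀ r x ^ p - cutoff x₀ r y ^ p| := by
          have e : truncH τ (U x) * cutoff x₀ r x ^ p - truncH τ (U y) * cutoff x₀ r y ^ p =
            (truncH τ (U x) - truncH τ (U y)) * cutoff x₀ r x ^ p +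
            truncH τ (U y) * (cutoff x₀ r x ^ p - cutoff x₀ r y ^ p) := by ring
          rw [e]
          refine (abs_add_le _ _).trans ?_
          rw [abs_mul, abs_mul, abs_of_nonneg hc0, abs_of_nonneg hH0]
          apply add_le_add
          · refine (mul_le_of_le_one_right (abs_nonneg _) hc1).trans h1
          · exact mul_le_of_le_one_left (abs_nonneg _) hH1
        calc _ ≤ (τ * |U x - U y| + |cutoff x₀ r x ^ p - cutoff x₀ r y ^ p|) ^ p := by gcongr
          _ ≤ 2 ^ p * ((τ * |U x - U y|) ^ p + |cutoff x₀ r x ^ p - cutoff x₀ r y ^ p| ^ p) :=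
            add_rpow_le_two_rpow_mul hp0.le (by positivity) (abs_nonneg _)
          _ = _ := by rw [Real.mul_rpow hτ.le (abs_nonneg _)]; ring
    _ < ⊤ := by
        rw [lintegral_add_left, lintegral_const_mul' _ _ ENNReal.ofReal_ne_top,
          lintegral_const_mul' _ _ ENNReal.ofReal_ne_top]
        · exact ENNReal.add_lt_top.2 ⟨ENNReal.mul_lt_top ENNReal.ofReal_lt_top hUg,
            ENNReal.mul_lt_top ENNReal.ofReal_lt_top hc⟩
        · have := measurable_gagliardo_integrand (s := s) (p := p) hU
          fun_prop

lemma lintegral_ofReal_le_of_le_add {α : Type*} [MeasurableSpace α] {ν : Measure α}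
    {F h g : α → ℝ} (hF : Integrable F ν) (hh : Measurable h) (hh0 : ∀ x, 0 ≤ h x)
    (hg0 : ∀ x, 0 ≤ g x) (hle : ∀ x, g x ≤ F x + h x) :
    ∫⁻ x, ENNReal.ofReal (g x) ∂ν ≤ ENNReal.ofReal (∫ x, F x ∂ν) +
      ∫⁻ x, ENNReal.ofReal (h x) ∂ν := by
  by_cases htop : ∫⁻ x, ENNReal.ofReal (h x) ∂ν = ⊤
  · rw [htop, add_top]; exact le_top
  have hi : Integrable h ν := by
    refine ⟨hh.aestronglyMeasurable, ?_⟩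
    rw [hasFiniteIntegral_iff_ofReal (ae_of_all _ hh0)]
    exact lt_top_iff_ne_top.2 htop
  calc ∫⁻ x, ENNReal.ofReal (g x) ∂ν ≤ ∫⁻ x, ENNReal.ofReal (F x + h x) ∂ν :=
        lintegral_mono fun x => ENNReal.ofReal_le_ofReal (hle x)
    _ = ENNReal.ofReal (∫ x, (F x + h x) ∂ν) :=
        (ofReal_integral_eq_lintegral_ofReal (hF.add hi)
          (ae_of_all _ fun x => (hg0 x).trans (hle x))).symm
    _ = ENNReal.ofReal ((∫ x, F x ∂ν) + ∫ x, h x ∂ν) := by rw [integral_add hF hi]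
    _ ≤ ENNReal.ofReal (∫ x, F x ∂ν) + ENNReal.ofReal (∫ x, h x ∂ν) := ENNReal.ofReal_add_le
    _ = _ := by rw [ofReal_integral_eq_lintegral_ofReal hi (ae_of_all _ hh0)]

/-- The error term of the energy estimate, supported where the first variable lies in the ball. -/
def energyErr {n : ℕ} (s p m : ℝ) (x₀ : Rn n) (r : ℝ) (U : Rn n → ℝ) (x y : Rn n) : ℝ :=
  (ball x₀ r).indicator (fun x => growG m (U x)) x *
    ((ball x₀ r).indicator (fun y => |cutoff x₀ r x - cutoff x₀ r y| ^ p /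
        ‖x - y‖ ^ ((n : ℝ) + s * p)) y +
      (ball x₀ r)ᶜ.indicator (fun y => (1 + max (U y) 0 ^ (p - 1)) * 2 ^ ((n : ℝ) + s * p) /
        ‖y - x₀‖ ^ ((n : ℝ) + s * p)) y)

lemma energyErr_nonneg {n : ℕ} (s p m : ℝ) (x₀ : Rn n) (r : ℝ) (U : Rn n → ℝ) (x y : Rn n) :
    0 ≤ energyErr s p m x₀ r U x y := by
  unfold energyErr
  refine mul_nonneg (indicator_nonneg (fun _ _ => growG_nonneg _ _) _)
    (add_nonneg (indicator_nonneg (fun _ _ => ?_) _) (indicator_nonneg (fun _ _ => ?_) _)) <;>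
    positivity

lemma measurable_energyErr {n : ℕ} {s p m : ℝ} {x₀ : Rn n} {r : ℝ} {U : Rn n → ℝ}
    (hU : Measurable U) :
    Measurable fun z : Rn n × Rn n => energyErr s p m x₀ r U z.1 z.2 := by
  have hB : MeasurableSet (ball x₀ r) := measurableSet_ball
  have h1 : Measurable ((ball x₀ r).indicator (fun x => growG m (U x))) :=
    ((measurable_growG m).comp hU).indicator hB
  have h2 : Measurable ((ball x₀ r)ᶜ.indicator (fun y => (1 + max (U y) 0 ^ (p - 1)) *
      2 ^ ((n : ℝ) + s * p) / ‖y - x₀‖ ^ ((n : ℝ) + s * p))) := by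
    refine Measurable.indicator ?_ hB.compl
    fun_prop
  have h3 : Measurable fun z : Rn n × Rn n => |cutoff x₀ r z.1 - cutoff x₀ r z.2| ^ p /
        ‖z.1 - z.2‖ ^ ((n : ℝ) + s * p) :=
    measurable_gagliardo_integrand measurable_cutoff
  have h4 : Measurable fun z : Rn n × Rn n => (ball x₀ r).indicator
      (fun y => |cutoff x₀ r z.1 - cutoff x₀ r y| ^ p / ‖z.1 - y‖ ^ ((n : ℝ) + s * p)) z.2 := by
    have e : (fun z : Rn n × Rn n => (ball x₀ r).indicator
      (fun y => |cutoff x₀ r z.1 - cutoff x₀ r y| ^ p / ‖z.1 - y‖ ^ ((n : ℝ) + s * p)) z.2) =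
      (Prod.snd ⁻¹' ball x₀ r).indicator fun z : Rn n × Rn n =>
        |cutoff x₀ r z.1 - cutoff x₀ r z.2| ^ p / ‖z.1 - z.2‖ ^ ((n : ℝ) + s * p) := by
      funext z
      by_cases hz : z.2 ∈ ball x₀ r
      · rw [indicator_of_mem hz, indicator_of_mem (by exact hz)]
      · rw [indicator_of_notMem hz, indicator_of_notMem (by exact hz)]
    rw [e]
    exact h3.indicator (measurable_snd hB)
  unfold energyErr
  exact (h1.comp measurable_fst).mul (h4.add (h2.comp measurable_snd))

lemma kernel_energy_le {n : ℕ} {Λ s p c A B E : ℝ} {K : Rn n → Rn n → ℝ}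
    (hK : KernelBounds n Λ s p K) (hΛ : 1 ≤ Λ) (hA : 0 ≤ A) (hE : 0 ≤ E) (hc : 0 < c)
    (h : c * A ≤ B + E) {x y : Rn n} (hxy : x ≠ y) :
    c / Λ * (A / ‖x - y‖ ^ ((n : ℝ) + s * p)) ≤
      B * K x y + Λ * (E / ‖x - y‖ ^ ((n : ℝ) + s * p)) := by
  have hd : 0 < ‖x - y‖ := norm_pos_iff.2 (sub_ne_zero.2 hxy)
  set k := ‖x - y‖ ^ ((n : ℝ) + s * p) with hk
  have hk0 : 0 < k := Real.rpow_pos_of_pos hd _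
  have hK0 := hK.nonneg hΛ hxy
  obtain ⟨h1, h2⟩ := hK.2 x y hxy
  have hΛ0 : 0 < Λ := by linarith
  calc c / Λ * (A / k) = (c * A) * (1 / (Λ * k)) := by field_simp
    _ ≤ (c * A) * K x y := by gcongr
    _ ≤ (B + E) * K x y := by gcongr
    _ = B * K x y + E * K x y := by ring
    _ ≤ B * K x y + E * (Λ / k) := by gcongr
    _ = _ := by ring

lemma energy_integrand_le {n : ℕ} {Λ p τ m c C : ℝ} {Φ : ℝ → ℝ} {K : Rn n → Rn n → ℝ} {s : ℝ}
    (hs : 0 < s) (hΛ : 1 ≤ Λ) (hp : 1 < p) (hc : 0 < c) (hC : 0 < C)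
    (hK : KernelBounds n Λ s p K)
    (hpt : ∀ a b e f : ℝ,
      0 ≤ e → e ≤ 1 → 0 ≤ f → f ≤ 1 →
      (c * |powW ((p - 1 - τ) / p) a * e - powW ((p - 1 - τ) / p) b * f| ^ p ≤
        Φ (a - b) * (truncH τ a * e ^ p - truncH τ b * f ^ p) +
          C * ((growG m a + growG m b) * |e - f| ^ p)) ∧
      (f = 0 → c * |powW ((p - 1 - τ) / p) a * e - powW ((p - 1 - τ) / p) b * f| ^ p ≤
        Φ (a - b) * (truncH τ a * e ^ p - truncH τ b * f ^ p) +
          C * (growG m a * (1 + max b 0 ^ (p - 1)))) ∧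
      (e = 0 → c * |powW ((p - 1 - τ) / p) a * e - powW ((p - 1 - τ) / p) b * f| ^ p ≤
        Φ (a - b) * (truncH τ a * e ^ p - truncH τ b * f ^ p) +
          C * (growG m b * (1 + max a 0 ^ (p - 1)))))
    {x₀ : Rn n} {r : ℝ} (hr : 0 < r) (U : Rn n → ℝ) (x y : Rn n) :
    c / Λ * (|powW ((p - 1 - τ) / p) (U x) * cutoff x₀ r x -
        powW ((p - 1 - τ) / p) (U y) * cutoff x₀ r y| ^ p / ‖x - y‖ ^ ((n : ℝ) + s * p)) ≤
      formInt Φ K U (fun x => truncH τ (U x) * cutoff x₀ r x ^ p) (x, y) +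
        Λ * C * (energyErr s p m x₀ r U x y + energyErr s p m x₀ r U y x) := by
  have hp0 : 0 < p := by linarith
  have hΛ0 : 0 < Λ := by linarith
  have hE1 := energyErr_nonneg s p m x₀ r U x y
  have hE2 := energyErr_nonneg s p m x₀ r U y x
  have hnsp : (0 : ℝ) < (n : ℝ) + s * p := by positivity
  rcases eq_or_ne x y with rfl | hxy
  · simp only [formInt, sub_self, abs_zero, Real.zero_rpow hp0.ne', zero_div, mul_zero, zero_mul,
      zero_add]
    positivity
  have htriv : cutoff x₀ r x = 0 → cutoff x₀ r y = 0 →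
      c / Λ * (|powW ((p - 1 - τ) / p) (U x) * cutoff x₀ r x -
        powW ((p - 1 - τ) / p) (U y) * cutoff x₀ r y| ^ p / ‖x - y‖ ^ ((n : ℝ) + s * p)) ≤
      formInt Φ K U (fun x => truncH τ (U x) * cutoff x₀ r x ^ p) (x, y) +
        Λ * C * (energyErr s p m x₀ r U x y + energyErr s p m x₀ r U y x) := by
    intro h1 h2
    simp only [formInt, h1, h2, mul_zero, sub_self, abs_zero, Real.zero_rpow hp0.ne', zero_div,
      zero_mul, zero_add]
    positivity
  have hout : ∀ z : Rn n, z ∉ ball x₀ r → r ≤ ‖z - x₀‖ := fun z hz => by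
    rwa [mem_ball, not_lt, dist_eq_norm] at hz
  obtain ⟨hnear, hfar1, hfar2⟩ := hpt (U x) (U y) (cutoff x₀ r x) (cutoff x₀ r y)
    (cutoff_nonneg x) (cutoff_le_one x) (cutoff_nonneg y) (cutoff_le_one y)
  have hGx := growG_nonneg m (U x)
  have hGy := growG_nonneg m (U y)
  have hdist : ∀ a b : Rn n, ‖a - x₀‖ < r / 2 → r ≤ ‖b - x₀‖ →
      1 / ‖a - b‖ ^ ((n : ℝ) + s * p) ≤
        2 ^ ((n : ℝ) + s * p) / ‖b - x₀‖ ^ ((n : ℝ) + s * p) := by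
    intro a b ha hb
    have h1 : ‖b - x₀‖ ≤ ‖a - b‖ + ‖a - x₀‖ := by
      have := norm_sub_le (a - x₀) (a - b)
      rw [sub_sub_sub_cancel_left] at this
      linarith
    have h2 : ‖b - x₀‖ ≤ 2 * ‖a - b‖ := by linarith
    have h3 : 0 < ‖b - x₀‖ := by linarith
    have h4 : 0 < ‖a - b‖ := by linarith
    rw [div_le_div_iff₀ (by positivity) (by positivity), one_mul,
      ← Real.mul_rpow (by norm_num) h4.le]
    gcongr
  by_cases hx : x ∈ ball x₀ r <;> by_cases hy : y ∈ ball x₀ r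
  · refine (kernel_energy_le hK hΛ (by positivity) (by positivity) hc hnear hxy).trans ?_
    simp only [formInt]
    have e1 : energyErr s p m x₀ r U x y = growG m (U x) *
        (|cutoff x₀ r x - cutoff x₀ r y| ^ p / ‖x - y‖ ^ ((n : ℝ) + s * p)) := by
      simp [energyErr, hx, hy]
    have e2 : energyErr s p m x₀ r U y x = growG m (U y) *
        (|cutoff x₀ r x - cutoff x₀ r y| ^ p / ‖x - y‖ ^ ((n : ℝ) + s * p)) := by
      simp [energyErr, hx, hy, abs_sub_comm (cutoff x₀ r y), norm_sub_rev y]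
    rw [e1, e2]
    apply le_of_eq
    ring
  · have hη := cutoff_eq_zero (x₀ := x₀) hr (x := y) (by linarith [hout y hy])
    by_cases hx2 : r / 2 ≤ ‖x - x₀‖
    · exact htriv (cutoff_eq_zero hr hx2) hη
    refine (kernel_energy_le hK hΛ (by positivity) (by positivity) hc (hfar1 hη) hxy).trans ?_
    simp only [formInt]
    have e1 : energyErr s p m x₀ r U x y = growG m (U x) * ((1 + max (U y) 0 ^ (p - 1)) *
        2 ^ ((n : ℝ) + s * p) / ‖y - x₀‖ ^ ((n : ℝ) + s * p)) := by
      simp [energyErr, hx, hy]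
    have h5 := hdist x y (not_le.1 hx2) (hout y hy)
    have h6 : C * (growG m (U x) * (1 + max (U y) 0 ^ (p - 1))) / ‖x - y‖ ^ ((n : ℝ) + s * p) ≤
        C * energyErr s p m x₀ r U x y := by
      calc _ = C * (growG m (U x) * (1 + max (U y) 0 ^ (p - 1))) *
            (1 / ‖x - y‖ ^ ((n : ℝ) + s * p)) := by ring
        _ ≤ C * (growG m (U x) * (1 + max (U y) 0 ^ (p - 1))) *
            (2 ^ ((n : ℝ) + s * p) / ‖y - x₀‖ ^ ((n : ℝ) + s * p)) := by gcongr
        _ = _ := by rw [e1]; ring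
    have h7 : Λ * (C * (growG m (U x) * (1 + max (U y) 0 ^ (p - 1))) /
        ‖x - y‖ ^ ((n : ℝ) + s * p)) ≤ Λ * (C * energyErr s p m x₀ r U x y) := by gcongr
    have h8 : 0 ≤ Λ * C * energyErr s p m x₀ r U y x := by positivity
    linarith
  · have hη := cutoff_eq_zero (x₀ := x₀) hr (x := x) (by linarith [hout x hx])
    by_cases hy2 : r / 2 ≤ ‖y - x₀‖
    · exact htriv hη (cutoff_eq_zero hr hy2)
    refine (kernel_energy_le hK hΛ (by positivity) (by positivity) hc (hfar2 hη) hxy).trans ?_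
    simp only [formInt]
    have e1 : energyErr s p m x₀ r U y x = growG m (U y) * ((1 + max (U x) 0 ^ (p - 1)) *
        2 ^ ((n : ℝ) + s * p) / ‖x - x₀‖ ^ ((n : ℝ) + s * p)) := by
      simp [energyErr, hx, hy]
    have h5 := hdist y x (not_le.1 hy2) (hout x hx)
    rw [norm_sub_rev y x] at h5
    have h6 : C * (growG m (U y) * (1 + max (U x) 0 ^ (p - 1))) / ‖x - y‖ ^ ((n : ℝ) + s * p) ≤
        C * energyErr s p m x₀ r U y x := by
      calc _ = C * (growG m (U y) * (1 + max (U x) 0 ^ (p - 1))) *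
            (1 / ‖x - y‖ ^ ((n : ℝ) + s * p)) := by ring
        _ ≤ C * (growG m (U y) * (1 + max (U x) 0 ^ (p - 1))) *
            (2 ^ ((n : ℝ) + s * p) / ‖x - x₀‖ ^ ((n : ℝ) + s * p)) := by gcongr
        _ = _ := by rw [e1]; ring
    have h7 : Λ * (C * (growG m (U y) * (1 + max (U x) 0 ^ (p - 1))) /
        ‖x - y‖ ^ ((n : ℝ) + s * p)) ≤ Λ * (C * energyErr s p m x₀ r U y x) := by gcongr
    have h8 : 0 ≤ Λ * C * energyErr s p m x₀ r U x y := by positivity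
    linarith
  · exact htriv (cutoff_eq_zero hr (by linarith [hout x hx]))
      (cutoff_eq_zero hr (by linarith [hout y hy]))

lemma lintegral_energyErr_le {n : ℕ} (hn : 2 ≤ n) {s p : ℝ} (hs : 0 < s) (hs1 : s < 1)
    (hp : 1 < p) :
    ∃ C : ℝ, 0 < C ∧ ∀ (m : ℝ) (U : Rn n → ℝ), Measurable U → ∀ (x₀ : Rn n) (r T : ℝ), 0 < r →
      0 ≤ T → ∫⁻ y in (ball x₀ r)ᶜ,
        ENNReal.ofReal (max (U y) 0 ^ (p - 1) / ‖y - x₀‖ ^ ((n : ℝ) + s * p)) ≤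
          ENNReal.ofReal (r ^ (-(s * p)) * T) →
      ∫⁻ z : Rn n × Rn n, ENNReal.ofReal (energyErr s p m x₀ r U z.1 z.2) ≤
        ENNReal.ofReal (C * r ^ (-(s * p)) * (1 + T)) *
          ∫⁻ x in ball x₀ r, ENNReal.ofReal (growG m (U x)) := by
  have hsp : 0 < s * p := by nlinarith
  obtain ⟨C₁, hC₁, h₁⟩ := lintegral_cutoff_near hn hs1 hp
  obtain ⟨C₂, hC₂, h₂⟩ := lintegral_compl_ball_norm_rpow hn hsp
  set L : ℝ := 2 ^ ((n : ℝ) + s * p) with hL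
  have hL0 : 0 < L := by positivity
  refine ⟨C₁ + L * C₂ + L, by positivity, fun m U hU x₀ r T hr hT htail => ?_⟩
  have hB : MeasurableSet (ball x₀ r) := measurableSet_ball
  have hin : ∀ x, ∫⁻ y, ENNReal.ofReal (energyErr s p m x₀ r U x y) ≤
      (ball x₀ r).indicator (fun x => ENNReal.ofReal ((C₁ + L * C₂ + L) * r ^ (-(s * p)) * (1 + T))
        * ENNReal.ofReal (growG m (U x))) x := by
    intro x
    by_cases hx : x ∈ ball x₀ r
    swap
    · simp [energyErr, hx]
    rw [indicator_of_mem hx]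
    simp only [energyErr, indicator_of_mem hx, ENNReal.ofReal_mul (growG_nonneg m (U x))]
    rw [lintegral_const_mul' _ _ ENNReal.ofReal_ne_top, mul_comm]
    gcongr
    rw [← lintegral_add_compl _ hB]
    have i1 : ∫⁻ y in ball x₀ r, ENNReal.ofReal ((ball x₀ r).indicator (fun y =>
        |cutoff x₀ r x - cutoff x₀ r y| ^ p / ‖x - y‖ ^ ((n : ℝ) + s * p)) y +
        (ball x₀ r)ᶜ.indicator (fun y => (1 + max (U y) 0 ^ (p - 1)) * L /
        ‖y - x₀‖ ^ ((n : ℝ) + s * p)) y) ≤ ENNReal.ofReal (C₁ * r ^ (-(s * p))) := by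
      calc _ = ∫⁻ y in ball x₀ r, ENNReal.ofReal
            (|cutoff x₀ r x - cutoff x₀ r y| ^ p / ‖x - y‖ ^ ((n : ℝ) + s * p)) := by
            refine setLIntegral_congr_fun hB fun y hy => ?_
            simp [hy]
        _ ≤ ∫⁻ y in ball x (2 * r), ENNReal.ofReal
            (|cutoff x₀ r x - cutoff x₀ r y| ^ p / ‖x - y‖ ^ ((n : ℝ) + s * p)) := by
            apply lintegral_mono_set
            apply ball_subset_ball'
            rw [mem_ball, dist_comm] at hx
            linarith
        _ ≤ _ := h₁ r hr x₀ x
    have i2 : ∫⁻ y in (ball x₀ r)ᶜ, ENNReal.ofReal ((ball x₀ r).indicator (fun y =>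
        |cutoff x₀ r x - cutoff x₀ r y| ^ p / ‖x - y‖ ^ ((n : ℝ) + s * p)) y +
        (ball x₀ r)ᶜ.indicator (fun y => (1 + max (U y) 0 ^ (p - 1)) * L /
        ‖y - x₀‖ ^ ((n : ℝ) + s * p)) y) ≤
        ENNReal.ofReal (L * (C₂ * r ^ (-(s * p)))) + ENNReal.ofReal (L * (r ^ (-(s * p)) * T)) := by
      calc _ = ∫⁻ y in (ball x₀ r)ᶜ, (ENNReal.ofReal L *
            ENNReal.ofReal (‖x₀ - y‖ ^ (-((n : ℝ) + s * p))) + ENNReal.ofReal L *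
            ENNReal.ofReal (max (U y) 0 ^ (p - 1) / ‖y - x₀‖ ^ ((n : ℝ) + s * p))) := by
            refine setLIntegral_congr_fun hB.compl fun y hy => ?_
            beta_reduce
            rw [indicator_of_mem hy, indicator_of_notMem (by exact hy),
              ← ENNReal.ofReal_mul (by positivity), ← ENNReal.ofReal_mul (by positivity),
              ← ENNReal.ofReal_add (by positivity) (by positivity),
              Real.rpow_neg (norm_nonneg _), norm_sub_rev x₀ y]
            congr 1
            ring
        _ ≤ _ := by
            rw [lintegral_add_left (by
              have : Measurable fun y : Rn n => ‖x₀ - y‖ ^ (-((n : ℝ) + s * p)) := by fun_prop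
              exact this.ennreal_ofReal.const_mul _),
              lintegral_const_mul' _ _ ENNReal.ofReal_ne_top,
              lintegral_const_mul' _ _ ENNReal.ofReal_ne_top, ENNReal.ofReal_mul hL0.le,
              ENNReal.ofReal_mul hL0.le]
            gcongr
            exact h₂ r hr x₀
    refine (add_le_add i1 i2).trans ?_
    have hr0 : 0 < r ^ (-(s * p)) := Real.rpow_pos_of_pos hr _
    rw [← ENNReal.ofReal_add (by positivity) (by positivity),
      ← ENNReal.ofReal_add (by positivity) (by positivity)]
    apply ENNReal.ofReal_le_ofReal
    have : 0 ≤ C₁ * r ^ (-(s * p)) * T + L * C₂ * r ^ (-(s * p)) * T + L * r ^ (-(s * p)) := by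
      positivity
    nlinarith
  rw [Measure.volume_eq_prod, lintegral_prod _ (measurable_energyErr hU).ennreal_ofReal.aemeasurable]
  calc _ ≤ _ := lintegral_mono hin
    _ = _ := by
      rw [lintegral_indicator hB, lintegral_const_mul' _ _ ENNReal.ofReal_ne_top]

lemma powW_rpow_div_le_growG {θ m : ℝ} (hθ : 0 < θ) (hm : 0 < m) (t : ℝ) :
    powW θ t ^ (m / θ) ≤ growG m t := by
  rcases le_or_gt t 0 with ht | ht
  · rw [powW_of_nonpos θ ht, Real.zero_rpow (by positivity)]
    exact growG_nonneg m t
  · unfold growG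
    rw [if_pos ht]
    have h1 : powW θ t ≤ (1 + t) ^ θ := by
      unfold powW; rw [max_eq_left ht.le]; linarith
    calc _ ≤ ((1 + t) ^ θ) ^ (m / θ) :=
          Real.rpow_le_rpow (powW_nonneg hθ.le t) h1 (by positivity)
      _ = _ := by
          rw [← Real.rpow_mul (by linarith)]
          congr 1; field_simp

/-- Energy estimate for the truncations of a weak solution at level zero, combined with the
Nash inequality. -/
lemma energy_estimate {n : ℕ} (hn : 2 ≤ n) {Λ s p τ m : ℝ} (hs : 0 < s) (hs1 : s < 1)
    (hΛ : 1 ≤ Λ) (hp : 1 < p) (hτ : 0 < τ) (hτp : τ < p - 1) (hm : (1 + τ) * (p - 1) ≤ m) :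
    ∃ C : ℝ, 0 < C ∧ ∀ (Φ : ℝ → ℝ) (K : Rn n → Rn n → ℝ) (Ω : Set (Rn n)) (U f : Rn n → ℝ)
      (x₀ : Rn n) (r G F T X : ℝ), PhiBounds Λ p Φ → KernelBounds n Λ s p K → IsOpen Ω →
      Measurable U → gagliardo n s p univ U < ⊤ → Continuous f → HasCompactSupport f →
      (∀ ψ : Rn n → ℝ, IsTestFun n Ω ψ → nonlocalForm n Φ K U ψ = ∫ x, ψ x * f x) →
      0 < r → closedBall x₀ r ⊆ Ω → 0 ≤ G → 0 ≤ F → 0 ≤ T → 0 < X → (1 + T) * G + F ≤ X →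
      ∫⁻ x in ball x₀ r, ENNReal.ofReal (growG m (U x)) ≤ ENNReal.ofReal (r ^ (n : ℝ) * G) →
      ∫⁻ y in (ball x₀ r)ᶜ,
        ENNReal.ofReal (max (U y) 0 ^ (p - 1) / ‖y - x₀‖ ^ ((n : ℝ) + s * p)) ≤
          ENNReal.ofReal (r ^ (-(s * p)) * T) →
      ∫⁻ x in ball x₀ r, ENNReal.ofReal |f x| ≤ ENNReal.ofReal (r ^ ((n : ℝ) - s * p) * F) →
      ∫⁻ x in ball x₀ (r / 4), ENNReal.ofReal (powW ((p - 1 - τ) / p) (U x) ^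
          (p + m / ((p - 1 - τ) / p) * (s * p / n))) ≤
        ENNReal.ofReal (C * (r ^ (n : ℝ) * X ^ (1 + s * p / n))) := by
  have hp0 : 0 < p := by linarith
  have hΛ0 : 0 < Λ := by linarith
  have hn0 : (0 : ℝ) < n := by positivity
  set θ := (p - 1 - τ) / p with hθ
  have hθ0 : 0 < θ := div_pos (by linarith) hp0
  have hm0 : 0 < m := lt_of_lt_of_le (mul_pos (by linarith) (by linarith)) hm
  obtain ⟨c, C₀, hc, hC₀, hpt⟩ := exists_energy_pointwise hΛ hp hτ hτp hm
  obtain ⟨C₁, hC₁, herr⟩ := lintegral_energyErr_le hn hs hs1 hp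
  obtain ⟨C₂, hC₂, hnash⟩ := nash_inequality hn hs hp0 (a := m / θ) (by positivity)
  set C₃ := Λ / c * (1 + 2 * (Λ * C₀ * C₁)) with hC₃
  have hC₃0 : 0 < C₃ := by positivity
  refine ⟨C₂ * C₃, by positivity, ?_⟩
  intro Φ K Ω U f x₀ r G F T X hΦ hK hΩ hU hUg hf hfc heq hr hball hG hF hT hX hGFX hGint htail hfint
  set φ : Rn n → ℝ := fun x => truncH τ (U x) * cutoff x₀ r x ^ p with hφ
  set w : Rn n → ℝ := fun x => powW θ (U x) * cutoff x₀ r x with hw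
  have hφm : Measurable φ := ((measurable_truncH τ).comp hU).mul (measurable_cutoff.pow_const p)
  have hwm : Measurable w := ((measurable_powW θ).comp hU).mul measurable_cutoff
  have hw0 : ∀ x, 0 ≤ w x := fun x => mul_nonneg (powW_nonneg hθ0.le _) (cutoff_nonneg x)
  have hφg : gagliardo n s p univ φ < ⊤ := gagliardo_test_lt_top hn hs hs1 hp hτ hr hU hUg x₀
  have hφ0 : ∀ x, 0 ≤ φ x := fun x =>
    mul_nonneg (truncH_nonneg hτ.le _) (Real.rpow_nonneg (cutoff_nonneg x) p)
  have hφ1 : ∀ x, φ x ≤ 1 := fun x =>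
    mul_le_one₀ (truncH_le_one τ _) (Real.rpow_nonneg (cutoff_nonneg x) p)
      (Real.rpow_le_one (cutoff_nonneg x) (cutoff_le_one x) hp0.le)
  have hφs : ∀ x, r / 2 ≤ ‖x - x₀‖ → φ x = 0 := fun x hx => by
    simp only [hφ]
    rw [cutoff_eq_zero hr hx, Real.zero_rpow hp0.ne', mul_zero]
  have hid := integral_formInt_eq hp hΛ hΦ hK hU hφm hUg hφg hf hfc hΩ
    (isCompact_closedBall x₀ r) hball (M := 1)
    (fun x => by rw [abs_of_nonneg (hφ0 x)]; exact hφ1 x)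
    (fun x hx => hφs x (by
      rw [mem_closedBall, not_le, dist_eq_norm] at hx; linarith)) heq
  have hFint := integrable_formInt hp hΛ hΦ hK hU hφm hUg hφg
  have hsrc : ENNReal.ofReal (∫ z, formInt Φ K U φ z) ≤ ENNReal.ofReal (r ^ ((n : ℝ) - s * p) * F) := by
    rw [hid]
    calc _ ≤ ∫⁻ x, ‖φ x * f x‖ₑ := by
          refine le_trans ?_ (enorm_integral_le_lintegral_enorm _)
          rw [Real.enorm_eq_ofReal_abs]
          exact ENNReal.ofReal_le_ofReal (le_abs_self _)
      _ ≤ ∫⁻ x, (ball x₀ r).indicator (fun x => ENNReal.ofReal |f x|) x := by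
          apply lintegral_mono
          intro x
          beta_reduce
          by_cases hx : x ∈ ball x₀ r
          · rw [indicator_of_mem hx, Real.enorm_eq_ofReal_abs]
            apply ENNReal.ofReal_le_ofReal
            rw [abs_mul, abs_of_nonneg (hφ0 x)]
            exact mul_le_of_le_one_left (abs_nonneg _) (hφ1 x)
          · rw [mem_ball, not_lt, dist_eq_norm] at hx
            rw [hφs x (by linarith)]
            simp
      _ = ∫⁻ x in ball x₀ r, ENNReal.ofReal |f x| := lintegral_indicator measurableSet_ball _
      _ ≤ _ := hfint
  have herrI : ∫⁻ z : Rn n × Rn n, ENNReal.ofReal (energyErr s p m x₀ r U z.1 z.2) ≤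
      ENNReal.ofReal (C₁ * r ^ (-(s * p)) * (1 + T) * (r ^ (n : ℝ) * G)) := by
    refine (herr m U hU x₀ r T hr hT htail).trans ?_
    rw [ENNReal.ofReal_mul (p := C₁ * r ^ (-(s * p)) * (1 + T)) (by positivity)]
    gcongr
  have herrI' : ∫⁻ z : Rn n × Rn n, ENNReal.ofReal (energyErr s p m x₀ r U z.2 z.1) ≤
      ENNReal.ofReal (C₁ * r ^ (-(s * p)) * (1 + T) * (r ^ (n : ℝ) * G)) := by
    refine le_trans (le_of_eq ?_) herrI
    have := (Measure.measurePreserving_swap (μ := (volume : Measure (Rn n)))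
      (ν := (volume : Measure (Rn n)))).lintegral_comp
      (measurable_energyErr (s := s) (p := p) (m := m) (x₀ := x₀) (r := r) hU).ennreal_ofReal
    rw [Measure.volume_eq_prod, ← this]
    rfl
  have hrsp : r ^ (-(s * p)) * r ^ (n : ℝ) = r ^ ((n : ℝ) - s * p) := by
    rw [← Real.rpow_add hr]; congr 1; ring
  have hgag : gagliardo n s p univ w ≤ ENNReal.ofReal (C₃ * (r ^ ((n : ℝ) - s * p) * X)) := by
    have h1 := lintegral_ofReal_le_of_le_add (ν := (volume : Measure (Rn n × Rn n))) hFint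
      (h := fun z => Λ * C₀ * (energyErr s p m x₀ r U z.1 z.2 + energyErr s p m x₀ r U z.2 z.1))
      (g := fun z => c / Λ * (|w z.1 - w z.2| ^ p / ‖z.1 - z.2‖ ^ ((n : ℝ) + s * p)))
      (((measurable_energyErr hU).add ((measurable_energyErr hU).comp measurable_swap)).const_mul _)
      (fun z => mul_nonneg (by positivity)
        (add_nonneg (energyErr_nonneg s p m x₀ r U _ _) (energyErr_nonneg s p m x₀ r U _ _)))
      (fun z => by positivity)
      (fun z => energy_integrand_le hs hΛ hp hc hC₀ hK (hpt Φ hΦ) hr U z.1 z.2)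
    have h2 : ∫⁻ z : Rn n × Rn n, ENNReal.ofReal (Λ * C₀ *
        (energyErr s p m x₀ r U z.1 z.2 + energyErr s p m x₀ r U z.2 z.1)) ≤
        ENNReal.ofReal (Λ * C₀ * (2 * (C₁ * r ^ (-(s * p)) * (1 + T) * (r ^ (n : ℝ) * G)))) := by
      simp only [ENNReal.ofReal_mul (p := Λ * C₀) (by positivity : 0 ≤ Λ * C₀)]
      rw [lintegral_const_mul' _ _ ENNReal.ofReal_ne_top]
      gcongr
      simp only [ENNReal.ofReal_add (energyErr_nonneg s p m x₀ r U _ _)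
        (energyErr_nonneg s p m x₀ r U _ _)]
      rw [lintegral_add_left (measurable_energyErr hU).ennreal_ofReal, two_mul,
        ENNReal.ofReal_add (by positivity) (by positivity)]
      exact add_le_add herrI herrI'
    simp only [ENNReal.ofReal_mul (p := c / Λ) (by positivity : 0 ≤ c / Λ)] at h1
    rw [lintegral_const_mul' _ _ ENNReal.ofReal_ne_top, ← gagliardo_univ_eq hwm] at h1
    have h3 := h1.trans (add_le_add hsrc h2)
    rw [← ENNReal.ofReal_add (by positivity) (by positivity)] at h3
    have h4 : r ^ ((n : ℝ) - s * p) * F +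
        Λ * C₀ * (2 * (C₁ * r ^ (-(s * p)) * (1 + T) * (r ^ (n : ℝ) * G))) ≤
        c / Λ * (C₃ * (r ^ ((n : ℝ) - s * p) * X)) := by
      have e1 : c / Λ * (C₃ * (r ^ ((n : ℝ) - s * p) * X)) =
          r ^ ((n : ℝ) - s * p) * X + 2 * (Λ * C₀ * C₁) * (r ^ ((n : ℝ) - s * p) * X) := by
        simp only [hC₃]; field_simp
      have e2 : Λ * C₀ * (2 * (C₁ * r ^ (-(s * p)) * (1 + T) * (r ^ (n : ℝ) * G))) =
          2 * (Λ * C₀ * C₁) * (r ^ ((n : ℝ) - s * p) * ((1 + T) * G)) := by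
        rw [← hrsp]; ring
      rw [e1, e2]
      have h5 : (1 + T) * G ≤ X := by linarith
      have h6 : F ≤ X := by
        have : 0 ≤ (1 + T) * G := by positivity
        linarith
      gcongr
    have h7 := h3.trans (ENNReal.ofReal_le_ofReal h4)
    rw [ENNReal.ofReal_mul (p := c / Λ) (by positivity)] at h7
    exact (ENNReal.mul_le_mul_iff_right (by
      rw [ne_eq, ENNReal.ofReal_eq_zero, not_le]; positivity) ENNReal.ofReal_ne_top).1 h7
  have hwa : ∫⁻ x, ENNReal.ofReal (w x ^ (m / θ)) ≤ ENNReal.ofReal (r ^ (n : ℝ) * X) := by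
    calc _ ≤ ∫⁻ x, (ball x₀ r).indicator (fun x => ENNReal.ofReal (growG m (U x))) x := by
          apply lintegral_mono
          intro x
          beta_reduce
          by_cases hx : x ∈ ball x₀ r
          · rw [indicator_of_mem hx]
            apply ENNReal.ofReal_le_ofReal
            refine le_trans ?_ (powW_rpow_div_le_growG hθ0 hm0 (U x))
            refine Real.rpow_le_rpow (hw0 x) ?_ (by positivity)
            exact mul_le_of_le_one_right (powW_nonneg hθ0.le _) (cutoff_le_one x)
          · rw [mem_ball, not_lt, dist_eq_norm] at hx
            simp only [hw]
            rw [cutoff_eq_zero hr (by linarith), mul_zero, Real.zero_rpow (by positivity)]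
            simp
      _ = _ := lintegral_indicator measurableSet_ball _
      _ ≤ _ := hGint
      _ ≤ _ := by
          apply ENNReal.ofReal_le_ofReal
          gcongr
          nlinarith [mul_nonneg hT hG]
  have hfin := hnash w hwm hw0 (r ^ (n : ℝ) * X) (by positivity) hwa
  calc _ = ∫⁻ x in ball x₀ (r / 4), ENNReal.ofReal (w x ^ (p + m / θ * (s * p / n))) := by
        refine setLIntegral_congr_fun measurableSet_ball fun x hx => ?_
        rw [mem_ball, dist_eq_norm] at hx
        simp only [hw]
        rw [cutoff_eq_one hr hx.le, mul_one]
    _ ≤ ∫⁻ x, ENNReal.ofReal (w x ^ (p + m / θ * (s * p / n))) := setLIntegral_le_lintegral _ _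
    _ ≤ ENNReal.ofReal (C₂ * (r ^ (n : ℝ) * X) ^ (s * p / n)) *
        ENNReal.ofReal (C₃ * (r ^ ((n : ℝ) - s * p) * X)) := hfin.trans (by gcongr)
    _ = _ := by
        rw [← ENNReal.ofReal_mul (by positivity)]
        congr 1
        rw [Real.mul_rpow (by positivity) hX.le, ← Real.rpow_mul hr.le, Real.rpow_add hX,
          Real.rpow_one]
        have e1 : (n : ℝ) * (s * p / n) = s * p := by field_simp
        have e2 : r ^ (n : ℝ) = r ^ (s * p) * r ^ ((n : ℝ) - s * p) := by
          rw [← Real.rpow_add hr]; congr 1; ring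
        rw [e1, e2]
        ring

/-- `u` is the limit of weak solutions whose data are asymptotically dominated by `ν`. -/
structure ApproxSol (n : ℕ) (Λ s p m : ℝ) (Ω : Set (Rn n)) (ν : Measure (Rn n)) (u : Rn n → ℝ)
    (Φ : ℝ → ℝ) (K : Rn n → Rn n → ℝ) (uj fj : ℕ → Rn n → ℝ) : Prop where
  phi : PhiBounds Λ p Φ
  kernel : KernelBounds n Λ s p K
  isOpen : IsOpen Ω
  measurable_limit : Measurable u
  measurable : ∀ j, Measurable (uj j)
  gagliardo_lt_top : ∀ j, gagliardo n s p univ (uj j) < ⊤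
  continuous : ∀ j, Continuous (fj j)
  hasCompactSupport : ∀ j, HasCompactSupport (fj j)
  weak : ∀ j, ∀ ψ : Rn n → ℝ, IsTestFun n Ω ψ → nonlocalForm n Φ K (uj j) ψ = ∫ x, ψ x * fj j x
  ae_tendsto : ∀ᵐ x : Rn n, Tendsto (fun j => uj j x) atTop (𝓝 (u x))
  tendsto_ball : ∀ z : Rn n, ∀ r : ℝ, 0 < r →
    Tendsto (fun j => ∫⁻ x in ball z r, ENNReal.ofReal (|uj j x - u x| ^ m)) atTop (𝓝 0)
  tendsto_tail : ∀ z : Rn n, ∀ r : ℝ, 0 < r →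
    Tendsto (fun j => ∫⁻ x in (ball z r)ᶜ, ENNReal.ofReal (|uj j x - u x| ^ (p - 1) /
      ‖x - z‖ ^ ((n : ℝ) + s * p))) atTop (𝓝 0)
  limsup_le : ∀ z : Rn n, ∀ r : ℝ, 0 < r →
    Filter.limsup (fun j => ∫⁻ x in ball z r, ENNReal.ofReal |fj j x|) atTop ≤
      ν (closedBall z r)

lemma gagliardo_comp_affine {n : ℕ} {s p l δ : ℝ} (hδ : 0 < δ) {v : Rn n → ℝ}
    (hv : gagliardo n s p univ v < ⊤) :
    gagliardo n s p univ (fun x => (v x - l) / δ) < ⊤ := by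
  have e : gagliardo n s p univ (fun x => (v x - l) / δ) =
      ENNReal.ofReal (δ ^ (-p)) * gagliardo n s p univ v := by
    unfold gagliardo
    simp only [Measure.restrict_univ]
    rw [← lintegral_const_mul' _ _ ENNReal.ofReal_ne_top]
    congr 1; funext x
    rw [← lintegral_const_mul' _ _ ENNReal.ofReal_ne_top]
    congr 1; funext y
    rw [← ENNReal.ofReal_mul (by positivity)]
    congr 1
    have : (v x - l) / δ - (v y - l) / δ = (v x - v y) / δ := by ring
    rw [this, abs_div, abs_of_pos hδ, Real.div_rpow (abs_nonneg _) hδ.le, Real.rpow_neg hδ.le]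
    ring
  rw [e]
  exact ENNReal.mul_lt_top ENNReal.ofReal_lt_top hv

lemma growG_div_le {m d δ t t' : ℝ} (hm : 0 ≤ m) (hd : 0 < d) (hdδ : d ≤ 2 * δ) :
    growG m (t / δ) ≤ 4 ^ m * ((max (t' + d) 0 / d) ^ m + d ^ (-m) * |t - t'| ^ m) := by
  have hδ : 0 < δ := by linarith
  have h0 : 0 ≤ 4 ^ m * ((max (t' + d) 0 / d) ^ m + d ^ (-m) * |t - t'| ^ m) := by positivity
  unfold growG
  split_ifs with ht
  swap
  · exact h0
  have ht0 : 0 < t := by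
    by_contra h
    exact absurd ht (not_lt.2 (div_nonpos_of_nonpos_of_nonneg (not_lt.1 h) hδ.le))
  have h1 : 1 + t / δ ≤ 2 * (max (t' + d) 0 / d + |t - t'| / d) := by
    have a1 : t / δ ≤ 2 * t / d := by
      rw [div_le_div_iff₀ hδ hd]; nlinarith
    have a2 : t + d ≤ max (t' + d) 0 + |t - t'| := by
      have := le_max_left (t' + d) 0
      have := le_abs_self (t - t')
      linarith
    have a3 : (t + d) / d ≤ (max (t' + d) 0 + |t - t'|) / d := by gcongr
    rw [add_div, div_self hd.ne', add_div] at a3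
    have : 2 * t / d = 2 * (t / d) := by ring
    linarith
  calc (1 + t / δ) ^ m ≤ (2 * (max (t' + d) 0 / d + |t - t'| / d)) ^ m := by gcongr
    _ = 2 ^ m * (max (t' + d) 0 / d + |t - t'| / d) ^ m :=
        Real.mul_rpow (by norm_num) (by positivity)
    _ ≤ 2 ^ m * (2 ^ m * ((max (t' + d) 0 / d) ^ m + (|t - t'| / d) ^ m)) := by
        gcongr
        exact add_rpow_le_two_rpow_mul hm (by positivity) (by positivity)
    _ = _ := by
        have : (4 : ℝ) ^ m = 2 ^ m * 2 ^ m := by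
          rw [← Real.mul_rpow (by norm_num) (by norm_num)]; norm_num
        rw [this, Real.div_rpow (abs_nonneg _) hd.le, Real.rpow_neg hd.le]
        ring

lemma max_div_rpow_le {e δ t t' : ℝ} (he : 0 ≤ e) (hδ : 0 < δ) :
    max (t / δ) 0 ^ e ≤ 2 ^ e * δ ^ (-e) * (max t' 0 ^ e + |t - t'| ^ e) := by
  have h1 : max (t / δ) 0 ≤ (max t' 0 + |t - t'|) / δ := by
    apply max_le
    · gcongr
      have := le_max_left t' 0
      have := le_abs_self (t - t')
      linarith
    · positivity
  calc _ ≤ ((max t' 0 + |t - t'|) / δ) ^ e := by gcongr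
    _ = δ ^ (-e) * (max t' 0 + |t - t'|) ^ e := by
        rw [Real.div_rpow (by positivity) hδ.le, Real.rpow_neg hδ.le]; ring
    _ ≤ δ ^ (-e) * (2 ^ e * (max t' 0 ^ e + |t - t'| ^ e)) := by
        gcongr
        exact add_rpow_le_two_rpow_mul he (by positivity) (by positivity)
    _ = _ := by ring

lemma eventually_le_ofReal {g : ℕ → ℝ≥0∞} (hg : Tendsto g atTop (𝓝 0)) {η : ℝ} (hη : 0 < η) :
    ∀ᶠ j in atTop, g j ≤ ENNReal.ofReal η :=
  (hg.eventually (gt_mem_nhds (ENNReal.ofReal_pos.2 hη))).mono fun _ h => h.le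

lemma exists_pos_perturb {G F T X A B : ℝ} (hG : 0 ≤ G) (hF : 0 ≤ F) (hX : 0 < X)
    (hA : 1 ≤ A) (hB : 1 ≤ B) (h : (1 + T) * G + F ≤ X) :
    ∃ ε : ℝ, 0 < ε ∧ (1 + B * (T + ε)) * (A * (G + ε)) + (F + ε) ≤ 2 * A * B * X := by
  have hcont : Continuous fun ε : ℝ => (1 + B * (T + ε)) * (A * (G + ε)) + (F + ε) := by fun_prop
  have h0 : (1 + B * (T + 0)) * (A * (G + 0)) + (F + 0) < 2 * A * B * X := by
    have hAB : 1 ≤ A * B := one_le_mul_of_one_le_of_one_le hA hB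
    have h1 : (1 + B * T) * (A * G) ≤ (A * B) * ((1 + T) * G) := by
      have : 0 ≤ A * G * (B - 1) := mul_nonneg (by positivity) (by linarith)
      nlinarith
    have h2 : F ≤ (A * B) * F := by nlinarith
    have h3 : (A * B) * ((1 + T) * G + F) ≤ (A * B) * X := by gcongr
    have h4 : 0 < A * B * X := by positivity
    simp only [add_zero]
    nlinarith
  have hev := hcont.continuousAt.eventually (gt_mem_nhds h0)
  obtain ⟨ε, h1, h2⟩ := ((hev.filter_mono nhdsWithin_le_nhds).and
    (self_mem_nhdsWithin (a := (0 : ℝ)) (s := Ioi 0))).exists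
  exact ⟨ε, h2, h1.le⟩

/-- The energy estimate passes to the limit. -/
lemma ApproxSol.level_estimate {n : ℕ} (hn : 2 ≤ n) {Λ s p τ m : ℝ} (hs : 0 < s) (hs1 : s < 1)
    (hΛ : 1 ≤ Λ) (hp : 1 < p) (hτ : 0 < τ) (hτp : τ < p - 1) (hm : (1 + τ) * (p - 1) ≤ m) :
    ∃ C : ℝ, 0 < C ∧ ∀ (Ω : Set (Rn n)) (ν : Measure (Rn n)) (u : Rn n → ℝ)
      (Φ : ℝ → ℝ) (K : Rn n → Rn n → ℝ) (uj fj : ℕ → Rn n → ℝ),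
      ApproxSol n Λ s p m Ω ν u Φ K uj fj → ∀ (x₀ : Rn n) (r l d δ G F T X : ℝ),
      0 < r → closedBall x₀ r ⊆ Ω → 0 < d → d ≤ 2 * δ →
      0 ≤ G → 0 ≤ F → 0 ≤ T → 0 < X → (1 + T) * G + F ≤ X →
      ∫⁻ x in ball x₀ r, ENNReal.ofReal ((max (u x - l + d) 0 / d) ^ m) ≤
        ENNReal.ofReal (r ^ (n : ℝ) * G) →
      ∫⁻ y in (ball x₀ r)ᶜ,
        ENNReal.ofReal (max (u y - l) 0 ^ (p - 1) / ‖y - x₀‖ ^ ((n : ℝ) + s * p)) ≤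
          ENNReal.ofReal (r ^ (-(s * p)) * (δ ^ (p - 1) * T)) →
      ν (closedBall x₀ r) ≤ ENNReal.ofReal (r ^ ((n : ℝ) - s * p) * (δ ^ (p - 1) * F)) →
      ∫⁻ x in ball x₀ (r / 4), ENNReal.ofReal (powW ((p - 1 - τ) / p) ((u x - l) / δ) ^
          (p + m / ((p - 1 - τ) / p) * (s * p / n))) ≤
        ENNReal.ofReal (C * (r ^ (n : ℝ) * X ^ (1 + s * p / n))) := by
  obtain ⟨C, hC, henergy⟩ := energy_estimate hn hs hs1 hΛ hp hτ hτp hm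
  have hp1 : 0 < p - 1 := by linarith
  have hm0 : 0 < m := lt_of_lt_of_le (mul_pos (by linarith) hp1) hm
  have hn0 : (0 : ℝ) < n := by positivity
  set B : ℝ := 2 ^ (p - 1) with hB
  set A : ℝ := 4 ^ m with hA
  have hB1 : 1 ≤ B := Real.one_le_rpow (by norm_num) hp1.le
  have hA1 : 1 ≤ A := Real.one_le_rpow (by norm_num) hm0.le
  refine ⟨C * (2 * A * B) ^ (1 + s * p / n), by positivity, ?_⟩
  intro Ω ν u Φ K uj fj S x₀ r l d δ G F T X hr hball hd hdδ hG hF hT hX hGFX hGint htail hν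
  have hδ : 0 < δ := by linarith
  obtain ⟨ε, hε, hεX⟩ := exists_pos_perturb hG hF hX hA1 hB1 hGFX
  have hrn : 0 < r ^ (n : ℝ) := Real.rpow_pos_of_pos hr _
  have hrsp : 0 < r ^ (-(s * p)) := Real.rpow_pos_of_pos hr _
  have hrnsp : 0 < r ^ ((n : ℝ) - s * p) := Real.rpow_pos_of_pos hr _
  have hdm : 0 < d ^ m := Real.rpow_pos_of_pos hd _
  have hδp : 0 < δ ^ (p - 1) := Real.rpow_pos_of_pos hδ _
  have ev1 := eventually_le_ofReal (S.tendsto_ball x₀ r hr)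
    (η := d ^ m * (r ^ (n : ℝ) * ε)) (by positivity)
  have ev2 := eventually_le_ofReal (S.tendsto_tail x₀ r hr)
    (η := δ ^ (p - 1) * (r ^ (-(s * p)) * ε)) (by positivity)
  have ev3 : ∀ᶠ j in atTop, ∫⁻ x in ball x₀ r, ENNReal.ofReal |fj j x| <
      ENNReal.ofReal (r ^ ((n : ℝ) - s * p) * (δ ^ (p - 1) * (F + ε))) := by
    apply Filter.eventually_lt_of_limsup_lt (hu := isBounded_le_of_top)
    refine ((S.limsup_le x₀ r hr).trans hν).trans_lt ?_
    rw [ENNReal.ofReal_lt_ofReal_iff (by positivity)]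
    gcongr
    linarith
  have hbound : ∀ᶠ j in atTop, ∫⁻ x in ball x₀ (r / 4),
      ENNReal.ofReal (powW ((p - 1 - τ) / p) ((uj j x - l) / δ) ^
        (p + m / ((p - 1 - τ) / p) * (s * p / n))) ≤
      ENNReal.ofReal (C * (r ^ (n : ℝ) * (2 * A * B * X) ^ (1 + s * p / n))) := by
    filter_upwards [ev1, ev2, ev3] with j h1 h2 h3
    have hujm := S.measurable j
    refine henergy (fun t => δ ^ (1 - p) * Φ (δ * t)) K Ω (fun x => (uj j x - l) / δ)
      (fun x => δ ^ (1 - p) * fj j x) x₀ r (A * (G + ε)) (F + ε) (B * (T + ε)) (2 * A * B * X)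
      (S.phi.scale hδ) S.kernel S.isOpen ((hujm.sub_const l).div_const δ)
      (gagliardo_comp_affine hδ (S.gagliardo_lt_top j)) ((S.continuous j).const_smul (δ ^ (1 - p)))
      ((S.hasCompactSupport j).mul_left) ?_ hr hball (by positivity) (by positivity)
      (by positivity) (by positivity) hεX ?_ ?_ ?_
    · intro ψ hψ
      have e1 : nonlocalForm n (fun t => δ ^ (1 - p) * Φ (δ * t)) K
          (fun x => (uj j x - l) / δ) ψ = δ ^ (1 - p) * nonlocalForm n Φ K (uj j) ψ := by
        unfold nonlocalForm
        rw [← integral_const_mul]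
        congr 1; funext x
        rw [← integral_const_mul]
        congr 1; funext y
        have : δ * ((uj j x - l) / δ - (uj j y - l) / δ) = uj j x - uj j y := by
          field_simp; ring
        beta_reduce
        rw [this]; ring
      rw [e1, S.weak j ψ hψ, ← integral_const_mul]
      congr 1; funext x; ring
    · calc _ ≤ ∫⁻ x in ball x₀ r, (ENNReal.ofReal A *
            ENNReal.ofReal ((max (u x - l + d) 0 / d) ^ m) + ENNReal.ofReal (A * d ^ (-m)) *
            ENNReal.ofReal (|uj j x - u x| ^ m)) := by
            apply lintegral_mono
            intro x
            beta_reduce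
            rw [← ENNReal.ofReal_mul (by positivity), ← ENNReal.ofReal_mul (by positivity),
              ← ENNReal.ofReal_add (by positivity) (by positivity)]
            apply ENNReal.ofReal_le_ofReal
            refine (growG_div_le (t' := u x - l) hm0.le hd hdδ).trans (le_of_eq ?_)
            rw [sub_sub_sub_cancel_right]
            ring
        _ ≤ ENNReal.ofReal A * ENNReal.ofReal (r ^ (n : ℝ) * G) + ENNReal.ofReal (A * d ^ (-m)) *
            ENNReal.ofReal (d ^ m * (r ^ (n : ℝ) * ε)) := by
            rw [lintegral_add_right, lintegral_const_mul' _ _ ENNReal.ofReal_ne_top,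
              lintegral_const_mul' _ _ ENNReal.ofReal_ne_top]
            · gcongr
            · have := ((hujm.sub S.measurable_limit).norm.pow_const m).ennreal_ofReal
              exact this.const_mul _
        _ = _ := by
            rw [← ENNReal.ofReal_mul (by positivity), ← ENNReal.ofReal_mul (by positivity),
              ← ENNReal.ofReal_add (by positivity) (by positivity)]
            congr 1
            rw [Real.rpow_neg hd.le]
            field_simp
    · calc _ ≤ ∫⁻ y in (ball x₀ r)ᶜ, (ENNReal.ofReal (B * δ ^ (-(p - 1))) *
            ENNReal.ofReal (max (u y - l) 0 ^ (p - 1) / ‖y - x₀‖ ^ ((n : ℝ) + s * p)) +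
            ENNReal.ofReal (B * δ ^ (-(p - 1))) *
            ENNReal.ofReal (|uj j y - u y| ^ (p - 1) / ‖y - x₀‖ ^ ((n : ℝ) + s * p))) := by
            apply lintegral_mono
            intro y
            beta_reduce
            rw [← ENNReal.ofReal_mul (by positivity), ← ENNReal.ofReal_mul (by positivity),
              ← ENNReal.ofReal_add (by positivity) (by positivity)]
            apply ENNReal.ofReal_le_ofReal
            rw [← mul_add, ← add_div, ← mul_div_assoc]
            gcongr
            refine (max_div_rpow_le (t' := u y - l) hp1.le hδ).trans (le_of_eq ?_)
            rw [sub_sub_sub_cancel_right]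
        _ ≤ ENNReal.ofReal (B * δ ^ (-(p - 1))) *
              ENNReal.ofReal (r ^ (-(s * p)) * (δ ^ (p - 1) * T)) +
            ENNReal.ofReal (B * δ ^ (-(p - 1))) *
              ENNReal.ofReal (δ ^ (p - 1) * (r ^ (-(s * p)) * ε)) := by
            rw [lintegral_add_right, lintegral_const_mul' _ _ ENNReal.ofReal_ne_top,
              lintegral_const_mul' _ _ ENNReal.ofReal_ne_top]
            · gcongr
            · have hu := S.measurable_limit
              have : Measurable fun y =>
                  |uj j y - u y| ^ (p - 1) / ‖y - x₀‖ ^ ((n : ℝ) + s * p) := by fun_prop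
              exact this.ennreal_ofReal.const_mul _
        _ = _ := by
            rw [← ENNReal.ofReal_mul (by positivity), ← ENNReal.ofReal_mul (by positivity),
              ← ENNReal.ofReal_add (by positivity) (by positivity)]
            congr 1
            rw [Real.rpow_neg hδ.le]
            field_simp
    · calc _ = ENNReal.ofReal (δ ^ (1 - p)) * ∫⁻ x in ball x₀ r, ENNReal.ofReal |fj j x| := by
            rw [← lintegral_const_mul' _ _ ENNReal.ofReal_ne_top]
            congr 1; funext x
            rw [← ENNReal.ofReal_mul (by positivity), abs_mul, abs_of_pos (by positivity)]
        _ ≤ ENNReal.ofReal (δ ^ (1 - p)) *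
            ENNReal.ofReal (r ^ ((n : ℝ) - s * p) * (δ ^ (p - 1) * (F + ε))) := by gcongr
        _ = _ := by
            rw [← ENNReal.ofReal_mul (by positivity)]
            congr 1
            have : δ ^ (1 - p) = (δ ^ (p - 1))⁻¹ := by
              rw [← Real.rpow_neg hδ.le]; congr 1; ring
            rw [this]
            field_simp
  have hθ0 : 0 < (p - 1 - τ) / p := div_pos (by linarith) (by linarith)
  set ζ := p + m / ((p - 1 - τ) / p) * (s * p / n) with hζ
  have hζ0 : 0 ≤ ζ := by positivity
  calc ∫⁻ x in ball x₀ (r / 4), ENNReal.ofReal (powW ((p - 1 - τ) / p) ((u x - l) / δ) ^ ζ)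
      = ∫⁻ x in ball x₀ (r / 4), liminf (fun j =>
          ENNReal.ofReal (powW ((p - 1 - τ) / p) ((uj j x - l) / δ) ^ ζ)) atTop := by
        apply lintegral_congr_ae
        filter_upwards [ae_restrict_of_ae S.ae_tendsto] with x hx
        refine (Tendsto.liminf_eq ?_).symm
        refine (ENNReal.continuous_ofReal.tendsto _).comp ?_
        refine Tendsto.rpow_const ?_ (Or.inr hζ0)
        have hc : Continuous (powW ((p - 1 - τ) / p)) := by
          unfold powW
          refine Continuous.sub (Continuous.rpow_const (by fun_prop) fun t => Or.inr hθ0.le)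
            continuous_const
        exact (hc.tendsto _).comp ((hx.sub_const l).div_const δ)
    _ ≤ liminf (fun j => ∫⁻ x in ball x₀ (r / 4),
          ENNReal.ofReal (powW ((p - 1 - τ) / p) ((uj j x - l) / δ) ^ ζ)) atTop := by
        apply lintegral_liminf_le
        intro j
        exact ((((measurable_powW _).comp
          (((S.measurable j).sub_const l).div_const δ)).pow_const ζ)).ennreal_ofReal
    _ ≤ _ := by
        refine (Filter.liminf_le_of_frequently_le' hbound.frequently).trans (le_of_eq ?_)
        congr 1
        rw [Real.mul_rpow (by positivity) hX.le]
        ring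

lemma rpow_le_powW_rpow {θ m ζ ε : ℝ} (hθ : 0 < θ) (hm : 0 < m) (hζ : m ≤ θ * ζ)
    (hε : 0 < ε) :
    ∃ C : ℝ, 0 < C ∧ ∀ t : ℝ, ε < t → t ^ m ≤ C * powW θ t ^ ζ := by
  set c := 1 - (1 + ε) ^ (-θ) with hc
  have hc0 : 0 < c := by
    have : (1 + ε) ^ (-θ) < 1 := Real.rpow_lt_one_of_one_lt_of_neg (by linarith) (by linarith)
    linarith
  have hζ0 : 0 < ζ := by
    by_contra h
    have : θ * ζ ≤ 0 := mul_nonpos_of_nonneg_of_nonpos hθ.le (not_lt.1 h)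
    linarith
  refine ⟨ε ^ (m - θ * ζ) * c ^ (-ζ), by positivity, fun t ht => ?_⟩
  have ht0 : 0 < t := hε.trans ht
  have h1 : c * t ^ θ ≤ powW θ t := by
    have e : powW θ t = (1 + t) ^ θ * (1 - (1 + t) ^ (-θ)) := by
      unfold powW
      rw [max_eq_left ht0.le, mul_sub, mul_one, ← Real.rpow_add (by linarith), add_neg_cancel,
        Real.rpow_zero]
    rw [e, mul_comm]
    have h2 : (1 + t) ^ (-θ) ≤ (1 + ε) ^ (-θ) :=
      Real.rpow_le_rpow_of_nonpos (by linarith) (by linarith) (by linarith)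
    have h3 : t ^ θ ≤ (1 + t) ^ θ := by gcongr; linarith
    have h4 : c ≤ 1 - (1 + t) ^ (-θ) := by linarith
    gcongr
  have h5 : c ^ ζ * t ^ (θ * ζ) ≤ powW θ t ^ ζ := by
    rw [Real.rpow_mul ht0.le, ← Real.mul_rpow hc0.le (by positivity)]
    gcongr
  have h6 : t ^ (m - θ * ζ) ≤ ε ^ (m - θ * ζ) :=
    Real.rpow_le_rpow_of_nonpos hε ht.le (by linarith)
  calc t ^ m = t ^ (m - θ * ζ) * t ^ (θ * ζ) := by rw [← Real.rpow_add ht0]; congr 1; ring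
    _ ≤ ε ^ (m - θ * ζ) * t ^ (θ * ζ) := by gcongr
    _ = ε ^ (m - θ * ζ) * c ^ (-ζ) * (c ^ ζ * t ^ (θ * ζ)) := by
        rw [Real.rpow_neg hc0.le]; field_simp
    _ ≤ _ := by gcongr

lemma rpow_le_of_level {θ m ζ ε C l d δ u : ℝ} (hθ : 0 < θ) (hm : 0 < m) (hε : 0 < ε) (hd : 0 < d)
    (hδ : 0 < δ) (hC : 0 < C) (h : ∀ t : ℝ, ε < t → t ^ m ≤ C * powW θ t ^ ζ) :
    max (u - (l + d)) 0 ^ m ≤ δ ^ m * (ε ^ m * (d ^ (-m) * max (u - l) 0 ^ m) +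
      C * powW θ ((u - (l + d)) / δ) ^ ζ) := by
  set t := (u - (l + d)) / δ with ht
  have hP : 0 ≤ powW θ t := powW_nonneg hθ.le t
  rcases le_or_gt t 0 with h0 | h0
  · have : u - (l + d) ≤ 0 := by
      by_contra h1
      exact absurd (div_pos (not_le.1 h1) hδ) (not_lt.2 h0)
    rw [max_eq_right this, Real.zero_rpow hm.ne']
    positivity
  have hu : u - (l + d) = δ * t := by simp only [ht]; field_simp
  have hpos : 0 < u - (l + d) := by rw [hu]; positivity
  rw [max_eq_left hpos.le, hu, Real.mul_rpow hδ.le h0.le]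
  gcongr
  rcases le_or_gt t ε with h1 | h1
  · have h2 : 1 ≤ d ^ (-m) * max (u - l) 0 ^ m := by
      have : d ≤ max (u - l) 0 := le_trans (by linarith) (le_max_left _ _)
      rw [Real.rpow_neg hd.le, inv_mul_eq_div, one_le_div (by positivity)]
      gcongr
    calc t ^ m ≤ ε ^ m := by gcongr
      _ ≤ ε ^ m * (d ^ (-m) * max (u - l) 0 ^ m) := le_mul_of_one_le_right (by positivity) h2
      _ ≤ _ := le_add_of_nonneg_right (by positivity)
  · exact (h t h1).trans (le_add_of_nonneg_left (by positivity))

set_option maxHeartbeats 1000000 in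
/-- One step of the level iteration. -/
lemma ApproxSol.level_step {n : ℕ} (hn : 2 ≤ n) {Λ s p τ m : ℝ} (hs : 0 < s) (hs1 : s < 1)
    (hΛ : 1 ≤ Λ) (hp : 1 < p) (hτ : 0 < τ) (hτp : τ < p - 1) (hm : (1 + τ) * (p - 1) ≤ m)
    (hmζ : m ≤ p - 1 - τ + m * (s * p / n)) :
    ∃ σ κ A : ℝ, 0 < σ ∧ σ ≤ 1 / 4 ∧ 0 < κ ∧ 0 < A ∧
      ∀ (Ω : Set (Rn n)) (ν : Measure (Rn n)) (u : Rn n → ℝ)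
      (Φ : ℝ → ℝ) (K : Rn n → Rn n → ℝ) (uj fj : ℕ → Rn n → ℝ),
      ApproxSol n Λ s p m Ω ν u Φ K uj fj → ∀ (x₀ : Rn n) (r l d δ : ℝ),
      0 < r → closedBall x₀ r ⊆ Ω → 0 < d → d ≤ 2 * δ →
      ∫⁻ x in ball x₀ r, ENNReal.ofReal (max (u x - l) 0 ^ m) ≤
        ENNReal.ofReal (κ * d ^ m * r ^ (n : ℝ)) →
      ∫⁻ y in (ball x₀ r)ᶜ,
        ENNReal.ofReal (max (u y - l) 0 ^ (p - 1) / ‖y - x₀‖ ^ ((n : ℝ) + s * p)) ≤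
          ENNReal.ofReal (A * d ^ (p - 1) * r ^ (-(s * p))) →
      ν (closedBall x₀ r) ≤ ENNReal.ofReal (κ * δ ^ (p - 1) * r ^ ((n : ℝ) - s * p)) →
      ∫⁻ x in ball x₀ (σ * r), ENNReal.ofReal (max (u x - (l + d)) 0 ^ m) ≤
        ENNReal.ofReal (κ * δ ^ m * (σ * r) ^ (n : ℝ)) ∧
      ∫⁻ y in (ball x₀ (σ * r))ᶜ,
        ENNReal.ofReal (max (u y - (l + d)) 0 ^ (p - 1) / ‖y - x₀‖ ^ ((n : ℝ) + s * p)) ≤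
          ENNReal.ofReal (A * δ ^ (p - 1) * (σ * r) ^ (-(s * p))) := by
  obtain ⟨C₀, hC₀, hlev⟩ := ApproxSol.level_estimate hn hs hs1 hΛ hp hτ hτp hm
  have hp0 : 0 < p := by linarith
  have hp1 : 0 < p - 1 := by linarith
  have hpm : p - 1 ≤ m := by nlinarith
  have hm0 : 0 < m := by linarith
  have hn0 : (0 : ℝ) < n := by positivity
  have hsp : 0 < s * p := by positivity
  set θ := (p - 1 - τ) / p with hθ
  have hθ0 : 0 < θ := div_pos (by linarith) hp0
  set ζ := p + m / θ * (s * p / n) with hζ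
  have hθζ : m ≤ θ * ζ := by
    have : θ * ζ = p - 1 - τ + m * (s * p / n) := by
      have e1 : θ * ζ = θ * p + m * (s * p / n) := by simp only [hζ]; field_simp
      rw [e1, hθ]; field_simp
    linarith
  set ω : ℝ := volume.real (ball (0 : Rn n) 1) with hω
  have hω0 : 0 ≤ ω := measureReal_nonneg
  set σ : ℝ := min (1 / 4) (((2 : ℝ) ^ p)⁻¹ ^ (1 / (s * p))) with hσ
  have hσ0 : 0 < σ := lt_min (by norm_num) (by positivity)
  have hσ4 : σ ≤ 1 / 4 := min_le_left _ _
  have hσsp : σ ^ (s * p) * 2 ^ (p - 1) ≤ 1 / 2 := by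
    have h1 : σ ^ (s * p) ≤ ((2 : ℝ) ^ p)⁻¹ := by
      calc σ ^ (s * p) ≤ (((2 : ℝ) ^ p)⁻¹ ^ (1 / (s * p))) ^ (s * p) := by
            gcongr; exact min_le_right _ _
        _ = _ := by
            rw [← Real.rpow_mul (by positivity), one_div_mul_cancel hsp.ne', Real.rpow_one]
    calc _ ≤ ((2 : ℝ) ^ p)⁻¹ * 2 ^ (p - 1) := by gcongr
      _ = 1 / 2 := by
        rw [Real.rpow_sub (by norm_num), Real.rpow_one]
        have : (2 : ℝ) ^ p ≠ 0 := by positivity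
        field_simp
  set A : ℝ := σ ^ (-((n : ℝ) + s * p)) * (1 + ω) with hA
  have hA0 : 0 < A := by positivity
  set ε : ℝ := (σ ^ (n : ℝ) / 2) ^ (1 / m) with hε
  have hε0 : 0 < ε := by positivity
  have hεm : ε ^ m = σ ^ (n : ℝ) / 2 := by
    rw [hε, ← Real.rpow_mul (by positivity), one_div_mul_cancel hm0.ne', Real.rpow_one]
  obtain ⟨C₁, hC₁, hC₁b⟩ := rpow_le_powW_rpow hθ0 hm0 hθζ hε0
  set T : ℝ := A * 2 ^ (p - 1) with hT
  have hT0 : 0 < T := by positivity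
  set β := s * p / n with hβ
  have hβ0 : 0 < β := by positivity
  set D : ℝ := C₁ * C₀ * (2 + T) ^ (1 + β) with hD
  have hD0 : 0 < D := by positivity
  set κ : ℝ := min 1 ((σ ^ (n : ℝ) / (2 * D)) ^ (1 / β)) with hκ
  have hκ0 : 0 < κ := lt_min one_pos (by positivity)
  have hκ1 : κ ≤ 1 := min_le_left _ _
  have hκβ : D * κ ^ β ≤ σ ^ (n : ℝ) / 2 := by
    have h1 : κ ^ β ≤ σ ^ (n : ℝ) / (2 * D) := by
      calc κ ^ β ≤ ((σ ^ (n : ℝ) / (2 * D)) ^ (1 / β)) ^ β := by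
            gcongr; exact min_le_right _ _
        _ = _ := by
            rw [← Real.rpow_mul (by positivity), one_div_mul_cancel hβ0.ne', Real.rpow_one]
    calc _ ≤ D * (σ ^ (n : ℝ) / (2 * D)) := by gcongr
      _ = _ := by field_simp
  refine ⟨σ, κ, A, hσ0, hσ4, hκ0, hA0, ?_⟩
  clear_value κ D T ε A σ ω ζ θ β
  intro Ω ν u Φ K uj fj S x₀ r l d δ hr hball hd hdδ h1 h2 h3
  have hu := S.measurable_limit
  have hδ : 0 < δ := by linarith
  have hσr : 0 < σ * r := by positivity
  have hrn : 0 < r ^ (n : ℝ) := Real.rpow_pos_of_pos hr _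
  have hdm : 0 < d ^ m := Real.rpow_pos_of_pos hd _
  have hδm : 0 < δ ^ m := Real.rpow_pos_of_pos hδ _
  have hdp : d ^ (p - 1) ≤ 2 ^ (p - 1) * δ ^ (p - 1) := by
    rw [← Real.mul_rpow (by norm_num) hδ.le]; gcongr
  have hmono : ∀ y, max (u y - (l + d)) 0 ≤ max (u y - l) 0 := fun y =>
    max_le_max_right 0 (by linarith)
  have hm1 : Measurable fun y => max (u y - l) 0 ^ (p - 1) / ‖y - x₀‖ ^ ((n : ℝ) + s * p) := by
    fun_prop
  have hm2 : Measurable fun y => max (u y - l) 0 ^ m := by fun_prop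
  constructor
  · have hest := hlev Ω ν u Φ K uj fj S x₀ r (l + d) d δ κ κ T ((2 + T) * κ) hr hball hd hdδ
      hκ0.le hκ0.le hT0.le (by positivity) (le_of_eq (by ring)) ?_ ?_ ?_
    rotate_left
    · calc _ = ∫⁻ x in ball x₀ r, ENNReal.ofReal (d ^ (-m)) *
            ENNReal.ofReal (max (u x - l) 0 ^ m) := by
            congr 1; funext x
            rw [← ENNReal.ofReal_mul (by positivity)]
            congr 1
            have : u x - (l + d) + d = u x - l := by ring
            rw [this, Real.div_rpow (le_max_right _ _) hd.le, Real.rpow_neg hd.le]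
            ring
        _ ≤ ENNReal.ofReal (d ^ (-m)) * ENNReal.ofReal (κ * d ^ m * r ^ (n : ℝ)) := by
            rw [lintegral_const_mul' _ _ ENNReal.ofReal_ne_top]
            gcongr
        _ = _ := by
            rw [← ENNReal.ofReal_mul (by positivity)]
            congr 1
            rw [Real.rpow_neg hd.le]; field_simp
    · calc _ ≤ ∫⁻ y in (ball x₀ r)ᶜ, ENNReal.ofReal
            (max (u y - l) 0 ^ (p - 1) / ‖y - x₀‖ ^ ((n : ℝ) + s * p)) := by
            apply lintegral_mono
            intro y
            apply ENNReal.ofReal_le_ofReal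
            gcongr
            linarith
        _ ≤ _ := h2
        _ ≤ _ := by
            apply ENNReal.ofReal_le_ofReal
            have : 0 < r ^ (-(s * p)) := Real.rpow_pos_of_pos hr _
            calc A * d ^ (p - 1) * r ^ (-(s * p)) ≤
                A * (2 ^ (p - 1) * δ ^ (p - 1)) * r ^ (-(s * p)) := by gcongr
              _ = _ := by rw [hT]; ring
    · refine h3.trans (ENNReal.ofReal_le_ofReal (le_of_eq (by ring)))
    calc _ ≤ ∫⁻ x in ball x₀ (σ * r), (ENNReal.ofReal (δ ^ m * ε ^ m * d ^ (-m)) *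
          ENNReal.ofReal (max (u x - l) 0 ^ m) + ENNReal.ofReal (δ ^ m * C₁) *
          ENNReal.ofReal (powW θ ((u x - (l + d)) / δ) ^ ζ)) := by
          apply lintegral_mono
          intro x
          beta_reduce
          have hP : 0 ≤ powW θ ((u x - (l + d)) / δ) := powW_nonneg hθ0.le _
          rw [← ENNReal.ofReal_mul (by positivity), ← ENNReal.ofReal_mul (by positivity),
            ← ENNReal.ofReal_add (by positivity) (by positivity)]
          apply ENNReal.ofReal_le_ofReal
          refine (rpow_le_of_level hθ0 hm0 hε0 hd hδ hC₁ hC₁b).trans (le_of_eq ?_)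
          ring
      _ = ENNReal.ofReal (δ ^ m * ε ^ m * d ^ (-m)) *
          (∫⁻ x in ball x₀ (σ * r), ENNReal.ofReal (max (u x - l) 0 ^ m)) +
          ENNReal.ofReal (δ ^ m * C₁) *
          ∫⁻ x in ball x₀ (σ * r), ENNReal.ofReal (powW θ ((u x - (l + d)) / δ) ^ ζ) := by
          rw [lintegral_add_left (hm2.ennreal_ofReal.const_mul _),
            lintegral_const_mul' _ _ ENNReal.ofReal_ne_top,
            lintegral_const_mul' _ _ ENNReal.ofReal_ne_top]
      _ ≤ ENNReal.ofReal (δ ^ m * ε ^ m * d ^ (-m)) * ENNReal.ofReal (κ * d ^ m * r ^ (n : ℝ)) +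
          ENNReal.ofReal (δ ^ m * C₁) *
          ENNReal.ofReal (C₀ * (r ^ (n : ℝ) * ((2 + T) * κ) ^ (1 + β))) := by
          gcongr
          · refine (lintegral_mono_set (ball_subset_ball ?_)).trans h1
            nlinarith
          · refine (lintegral_mono_set (ball_subset_ball ?_)).trans hest
            nlinarith
      _ ≤ _ := by
          rw [← ENNReal.ofReal_mul (by positivity), ← ENNReal.ofReal_mul (by positivity),
            ← ENNReal.ofReal_add (by positivity) (by positivity)]
          apply ENNReal.ofReal_le_ofReal
          have e1 : δ ^ m * ε ^ m * d ^ (-m) * (κ * d ^ m * r ^ (n : ℝ)) =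
              δ ^ m * κ * r ^ (n : ℝ) * (σ ^ (n : ℝ) / 2) := by
            rw [hεm, Real.rpow_neg hd.le]; field_simp
          have e2 : δ ^ m * C₁ * (C₀ * (r ^ (n : ℝ) * ((2 + T) * κ) ^ (1 + β))) =
              δ ^ m * κ * r ^ (n : ℝ) * (D * κ ^ β) := by
            rw [Real.mul_rpow (by positivity) hκ0.le, Real.rpow_add hκ0, Real.rpow_one, hD]
            ring
          rw [e1, e2, Real.mul_rpow hσ0.le hr.le]
          have : δ ^ m * κ * r ^ (n : ℝ) * (D * κ ^ β) ≤
              δ ^ m * κ * r ^ (n : ℝ) * (σ ^ (n : ℝ) / 2) := by gcongr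
          linarith
  · have hsub : (ball x₀ (σ * r))ᶜ ⊆ (ball x₀ r)ᶜ ∪ (ball x₀ r \ ball x₀ (σ * r)) := by
      intro y hy
      by_cases h : y ∈ ball x₀ r
      · exact Or.inr ⟨h, hy⟩
      · exact Or.inl h
    have hpt : ∀ t : ℝ, 0 ≤ t → t ^ (p - 1) ≤ d ^ (p - 1) * (1 + d ^ (-m) * t ^ m) := by
      intro t ht
      have hd1 : 0 < d ^ (p - 1) := Real.rpow_pos_of_pos hd _
      rcases le_or_gt t d with htd | htd
      · calc t ^ (p - 1) ≤ d ^ (p - 1) := by gcongr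
          _ ≤ _ := le_mul_of_one_le_right hd1.le (le_add_of_nonneg_right (by positivity))
      · have ht0 : 0 < t := hd.trans htd
        have h4 : (t / d) ^ (p - 1) ≤ (t / d) ^ m :=
          Real.rpow_le_rpow_of_exponent_le ((one_le_div hd).2 htd.le) hpm
        rw [Real.div_rpow ht hd.le, Real.div_rpow ht hd.le, div_le_iff₀ hd1] at h4
        rw [Real.rpow_neg hd.le]
        calc _ ≤ _ := h4
          _ = d ^ (p - 1) * ((d ^ m)⁻¹ * t ^ m) := by ring
          _ ≤ _ := by gcongr; linarith
    have : Nonempty (Fin n) := ⟨⟨0, by omega⟩⟩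
    have : Nontrivial (Rn n) := inferInstance
    have hvol : volume (ball x₀ r) = ENNReal.ofReal (ω * r ^ (n : ℝ)) := by
      rw [Measure.addHaar_ball volume x₀ hr.le, finrank_euclideanSpace_fin, mul_comm ω,
        ENNReal.ofReal_mul (by positivity), hω, ofReal_measureReal measure_ball_lt_top.ne,
        Real.rpow_natCast]
    have hin : ∫⁻ y in ball x₀ r \ ball x₀ (σ * r), ENNReal.ofReal
        (max (u y - l) 0 ^ (p - 1) / ‖y - x₀‖ ^ ((n : ℝ) + s * p)) ≤
        ENNReal.ofReal ((σ * r) ^ (-((n : ℝ) + s * p)) * d ^ (p - 1) *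
          ((1 + ω) * r ^ (n : ℝ))) := by
      have hc : 0 ≤ (σ * r) ^ (-((n : ℝ) + s * p)) * d ^ (p - 1) := by positivity
      calc _ ≤ ∫⁻ y in ball x₀ r \ ball x₀ (σ * r),
            ENNReal.ofReal ((σ * r) ^ (-((n : ℝ) + s * p)) * d ^ (p - 1)) *
              (1 + ENNReal.ofReal (d ^ (-m)) * ENNReal.ofReal (max (u y - l) 0 ^ m)) := by
            refine setLIntegral_mono' (measurableSet_ball.diff measurableSet_ball) fun y hy => ?_
            have hy2 : σ * r ≤ ‖y - x₀‖ := by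
              have := hy.2
              rwa [mem_ball, not_lt, dist_eq_norm] at this
            rw [← ENNReal.ofReal_mul (by positivity), ← ENNReal.ofReal_one,
              ← ENNReal.ofReal_add (by positivity) (by positivity), ← ENNReal.ofReal_mul hc]
            apply ENNReal.ofReal_le_ofReal
            calc _ ≤ max (u y - l) 0 ^ (p - 1) / (σ * r) ^ ((n : ℝ) + s * p) := by gcongr
              _ ≤ d ^ (p - 1) * (1 + d ^ (-m) * max (u y - l) 0 ^ m) /
                  (σ * r) ^ ((n : ℝ) + s * p) := by
                  gcongr
                  exact hpt _ (le_max_right _ _)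
              _ = _ := by rw [Real.rpow_neg hσr.le]; ring
        _ ≤ ∫⁻ y in ball x₀ r,
            ENNReal.ofReal ((σ * r) ^ (-((n : ℝ) + s * p)) * d ^ (p - 1)) *
              (1 + ENNReal.ofReal (d ^ (-m)) * ENNReal.ofReal (max (u y - l) 0 ^ m)) :=
            lintegral_mono_set sdiff_subset
        _ = ENNReal.ofReal ((σ * r) ^ (-((n : ℝ) + s * p)) * d ^ (p - 1)) *
              (volume (ball x₀ r) + ENNReal.ofReal (d ^ (-m)) *
                ∫⁻ y in ball x₀ r, ENNReal.ofReal (max (u y - l) 0 ^ m)) := by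
            rw [lintegral_const_mul' _ _ ENNReal.ofReal_ne_top,
              lintegral_add_left measurable_const,
              lintegral_const_mul' _ _ ENNReal.ofReal_ne_top, setLIntegral_const, one_mul]
        _ ≤ ENNReal.ofReal ((σ * r) ^ (-((n : ℝ) + s * p)) * d ^ (p - 1)) *
              (ENNReal.ofReal (ω * r ^ (n : ℝ)) + ENNReal.ofReal (d ^ (-m)) *
                ENNReal.ofReal (κ * d ^ m * r ^ (n : ℝ))) := by
            rw [hvol]; gcongr
        _ ≤ _ := by
            rw [← ENNReal.ofReal_mul (by positivity),
              ← ENNReal.ofReal_add (by positivity) (by positivity), ← ENNReal.ofReal_mul hc]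
            apply ENNReal.ofReal_le_ofReal
            gcongr
            have : d ^ (-m) * (κ * d ^ m * r ^ (n : ℝ)) = κ * r ^ (n : ℝ) := by
              rw [Real.rpow_neg hd.le]; field_simp
            rw [this]
            nlinarith
    calc _ ≤ ∫⁻ y in (ball x₀ (σ * r))ᶜ, ENNReal.ofReal
          (max (u y - l) 0 ^ (p - 1) / ‖y - x₀‖ ^ ((n : ℝ) + s * p)) := by
          apply lintegral_mono
          intro y
          apply ENNReal.ofReal_le_ofReal
          gcongr
          linarith
      _ ≤ _ := lintegral_mono_set hsub
      _ ≤ _ := lintegral_union_le _ _ _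
      _ ≤ ENNReal.ofReal (A * d ^ (p - 1) * r ^ (-(s * p))) + ENNReal.ofReal
          ((σ * r) ^ (-((n : ℝ) + s * p)) * d ^ (p - 1) * ((1 + ω) * r ^ (n : ℝ))) :=
          add_le_add h2 hin
      _ ≤ _ := by
          rw [← ENNReal.ofReal_add (by positivity) (by positivity)]
          apply ENNReal.ofReal_le_ofReal
          have e1 : (σ * r) ^ (-((n : ℝ) + s * p)) * d ^ (p - 1) * ((1 + ω) * r ^ (n : ℝ)) =
              A * d ^ (p - 1) * r ^ (-(s * p)) := by
            have : r ^ (-(s * p)) = r ^ (-((n : ℝ) + s * p)) * r ^ (n : ℝ) := by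
              rw [← Real.rpow_add hr]; congr 1; ring
            rw [Real.mul_rpow hσ0.le hr.le, this, hA]; ring
          rw [e1, Real.mul_rpow hσ0.le hr.le, Real.rpow_neg hσ0.le]
          have hs0 : 0 < σ ^ (s * p) := Real.rpow_pos_of_pos hσ0 _
          have hr0 : 0 < r ^ (-(s * p)) := Real.rpow_pos_of_pos hr _
          have hδp : 0 < δ ^ (p - 1) := Real.rpow_pos_of_pos hδ _
          have h5 : 2 * d ^ (p - 1) ≤ δ ^ (p - 1) * (σ ^ (s * p))⁻¹ := by
            rw [← div_eq_mul_inv, le_div_iff₀ hs0]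
            calc 2 * d ^ (p - 1) * σ ^ (s * p) ≤
                2 * (2 ^ (p - 1) * δ ^ (p - 1)) * σ ^ (s * p) := by gcongr
              _ = 2 * δ ^ (p - 1) * (σ ^ (s * p) * 2 ^ (p - 1)) := by ring
              _ ≤ 2 * δ ^ (p - 1) * (1 / 2) := by gcongr
              _ = _ := by ring
          calc _ = A * (2 * d ^ (p - 1)) * r ^ (-(s * p)) := by ring
            _ ≤ A * (δ ^ (p - 1) * (σ ^ (s * p))⁻¹) * r ^ (-(s * p)) := by gcongr
            _ = _ := by ring

/-- The super-level sets of `u - L` having vanishing mean at a Lebesgue point force `u ≤ L`. -/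
lemma le_of_tendsto_level {n : ℕ} (hn : 2 ≤ n) {u : Rn n → ℝ} (hu : Measurable u) {x₀ : Rn n}
    {m κ L : ℝ} (hm : 0 < m) {r d : ℕ → ℝ} (hr : ∀ k, 0 < r k) (hr0 : Tendsto r atTop (𝓝 0))
    (hd0 : Tendsto d atTop (𝓝 0))
    (hL : Tendsto (fun ρ => (∫⁻ y in ball x₀ ρ, ENNReal.ofReal |u y - u x₀|) /
      volume (ball x₀ ρ)) (𝓝[>] 0) (𝓝 0))
    (H : ∀ k, ∫⁻ x in ball x₀ (r k), ENNReal.ofReal (max (u x - L) 0 ^ m) ≤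
      ENNReal.ofReal (κ * d k ^ m * r k ^ (n : ℝ))) :
    u x₀ ≤ L := by
  by_contra hlt
  rw [not_le] at hlt
  have : Nonempty (Fin n) := ⟨⟨0, by omega⟩⟩
  have : Nontrivial (Rn n) := inferInstance
  set η := u x₀ - L with hη
  have hη0 : 0 < η := by linarith
  have hpt : ∀ y, 1 ≤ 2 / η * |u y - u x₀| + (2 / η) ^ m * max (u y - L) 0 ^ m := by
    intro y
    have hp1 : 0 ≤ (2 / η) ^ m * max (u y - L) 0 ^ m := by positivity
    have hp2 : 0 ≤ 2 / η * |u y - u x₀| := by positivity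
    rcases le_or_gt (η / 2) |u y - u x₀| with h | h
    · have : 1 ≤ 2 / η * |u y - u x₀| := by
        rw [div_mul_eq_mul_div, one_le_div hη0]; linarith
      linarith
    · have h1 : η / 2 ≤ max (u y - L) 0 := by
        refine le_trans ?_ (le_max_left _ _)
        have := (abs_lt.1 h).1
        linarith
      have h2 : 1 ≤ 2 / η * max (u y - L) 0 := by
        rw [div_mul_eq_mul_div, one_le_div hη0]; linarith
      have h3 : 1 ≤ (2 / η * max (u y - L) 0) ^ m := Real.one_le_rpow h2 hm.le
      rw [Real.mul_rpow (by positivity) (by positivity)] at h3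
      linarith
  set ω : ℝ := volume.real (ball (0 : Rn n) 1) with hω
  have hω0 : 0 < ω := ENNReal.toReal_pos (measure_ball_pos _ _ one_pos).ne' measure_ball_lt_top.ne
  have hvol : ∀ ρ : ℝ, 0 < ρ → volume (ball x₀ ρ) = ENNReal.ofReal (ω * ρ ^ (n : ℝ)) := by
    intro ρ hρ
    rw [Measure.addHaar_ball volume x₀ hρ.le, finrank_euclideanSpace_fin, mul_comm ω,
      ENNReal.ofReal_mul (by positivity), hω, ofReal_measureReal measure_ball_lt_top.ne,
      Real.rpow_natCast]
  have hk : ∀ k, 1 ≤ ENNReal.ofReal (2 / η) * ((∫⁻ y in ball x₀ (r k),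
      ENNReal.ofReal |u y - u x₀|) / volume (ball x₀ (r k))) +
      ENNReal.ofReal ((2 / η) ^ m * (κ / ω) * d k ^ m) := by
    intro k
    have hv0 : volume (ball x₀ (r k)) ≠ 0 := (measure_ball_pos _ _ (hr k)).ne'
    have hvt : volume (ball x₀ (r k)) ≠ ⊤ := measure_ball_lt_top.ne
    have h1 : volume (ball x₀ (r k)) ≤ ENNReal.ofReal (2 / η) * (∫⁻ y in ball x₀ (r k),
        ENNReal.ofReal |u y - u x₀|) +
        ENNReal.ofReal ((2 / η) ^ m) * ENNReal.ofReal (κ * d k ^ m * r k ^ (n : ℝ)) := by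
      calc volume (ball x₀ (r k)) = ∫⁻ y in ball x₀ (r k), 1 := by simp
        _ ≤ ∫⁻ y in ball x₀ (r k), (ENNReal.ofReal (2 / η) * ENNReal.ofReal |u y - u x₀| +
            ENNReal.ofReal ((2 / η) ^ m) * ENNReal.ofReal (max (u y - L) 0 ^ m)) := by
          apply lintegral_mono
          intro y
          beta_reduce
          rw [← ENNReal.ofReal_mul (by positivity), ← ENNReal.ofReal_mul (by positivity),
            ← ENNReal.ofReal_add (by positivity) (by positivity), ← ENNReal.ofReal_one]
          exact ENNReal.ofReal_le_ofReal (hpt y)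
        _ = ENNReal.ofReal (2 / η) * (∫⁻ y in ball x₀ (r k), ENNReal.ofReal |u y - u x₀|) +
            ENNReal.ofReal ((2 / η) ^ m) *
              ∫⁻ y in ball x₀ (r k), ENNReal.ofReal (max (u y - L) 0 ^ m) := by
          have hm1 : Measurable fun y => |u y - u x₀| := by fun_prop
          rw [lintegral_add_left (hm1.ennreal_ofReal.const_mul _),
            lintegral_const_mul' _ _ ENNReal.ofReal_ne_top,
            lintegral_const_mul' _ _ ENNReal.ofReal_ne_top]
        _ ≤ _ := by gcongr; exact H k
    calc (1 : ℝ≥0∞) = volume (ball x₀ (r k)) / volume (ball x₀ (r k)) :=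
          (ENNReal.div_self hv0 hvt).symm
      _ ≤ (ENNReal.ofReal (2 / η) * (∫⁻ y in ball x₀ (r k), ENNReal.ofReal |u y - u x₀|) +
        ENNReal.ofReal ((2 / η) ^ m) * ENNReal.ofReal (κ * d k ^ m * r k ^ (n : ℝ))) /
          volume (ball x₀ (r k)) := by gcongr
      _ = _ := by
        have hrk := Real.rpow_pos_of_pos (hr k) (n : ℝ)
        rw [ENNReal.add_div, mul_div_assoc]
        congr 1
        rw [hvol _ (hr k), ← ENNReal.ofReal_mul (by positivity),
          ← ENNReal.ofReal_div_of_pos (by positivity)]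
        congr 1
        field_simp
  have hr' : Tendsto r atTop (𝓝[>] 0) :=
    tendsto_nhdsWithin_iff.2 ⟨hr0, Eventually.of_forall hr⟩
  have hlim : Tendsto (fun k => ENNReal.ofReal (2 / η) * ((∫⁻ y in ball x₀ (r k),
      ENNReal.ofReal |u y - u x₀|) / volume (ball x₀ (r k))) +
      ENNReal.ofReal ((2 / η) ^ m * (κ / ω) * d k ^ m)) atTop (𝓝 (0 + 0)) := by
    apply Tendsto.add
    · have := ENNReal.Tendsto.const_mul (a := ENNReal.ofReal (2 / η)) (hL.comp hr')
        (Or.inr ENNReal.ofReal_ne_top)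
      simpa using this
    · have h1 : Tendsto (fun k => (2 / η) ^ m * (κ / ω) * d k ^ m) atTop
          (𝓝 ((2 / η) ^ m * (κ / ω) * 0 ^ m)) :=
        (hd0.rpow_const (Or.inr hm.le)).const_mul _
      rw [Real.zero_rpow hm.ne', mul_zero] at h1
      simpa using ENNReal.tendsto_ofReal h1
  have h1 : (1 : ℝ≥0∞) ≤ 0 + 0 := ge_of_tendsto' hlim hk
  simp at h1

/-- The sequence of level increments. -/
def levelIncr (d₀ : ℝ) (M : ℕ → ℝ) : ℕ → ℝ
  | 0 => d₀
  | k + 1 => levelIncr d₀ M k / 2 + M k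

lemma levelIncr_pos {d₀ : ℝ} {M : ℕ → ℝ} (hd : 0 < d₀) (hM : ∀ k, 0 ≤ M k) (k : ℕ) :
    0 < levelIncr d₀ M k := by
  induction k with
  | zero => exact hd
  | succ k ih => have := hM k; simp only [levelIncr]; linarith

lemma sum_levelIncr_add (d₀ : ℝ) (M : ℕ → ℝ) (N : ℕ) :
    ∑ k ∈ Finset.range N, levelIncr d₀ M k + 2 * levelIncr d₀ M N =
      2 * d₀ + 2 * ∑ k ∈ Finset.range N, M k := by
  induction N with
  | zero => simp [levelIncr]
  | succ N ih =>
    rw [Finset.sum_range_succ, Finset.sum_range_succ]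
    simp only [levelIncr]
    linarith

/-- Pointwise upper bound by a dyadic Wolff-type sum. -/
lemma ApproxSol.le_of_sum_le {n : ℕ} (hn : 2 ≤ n) {Λ s p τ m : ℝ} (hs : 0 < s) (hs1 : s < 1)
    (hΛ : 1 ≤ Λ) (hp : 1 < p) (hτ : 0 < τ) (hτp : τ < p - 1) (hm : (1 + τ) * (p - 1) ≤ m)
    (hmζ : m ≤ p - 1 - τ + m * (s * p / n)) :
    ∃ σ κ A : ℝ, 0 < σ ∧ σ ≤ 1 / 4 ∧ 0 < κ ∧ 0 < A ∧
      ∀ (Ω : Set (Rn n)) (ν : Measure (Rn n)) (u : Rn n → ℝ)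
      (Φ : ℝ → ℝ) (K : Rn n → Rn n → ℝ) (uj fj : ℕ → Rn n → ℝ),
      ApproxSol n Λ s p m Ω ν u Φ K uj fj → ∀ (x₀ : Rn n) (r₀ d₀ S : ℝ) (M : ℕ → ℝ),
      0 < r₀ → closedBall x₀ r₀ ⊆ Ω → 0 < d₀ → (∀ k, 0 ≤ M k) →
      (∀ k, ν (closedBall x₀ (σ ^ k * r₀)) ≤
        ENNReal.ofReal (κ * M k ^ (p - 1) * (σ ^ k * r₀) ^ ((n : ℝ) - s * p))) →
      (∀ N, ∑ k ∈ Finset.range N, M k ≤ S) →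
      ∫⁻ x in ball x₀ r₀, ENNReal.ofReal (max (u x) 0 ^ m) ≤
        ENNReal.ofReal (κ * d₀ ^ m * r₀ ^ (n : ℝ)) →
      ∫⁻ y in (ball x₀ r₀)ᶜ,
        ENNReal.ofReal (max (u y) 0 ^ (p - 1) / ‖y - x₀‖ ^ ((n : ℝ) + s * p)) ≤
          ENNReal.ofReal (A * d₀ ^ (p - 1) * r₀ ^ (-(s * p))) →
      Tendsto (fun ρ => (∫⁻ y in ball x₀ ρ, ENNReal.ofReal |u y - u x₀|) /
        volume (ball x₀ ρ)) (𝓝[>] 0) (𝓝 0) →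
      u x₀ ≤ 2 * d₀ + 2 * S := by
  obtain ⟨σ, κ, A, hσ0, hσ4, hκ0, hA0, hstep⟩ :=
    ApproxSol.level_step hn hs hs1 hΛ hp hτ hτp hm hmζ
  refine ⟨σ, κ, A, hσ0, hσ4, hκ0, hA0, ?_⟩
  intro Ω ν u Φ K uj fj hS x₀ r₀ d₀ S M hr hball hd hM hν hMS h1 h2 hL
  have hm0 : 0 < m := by nlinarith
  set d := levelIncr d₀ M with hdd
  have hdpos : ∀ k, 0 < d k := levelIncr_pos hd hM
  have hrpos : ∀ k, 0 < σ ^ k * r₀ := fun k => by positivity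
  have hrle : ∀ k, σ ^ k * r₀ ≤ r₀ := fun k =>
    mul_le_of_le_one_left hr.le (pow_le_one₀ hσ0.le (by linarith))
  have key : ∀ k, ∫⁻ x in ball x₀ (σ ^ k * r₀),
      ENNReal.ofReal (max (u x - ∑ i ∈ Finset.range k, d i) 0 ^ m) ≤
        ENNReal.ofReal (κ * d k ^ m * (σ ^ k * r₀) ^ (n : ℝ)) ∧
      ∫⁻ y in (ball x₀ (σ ^ k * r₀))ᶜ, ENNReal.ofReal
        (max (u y - ∑ i ∈ Finset.range k, d i) 0 ^ (p - 1) / ‖y - x₀‖ ^ ((n : ℝ) + s * p)) ≤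
          ENNReal.ofReal (A * d k ^ (p - 1) * (σ ^ k * r₀) ^ (-(s * p))) := by
    intro k
    induction k with
    | zero => simpa [hdd, levelIncr] using And.intro h1 h2
    | succ k ih =>
      have hdk : d (k + 1) = d k / 2 + M k := rfl
      have hMd : M k ≤ d (k + 1) := by have := hdpos k; linarith
      rw [Finset.sum_range_succ, pow_succ', mul_assoc]
      refine hstep Ω ν u Φ K uj fj hS x₀ (σ ^ k * r₀) _ (d k) (d (k + 1)) (hrpos k)
        ((closedBall_subset_closedBall (hrle k)).trans hball) (hdpos k)
        (by have := hM k; linarith) ih.1 ih.2 ((hν k).trans (ENNReal.ofReal_le_ofReal ?_))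
      have hrk := Real.rpow_pos_of_pos (hrpos k) ((n : ℝ) - s * p)
      have := hM k
      gcongr
  have hsum : ∀ N, ∑ k ∈ Finset.range N, d k ≤ 2 * d₀ + 2 * S := by
    intro N
    have h3 := sum_levelIncr_add d₀ M N
    have h4 := hdpos N
    have h5 := hMS N
    simp only [← hdd] at h3
    linarith
  have hsm : Summable d := summable_of_sum_range_le (fun k => (hdpos k).le) hsum
  refine le_of_tendsto_level hn hS.measurable_limit (κ := κ) hm0 hrpos ?_
    hsm.tendsto_atTop_zero hL fun k => le_trans (lintegral_mono fun x => ?_) (key k).1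
  · have := (tendsto_pow_atTop_nhds_zero_of_lt_one hσ0.le (by linarith : σ < 1)).mul_const r₀
    simpa using this
  · apply ENNReal.ofReal_le_ofReal
    have := hsum k
    gcongr

/-- Weak type estimate behind the maximal theorem, localized to the set where `2 g > t`. -/
lemma volume_le_of_forall_exists_ball {n : ℕ} (hn : 2 ≤ n) {g : Rn n → ℝ} (hg : Measurable g)
    {E : Set (Rn n)} {R t : ℝ} (ht : 0 < t)
    (h : ∀ x ∈ E, ∃ ρ : ℝ, 0 < ρ ∧ ρ ≤ R ∧ ENNReal.ofReal t * volume (closedBall x ρ) <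
      ∫⁻ y in closedBall x ρ, ENNReal.ofReal (g y)) :
    volume E ≤ ENNReal.ofReal (2 * 5 ^ n / t) *
      ∫⁻ y in {y | t < 2 * g y}, ENNReal.ofReal (g y) := by
  have : Nonempty (Fin n) := ⟨⟨0, by omega⟩⟩
  have : Nontrivial (Rn n) := inferInstance
  choose! ρ hρ0 hρR hρ using h
  obtain ⟨T, hTE, hdisj, hcov⟩ := Vitali.exists_disjoint_subfamily_covering_enlargement_closedBall
    E (fun x => x) ρ R (fun x hx => hρR x hx) 5 (by norm_num)
  have hTc : T.Countable := by
    refine hdisj.countable_of_nonempty_interior fun x hx => ⟨x, ?_⟩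
    exact ball_subset_interior_closedBall (mem_ball_self (hρ0 x (hTE hx)))
  set D : Set (Rn n) := {y | t < 2 * g y} with hD
  have hDm : MeasurableSet D := measurableSet_lt measurable_const (by fun_prop)
  have hball : ∀ x ∈ E, volume (closedBall x (5 * ρ x)) ≤ ENNReal.ofReal (2 * 5 ^ n / t) *
      ∫⁻ y in closedBall x (ρ x), D.indicator (fun y => ENNReal.ofReal (g y)) y := by
    intro x hx
    set B := closedBall x (ρ x) with hB
    have hBt : volume B ≠ ⊤ := measure_closedBall_lt_top.ne
    have h5 : volume (closedBall x (5 * ρ x)) = ENNReal.ofReal (5 ^ n) * volume B := by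
      rw [hB, Measure.addHaar_closedBall volume x (by have := hρ0 x hx; positivity),
        Measure.addHaar_closedBall volume x (hρ0 x hx).le, finrank_euclideanSpace_fin, mul_pow,
        ENNReal.ofReal_mul (by positivity), mul_assoc]
    have h1 : ∫⁻ y in B, ENNReal.ofReal (g y) ≤
        (∫⁻ y in B, D.indicator (fun y => ENNReal.ofReal (g y)) y) +
          ENNReal.ofReal (t / 2) * volume B := by
      calc _ ≤ ∫⁻ y in B, (D.indicator (fun y => ENNReal.ofReal (g y)) y +
            ENNReal.ofReal (t / 2)) := by
            apply lintegral_mono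
            intro y
            by_cases hy : y ∈ D
            · simp [hy]
            · simp only [hy, not_false_eq_true, indicator_of_notMem, zero_add]
              apply ENNReal.ofReal_le_ofReal
              have : ¬ t < 2 * g y := hy
              linarith
        _ = _ := by
            rw [lintegral_add_right _ measurable_const, setLIntegral_const]
    have h2 : ENNReal.ofReal (t / 2) * volume B ≤
        ∫⁻ y in B, D.indicator (fun y => ENNReal.ofReal (g y)) y := by
      have h3 := (hρ x hx).le.trans h1
      have h4 : ENNReal.ofReal t = ENNReal.ofReal (t / 2) + ENNReal.ofReal (t / 2) := by
        rw [← ENNReal.ofReal_add (by positivity) (by positivity)]; congr 1; ring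
      rw [h4, add_mul] at h3
      exact ENNReal.le_of_add_le_add_right (ENNReal.mul_ne_top ENNReal.ofReal_ne_top hBt) h3
    calc _ = ENNReal.ofReal (2 * 5 ^ n / t) * (ENNReal.ofReal (t / 2) * volume B) := by
          rw [h5, ← mul_assoc, ← ENNReal.ofReal_mul (by positivity)]
          congr 2
          field_simp
      _ ≤ _ := by gcongr
  calc volume E ≤ volume (⋃ x ∈ T, closedBall x (5 * ρ x)) := by
        apply measure_mono
        intro x hx
        obtain ⟨b, hb, hsub⟩ := hcov x hx
        exact mem_biUnion hb (hsub (mem_closedBall_self (hρ0 x hx).le))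
    _ ≤ ∑' x : T, volume (closedBall (x : Rn n) (5 * ρ x)) := measure_biUnion_le _ hTc _
    _ ≤ ∑' x : T, ENNReal.ofReal (2 * 5 ^ n / t) *
        ∫⁻ y in closedBall (x : Rn n) (ρ x), D.indicator (fun y => ENNReal.ofReal (g y)) y :=
        ENNReal.tsum_le_tsum fun x => hball x (hTE x.2)
    _ = ENNReal.ofReal (2 * 5 ^ n / t) * ∫⁻ y in ⋃ x ∈ T, closedBall x (ρ x),
        D.indicator (fun y => ENNReal.ofReal (g y)) y := by
        rw [ENNReal.tsum_mul_left, lintegral_biUnion hTc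
          (fun _ _ => measurableSet_closedBall) hdisj]
    _ ≤ ENNReal.ofReal (2 * 5 ^ n / t) *
        ∫⁻ y, D.indicator (fun y => ENNReal.ofReal (g y)) y := by
        gcongr
        exact Measure.restrict_le_self
    _ = _ := by rw [lintegral_indicator hDm]

/-- Strong type estimate from a localized weak type estimate. -/
lemma lintegral_rpow_le_of_weak_type {n : ℕ} {g A : Rn n → ℝ} (hg : Measurable g)
    (hg0 : ∀ x, 0 ≤ g x) (hA : Measurable A) (hA0 : ∀ x, 0 ≤ A x) {C q : ℝ} (hC : 0 ≤ C)
    (hq : 1 < q)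
    (h : ∀ t : ℝ, 0 < t → volume {x | t < A x} ≤ ENNReal.ofReal (C / t) *
      ∫⁻ y in {y | t < 2 * g y}, ENNReal.ofReal (g y)) :
    ∫⁻ x, ENNReal.ofReal (A x ^ q) ≤
      ENNReal.ofReal (q * C * 2 ^ (q - 1) / (q - 1)) * ∫⁻ x, ENNReal.ofReal (g x ^ q) := by
  set ν : Measure (Rn n) := volume.withDensity fun y => ENNReal.ofReal (g y) with hν
  have hq1 : 0 < q - 1 := by linarith
  have hνl : ∫⁻ y, ENNReal.ofReal ((2 * g y) ^ (q - 1)) ∂ν = ENNReal.ofReal (2 ^ (q - 1)) *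
      ∫⁻ x, ENNReal.ofReal (g x ^ q) := by
    rw [hν, lintegral_withDensity_eq_lintegral_mul _ hg.ennreal_ofReal (by fun_prop),
      ← lintegral_const_mul' _ _ ENNReal.ofReal_ne_top]
    congr 1; funext x
    rw [Pi.mul_apply, ← ENNReal.ofReal_mul (hg0 x), ← ENNReal.ofReal_mul (by positivity)]
    congr 1
    rw [Real.mul_rpow (by norm_num) (hg0 x)]
    rcases (hg0 x).eq_or_lt with h0 | h0
    · rw [← h0, Real.zero_rpow (by linarith : q ≠ 0)]; ring
    · have : g x ^ q = g x ^ (q - 1) * g x := by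
        rw [← Real.rpow_add_one h0.ne']; congr 1; ring
      rw [this]; ring
  have hlay := lintegral_rpow_eq_lintegral_meas_lt_mul ν (f := fun y => 2 * g y)
    (Eventually.of_forall fun y => by have := hg0 y; simp only [Pi.zero_apply]; positivity)
    (by fun_prop) hq1
  rw [lintegral_rpow_eq_lintegral_meas_lt_mul volume (Eventually.of_forall hA0) hA.aemeasurable
    (by linarith : 0 < q)]
  have hI : ENNReal.ofReal (1 / (q - 1)) * ENNReal.ofReal (q - 1) = 1 := by
    rw [← ENNReal.ofReal_mul (by positivity), one_div_mul_cancel hq1.ne', ENNReal.ofReal_one]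
  calc _ ≤ ENNReal.ofReal q * ∫⁻ t in Ioi (0 : ℝ), ENNReal.ofReal C *
        (ν {y | t < 2 * g y} * ENNReal.ofReal (t ^ (q - 1 - 1))) := by
        gcongr ENNReal.ofReal q * ?_
        refine setLIntegral_mono' measurableSet_Ioi fun t ht => ?_
        have ht0 : (0 : ℝ) < t := ht
        have hD : MeasurableSet {y | t < 2 * g y} := measurableSet_lt measurable_const (by fun_prop)
        rw [hν, withDensity_apply _ hD]
        calc _ ≤ ENNReal.ofReal (C / t) * (∫⁻ y in {y | t < 2 * g y}, ENNReal.ofReal (g y)) *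
              ENNReal.ofReal (t ^ (q - 1)) := by gcongr; exact h t ht0
          _ = (∫⁻ y in {y | t < 2 * g y}, ENNReal.ofReal (g y)) *
              (ENNReal.ofReal (C / t) * ENNReal.ofReal (t ^ (q - 1))) := by ring
          _ = (∫⁻ y in {y | t < 2 * g y}, ENNReal.ofReal (g y)) *
              (ENNReal.ofReal C * ENNReal.ofReal (t ^ (q - 1 - 1))) := by
              rw [← ENNReal.ofReal_mul (by positivity), ← ENNReal.ofReal_mul hC,
                Real.rpow_sub_one ht0.ne' (q - 1)]
              congr 2
              ring
          _ = _ := by ring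
    _ = ENNReal.ofReal q * (ENNReal.ofReal C * (ENNReal.ofReal (1 / (q - 1)) *
        (ENNReal.ofReal (q - 1) *
        ∫⁻ t in Ioi (0 : ℝ), ν {y | t < 2 * g y} * ENNReal.ofReal (t ^ (q - 1 - 1))))) := by
        rw [lintegral_const_mul' _ _ ENNReal.ofReal_ne_top,
          ← mul_assoc (ENNReal.ofReal (1 / (q - 1))), hI, one_mul]
    _ = ENNReal.ofReal q * (ENNReal.ofReal C * (ENNReal.ofReal (1 / (q - 1)) *
        (ENNReal.ofReal (2 ^ (q - 1)) * ∫⁻ x, ENNReal.ofReal (g x ^ q)))) := by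
        rw [← hlay, hνl]
    _ = _ := by
        rw [← mul_assoc, ← mul_assoc, ← mul_assoc, ← ENNReal.ofReal_mul (by linarith),
          ← ENNReal.ofReal_mul (by positivity), ← ENNReal.ofReal_mul (by positivity)]
        congr 2
        ring

/-- The average of a nonnegative function over a closed ball. -/
def ballMean (n : ℕ) (g : Rn n → ℝ) (x : Rn n) (r : ℝ) : ℝ≥0 :=
  ((∫⁻ y in closedBall x r, ENNReal.ofReal (g y)) / volume (closedBall x r)).toNNReal

lemma measurable_ballMean {n : ℕ} {g : Rn n → ℝ} (hg : Measurable g) {r : ℝ} (hr : 0 ≤ r) :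
    Measurable fun x => ballMean n g x r := by
  have h1 : Measurable fun x : Rn n => ∫⁻ y in closedBall x r, ENNReal.ofReal (g y) := by
    have h2 : Measurable fun z : Rn n × Rn n =>
        {z : Rn n × Rn n | dist z.2 z.1 ≤ r}.indicator (fun z => ENNReal.ofReal (g z.2)) z := by
      refine Measurable.indicator (by fun_prop) ?_
      exact (isClosed_le (by fun_prop) continuous_const).measurableSet
    have h3 := h2.lintegral_prod_right' (ν := (volume : Measure (Rn n)))
    convert h3 using 2 with x
    rw [← lintegral_indicator measurableSet_closedBall]
    rfl
  have h4 : (fun x => ballMean n g x r) = fun x => ((∫⁻ y in closedBall x r,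
      ENNReal.ofReal (g y)) / volume (closedBall (0 : Rn n) r)).toNNReal := by
    funext x
    rw [ballMean, Measure.addHaar_closedBall volume x hr, Measure.addHaar_closedBall volume 0 hr]
  rw [h4]
  exact (h1.div_const _).ennreal_toNNReal

/-- The finite maximal function along the radii `r k`, `k < N`, is bounded on `L^q`. -/
lemma lintegral_sup_ballMean_le {n : ℕ} (hn : 2 ≤ n) {q : ℝ} (hq : 1 < q) :
    ∃ C : ℝ, 0 ≤ C ∧ ∀ (g : Rn n → ℝ) (r : ℕ → ℝ) (N : ℕ), Measurable g → (∀ x, 0 ≤ g x) →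
      (∀ k, 0 < r k) →
      ∫⁻ x, ENNReal.ofReal
        ((((Finset.range N).sup fun k => ballMean n g x (r k) : ℝ≥0) : ℝ) ^ q) ≤
        ENNReal.ofReal C * ∫⁻ x, ENNReal.ofReal (g x ^ q) := by
  refine ⟨q * (2 * 5 ^ n) * 2 ^ (q - 1) / (q - 1), ?_, fun g r N hg hg0 hr => ?_⟩
  · have : 0 < q - 1 := by linarith
    positivity
  have hA : Measurable fun x => (Finset.range N).sup fun k => ballMean n g x (r k) := by
    have : ∀ s : Finset ℕ, Measurable fun x => s.sup fun k => ballMean n g x (r k) := by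
      intro s
      induction s using Finset.induction_on with
      | empty => simp
      | insert a s ha ih =>
        simp only [Finset.sup_insert]
        exact (measurable_ballMean hg (hr a).le).sup ih
    exact this _
  refine lintegral_rpow_le_of_weak_type hg hg0 hA.coe_nnreal_real (fun x => NNReal.coe_nonneg _)
    (by positivity) hq fun t ht => ?_
  refine volume_le_of_forall_exists_ball hn hg (R := ∑ k ∈ Finset.range N, r k) ht fun x hx => ?_
  have hx' : t.toNNReal < (Finset.range N).sup fun k => ballMean n g x (r k) := by
    rw [Real.toNNReal_lt_iff_lt_coe ht.le]; exact hx
  obtain ⟨k, hk, hlt⟩ := Finset.lt_sup_iff.1 hx'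
  refine ⟨r k, hr k, Finset.single_le_sum (fun i _ => (hr i).le) hk, ?_⟩
  have h1 : ENNReal.ofReal t < (∫⁻ y in closedBall x (r k), ENNReal.ofReal (g y)) /
      volume (closedBall x (r k)) := by
    refine lt_of_lt_of_le ?_ ENNReal.coe_toNNReal_le_self
    exact ENNReal.coe_lt_coe.2 hlt
  have hv0 : volume (closedBall x (r k)) ≠ 0 := (measure_closedBall_pos _ _ (hr k)).ne'
  rwa [ENNReal.lt_div_iff_mul_lt (Or.inl hv0) (Or.inl measure_closedBall_lt_top.ne)] at h1

lemma sum_le_of_two_powers {σ a b : ℝ} (hσ : 0 < σ) (hσ1 : σ < 1) (ha : 0 < a) (hb : 0 < b)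
    {t W : ℝ} (ht : 0 < t) (hW : 0 ≤ W) {M : ℕ → ℝ} {N : ℕ}
    (h1 : ∀ k < N, M k ≤ W * (σ ^ k * t) ^ a) (h2 : ∀ k < N, M k ≤ W * (σ ^ k * t) ^ (-b)) :
    ∑ k ∈ Finset.range N, M k ≤ W * (4 / (1 - σ ^ min a b)) := by
  set e := min a b with he
  have he0 : 0 < e := lt_min ha hb
  have hl1 : σ ^ e < 1 := Real.rpow_lt_one hσ.le hσ1 he0
  have hl0 : 0 < σ ^ e := Real.rpow_pos_of_pos hσ _
  set φ : ℝ → ℝ := fun x => x ^ e / (1 + x ^ e) with hφ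
  have hstep : ∀ x : ℝ, 0 < x → ∀ y, y ≤ W * x ^ a → y ≤ W * x ^ (-b) →
      y ≤ W * (4 / (1 - σ ^ e)) * (φ x - φ (σ * x)) := by
    intro x hx y hy1 hy2
    set z := x ^ e with hz
    have hz0 : 0 < z := Real.rpow_pos_of_pos hx _
    have hmul : (σ * x) ^ e = σ ^ e * z := Real.mul_rpow hσ.le hx.le
    have hy : y ≤ W * (4 * z / (1 + z) ^ 2) := by
      rcases le_or_gt x 1 with hx1 | hx1
      · have hz1 : z ≤ 1 := Real.rpow_le_one hx.le hx1 he0.le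
        have h3 : x ^ a ≤ z := Real.rpow_le_rpow_of_exponent_ge hx hx1 (min_le_left _ _)
        have h4 : z ≤ 4 * z / (1 + z) ^ 2 := by
          rw [le_div_iff₀ (by positivity)]
          have : (1 + z) ^ 2 ≤ 4 := by nlinarith
          nlinarith
        exact hy1.trans (mul_le_mul_of_nonneg_left (h3.trans h4) hW)
      · have hz1 : 1 ≤ z := Real.one_le_rpow hx1.le he0.le
        have h3 : x ^ (-b) ≤ z⁻¹ := by
          rw [hz, ← Real.rpow_neg hx.le]
          exact Real.rpow_le_rpow_of_exponent_le hx1.le (neg_le_neg (min_le_right _ _))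
        have h4 : z⁻¹ ≤ 4 * z / (1 + z) ^ 2 := by
          rw [inv_eq_one_div, div_le_div_iff₀ hz0 (by positivity)]
          nlinarith
        exact hy2.trans (mul_le_mul_of_nonneg_left (h3.trans h4) hW)
    have hdiff : φ x - φ (σ * x) = (1 - σ ^ e) * z / ((1 + z) * (1 + σ ^ e * z)) := by
      simp only [hφ, hmul, ← hz]
      field_simp
      ring
    have h5 : 4 * z / (1 + z) ^ 2 ≤ 4 / (1 - σ ^ e) * (φ x - φ (σ * x)) := by
      have h6 : 0 < 1 - σ ^ e := by linarith
      have : 4 / (1 - σ ^ e) * (φ x - φ (σ * x)) = 4 * z / ((1 + z) * (1 + σ ^ e * z)) := by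
        rw [hdiff]; field_simp
      rw [this, sq]
      gcongr
      nlinarith
    calc y ≤ _ := hy
      _ ≤ W * (4 / (1 - σ ^ e) * (φ x - φ (σ * x))) := by gcongr
      _ = _ := by ring
  have hpos : ∀ k : ℕ, 0 < σ ^ k * t := fun k => by positivity
  have hc : 0 ≤ W * (4 / (1 - σ ^ e)) := by
    have : 0 < 1 - σ ^ e := by linarith
    positivity
  calc _ ≤ ∑ k ∈ Finset.range N, W * (4 / (1 - σ ^ e)) *
        (φ (σ ^ k * t) - φ (σ ^ (k + 1) * t)) := by
        apply Finset.sum_le_sum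
        intro k hk
        rw [Finset.mem_range] at hk
        have := hstep _ (hpos k) _ (h1 k hk) (h2 k hk)
        rwa [← mul_assoc, ← pow_succ'] at this
    _ = W * (4 / (1 - σ ^ e)) * (φ (σ ^ 0 * t) - φ (σ ^ N * t)) := by
        rw [← Finset.mul_sum, Finset.sum_range_sub' (fun k => φ (σ ^ k * t))]
    _ ≤ W * (4 / (1 - σ ^ e)) * 1 := by
        gcongr
        have h7 : φ (σ ^ 0 * t) ≤ 1 := by
          simp only [hφ]
          have := hpos 0
          rw [div_le_one (by positivity)]
          linarith
        have h8 : 0 ≤ φ (σ ^ N * t) := by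
          simp only [hφ]
          have := hpos N
          positivity
        linarith
    _ = _ := mul_one _

/-- Hedberg's pointwise interpolation for dyadic Wolff sums. -/
lemma hedberg_sum_le {σ N' e p q κ ω H : ℝ} (hσ : 0 < σ) (hσ1 : σ < 1) (he : 0 < e) (hp : 1 < p)
    (hq : 1 < q) (heq : e * q < N') (hκ : 0 < κ) (hω : 0 < ω) :
    ∃ C : ℝ, 0 ≤ C ∧ ∀ (r₀ A : ℝ) (b : ℕ → ℝ) (N : ℕ), 0 < r₀ → 0 < A → (∀ k, 0 ≤ b k) →
      (∀ k < N, b k ≤ A * (ω * (σ ^ k * r₀) ^ N')) →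
      (∀ k < N, b k ≤ H * (σ ^ k * r₀) ^ (N' - N' / q)) →
      (∑ k ∈ Finset.range N, (b k * (σ ^ k * r₀) ^ (e - N') / κ) ^ (1 / (p - 1))) ^
        (N' * q * (p - 1) / (N' - e * q)) ≤ C * A ^ q := by
  have hp1 : 0 < p - 1 := by linarith
  have hq0 : 0 < q := by linarith
  have hN : 0 < N' := by nlinarith
  have hNe : 0 < N' - e * q := by linarith
  have hb0 : 0 < N' / q - e := by
    rw [sub_pos, lt_div_iff₀ hq0]; linarith
  set γ := 1 / (p - 1) with hγ
  have hγ0 : 0 < γ := by positivity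
  set a' := e * γ with ha'
  set b' := (N' / q - e) * γ with hb'
  have ha0 : 0 < a' := by positivity
  have hbb0 : 0 < b' := by positivity
  set Q := N' * q * (p - 1) / (N' - e * q) with hQ
  have hQ0 : 0 < Q := by positivity
  set c := (max ω H / κ) ^ γ with hc
  have hm0 : 0 < max ω H := lt_max_of_lt_left hω
  have hc0 : 0 < c := by positivity
  set G := 4 / (1 - σ ^ min a' b') with hG
  have hG0 : 0 ≤ G := by
    have : σ ^ min a' b' < 1 := Real.rpow_lt_one hσ.le hσ1 (lt_min ha0 hbb0)
    have : 0 < 1 - σ ^ min a' b' := by linarith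
    positivity
  refine ⟨(c * G) ^ Q, by positivity, fun r₀ A b N hr hA hb h1 h2 => ?_⟩
  set y := A ^ (q / N') with hy
  have hy0 : 0 < y := Real.rpow_pos_of_pos hA _
  set W := c * y ^ b' with hW
  have hW0 : 0 ≤ W := by positivity
  have hrk : ∀ k : ℕ, 0 < σ ^ k * r₀ := fun k => by positivity
  have hAy : A = y ^ (N' / q) := by
    rw [hy, ← Real.rpow_mul hA.le]
    have : q / N' * (N' / q) = 1 := by field_simp
    rw [this, Real.rpow_one]
  have key : ∑ k ∈ Finset.range N, (b k * (σ ^ k * r₀) ^ (e - N') / κ) ^ γ ≤ W * G := by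
    refine sum_le_of_two_powers hσ hσ1 ha0 hbb0 (t := r₀ * y) (by positivity) hW0
      (fun k hk => ?_) (fun k hk => ?_)
    · have hr' := hrk k
      have h0 := hb k
      have h1' := h1 k hk
      rw [← mul_assoc]
      generalize σ ^ k * r₀ = ρ at hr' h0 h1' ⊢
      have h3 : b k * ρ ^ (e - N') / κ ≤ max ω H / κ * (A * ρ ^ e) := by
        have h4 := Real.rpow_pos_of_pos hr' (e - N')
        calc b k * ρ ^ (e - N') / κ ≤ A * (ω * ρ ^ N') * ρ ^ (e - N') / κ := by gcongr
          _ = ω / κ * (A * (ρ ^ N' * ρ ^ (e - N'))) := by ring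
          _ = ω / κ * (A * ρ ^ e) := by
              rw [← Real.rpow_add hr']; congr 3; ring
          _ ≤ _ := by gcongr; exact le_max_left _ _
      have h4 : 0 ≤ b k * ρ ^ (e - N') / κ := by positivity
      calc _ ≤ (max ω H / κ * (A * ρ ^ e)) ^ γ := by gcongr
        _ = c * (A ^ γ * ρ ^ a') := by
            rw [Real.mul_rpow (by positivity) (by positivity), Real.mul_rpow hA.le (by positivity),
              ← Real.rpow_mul hr'.le]
        _ = _ := by
            rw [hW, Real.mul_rpow hr'.le hy0.le]
            have h5 : A ^ γ = y ^ b' * y ^ a' := by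
              conv_lhs => rw [hAy]
              rw [← Real.rpow_mul hy0.le, ← Real.rpow_add hy0]
              congr 1
              rw [ha', hb']; ring
            rw [h5]; ring
    · have hr' := hrk k
      have h0 := hb k
      have h2' := h2 k hk
      rw [← mul_assoc]
      generalize σ ^ k * r₀ = ρ at hr' h0 h2' ⊢
      have h3 : b k * ρ ^ (e - N') / κ ≤ max ω H / κ * ρ ^ (e - N' / q) := by
        have h4 := Real.rpow_pos_of_pos hr' (e - N')
        calc b k * ρ ^ (e - N') / κ ≤ H * ρ ^ (N' - N' / q) * ρ ^ (e - N') / κ := by gcongr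
          _ = H / κ * (ρ ^ (N' - N' / q) * ρ ^ (e - N')) := by ring
          _ = H / κ * ρ ^ (e - N' / q) := by
              rw [← Real.rpow_add hr']; congr 2; ring
          _ ≤ _ := by gcongr; exact le_max_right _ _
      have h4 : 0 ≤ b k * ρ ^ (e - N') / κ := by positivity
      calc _ ≤ (max ω H / κ * ρ ^ (e - N' / q)) ^ γ := by gcongr
        _ = c * ρ ^ (-b') := by
            rw [Real.mul_rpow (by positivity) (by positivity), ← Real.rpow_mul hr'.le]
            congr 2
            rw [hb']; ring
        _ = _ := by
            rw [hW, Real.mul_rpow hr'.le hy0.le, Real.rpow_neg hy0.le b']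
            have := Real.rpow_pos_of_pos hy0 b'
            field_simp
  have hs0 : 0 ≤ ∑ k ∈ Finset.range N, (b k * (σ ^ k * r₀) ^ (e - N') / κ) ^ γ := by
    refine Finset.sum_nonneg fun k _ => ?_
    have := hb k
    have := hrk k
    positivity
  calc _ ≤ (W * G) ^ Q := by gcongr
    _ = (c * G) ^ Q * (y ^ b') ^ Q := by
        rw [hW, ← Real.mul_rpow (by positivity) (by positivity)]; congr 1; ring
    _ = _ := by
        rw [← Real.rpow_mul hy0.le, hy, ← Real.rpow_mul hA.le]
        congr 2
        rw [hb', hQ, hγ]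
        field_simp
        exact div_self (by rw [mul_comm q e]; exact hNe.ne')

/-- Smooth approximation of the indicator of a compact set from above. -/
lemma exists_testFun_tendsto_indicator {n : ℕ} {Ω K : Set (Rn n)} (hΩ : IsOpen Ω)
    (hK : IsCompact K) (hKΩ : K ⊆ Ω) :
    ∃ (K' : Set (Rn n)) (φ : ℕ → Rn n → ℝ), IsCompact K' ∧ K' ⊆ Ω ∧ (∀ k, IsTestFun n Ω (φ k)) ∧
      (∀ k x, |φ k x| ≤ K'.indicator 1 x) ∧
      ∀ x, Tendsto (fun k => φ k x) atTop (𝓝 (K.indicator 1 x)) := by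
  obtain ⟨δ, hδ, hδΩ⟩ := hK.exists_cthickening_subset_open hΩ hKΩ
  set ε : ℕ → ℝ := fun k => δ / (k + 1) with hε
  have hε0 : ∀ k, 0 < ε k := fun k => by positivity
  have hεδ : ∀ k, ε k ≤ δ := fun k => by
    rw [hε, div_le_iff₀ (by positivity)]
    have : (0 : ℝ) ≤ k := by positivity
    nlinarith
  have hex : ∀ k, ∃ φ : Rn n → ℝ, ContDiff ℝ (⊤ : ℕ∞) φ ∧ (∀ x ∉ thickening (ε k) K, φ x = 0) ∧
      (∀ x ∈ K, φ x = 1) ∧ ∀ x, φ x ∈ Icc (0 : ℝ) 1 := by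
    intro k
    have hd : Disjoint (thickening (ε k) K)ᶜ K := by
      rw [disjoint_compl_left_iff_subset]
      exact self_subset_thickening (hε0 k) K
    obtain ⟨f, hf0, hf1, hf⟩ := exists_contMDiffMap_zero_one_of_isClosed (n := (⊤ : ℕ∞))
      (modelWithCornersSelf ℝ (Rn n)) isOpen_thickening.isClosed_compl hK.isClosed hd
    exact ⟨f, f.contMDiff.contDiff, fun x hx => hf0 hx, fun x hx => hf1 hx, hf⟩
  choose φ hφs hφ0 hφ1 hφ using hex
  have hts : ∀ k, tsupport (φ k) ⊆ cthickening δ K := fun k => by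
    refine closure_minimal (fun x hx => ?_) isClosed_cthickening
    by_contra h
    exact hx (hφ0 k x fun hx' =>
      h (thickening_subset_cthickening_of_le (hεδ k) K hx'))
  refine ⟨cthickening δ K, φ, hK.cthickening, hδΩ, fun k => ⟨hφs k,
    hK.cthickening.of_isClosed_subset (isClosed_tsupport _) (hts k), (hts k).trans hδΩ⟩,
    fun k x => ?_, fun x => ?_⟩
  · by_cases hx : x ∈ cthickening δ K
    · rw [indicator_of_mem hx, Pi.one_apply, abs_le]
      have := hφ k x
      exact ⟨by linarith [this.1], this.2⟩
    · have h0 : φ k x = 0 := by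
        by_contra h
        exact hx (hts k (subset_tsupport _ h))
      simp [hx, h0]
  · by_cases hx : x ∈ K
    · simp [hx, hφ1 _ x hx]
    · rw [indicator_of_notMem hx]
      have hx' : x ∉ closure K := by rwa [hK.isClosed.closure_eq]
      obtain ⟨η, hη, hxη⟩ : ∃ η > 0, x ∉ thickening η K := by
        have h1 := hx'
        rw [closure_eq_iInter_thickening] at h1
        simpa using h1
      have hlim : Tendsto ε atTop (𝓝 0) := by
        have h2 := (tendsto_one_div_add_atTop_nhds_zero_nat (𝕜 := ℝ)).const_mul δ
        simpa [hε, div_eq_mul_inv] using h2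
      refine tendsto_const_nhds.congr' ?_
      filter_upwards [hlim.eventually_lt_const hη] with k hk
      exact (hφ0 k x fun h => hxη (thickening_mono hk.le K h)).symm

/-- A signed measure with density `f` in `Ω` satisfies the corresponding identity on compacts. -/
lemma posPart_sub_negPart_eq_integral {n : ℕ} {Ω K : Set (Rn n)} (hΩ : IsOpen Ω)
    (hK : IsCompact K) (hKΩ : K ⊆ Ω) {μ : SignedMeasure (Rn n)} {f : Rn n → ℝ}
    (hf : ∀ K' : Set (Rn n), IsCompact K' → K' ⊆ Ω → IntegrableOn f K')
    (hd : ∀ φ : Rn n → ℝ, IsTestFun n Ω φ → sintegral n μ φ = ∫ x : Rn n, φ x * f x) :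
    μ.toJordanDecomposition.posPart.real K - μ.toJordanDecomposition.negPart.real K =
      ∫ x in K, f x := by
  obtain ⟨K', φ, hK', hK'Ω, hφ, hφb, hφl⟩ := exists_testFun_tendsto_indicator hΩ hK hKΩ
  have hμ : ∀ ν : Measure (Rn n), IsFiniteMeasure ν →
      Tendsto (fun k => ∫ x, φ k x ∂ν) atTop (𝓝 (ν.real K)) := by
    intro ν hν
    have h1 : ν.real K = ∫ x, K.indicator 1 x ∂ν := (integral_indicator_one hK.measurableSet).symm
    rw [h1]
    refine tendsto_integral_of_dominated_convergence (fun _ => 1)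
      (fun k => (hφ k).1.continuous.aestronglyMeasurable) (integrable_const _)
      (fun k => Eventually.of_forall fun x => ?_) (Eventually.of_forall hφl)
    rw [Real.norm_eq_abs]
    exact (hφb k x).trans (indicator_le_self' (fun _ _ => zero_le_one) x)
  have h2 : Tendsto (fun k => ∫ x, φ k x * f x) atTop (𝓝 (∫ x in K, f x)) := by
    have h1 : ∫ x in K, f x = ∫ x, K.indicator 1 x * f x := by
      rw [← integral_indicator hK.measurableSet]
      congr 1; funext x
      by_cases hx : x ∈ K <;> simp [hx]
    rw [h1]
    have hfi : Integrable (K'.indicator f) :=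
      (integrable_indicator_iff hK'.measurableSet).2 (hf K' hK' hK'Ω)
    have heq : ∀ k, (fun x => φ k x * f x) = fun x => φ k x * K'.indicator f x := by
      intro k
      funext x
      by_cases hx : x ∈ K'
      · simp [hx]
      · have := hφb k x
        simp only [hx, not_false_eq_true, indicator_of_notMem, abs_nonpos_iff] at this
        simp [this]
    refine tendsto_integral_of_dominated_convergence (fun x => ‖K'.indicator f x‖)
      (fun k => ?_) hfi.norm
      (fun k => Eventually.of_forall fun x => ?_)
      (Eventually.of_forall fun x => (hφl x).mul_const _)
    · rw [heq]
      exact (hφ k).1.continuous.aestronglyMeasurable.mul hfi.aestronglyMeasurable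
    · have := congrFun (heq k) x
      beta_reduce at this
      rw [this, norm_mul]
      refine mul_le_of_le_one_left (norm_nonneg _) ?_
      rw [Real.norm_eq_abs]
      exact (hφb k x).trans (indicator_le_self' (fun _ _ => zero_le_one) x)
  have h3 := (hμ μ.toJordanDecomposition.posPart inferInstance).sub
    (hμ μ.toJordanDecomposition.negPart inferInstance)
  refine tendsto_nhds_unique h3 (h2.congr fun k => ?_)
  exact (hd _ (hφ k)).symm

/-- Total variation of a signed measure with density `f` in `Ω`. -/
lemma totalVariation_le_lintegral {n : ℕ} {Ω B : Set (Rn n)} (hΩ : IsOpen Ω)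
    (hB : IsCompact B) (hBΩ : B ⊆ Ω) {μ : SignedMeasure (Rn n)} {f : Rn n → ℝ}
    (hf : ∀ K' : Set (Rn n), IsCompact K' → K' ⊆ Ω → IntegrableOn f K')
    (hd : ∀ φ : Rn n → ℝ, IsTestFun n Ω φ → sintegral n μ φ = ∫ x : Rn n, φ x * f x) :
    μ.totalVariation B ≤ ∫⁻ x in B, ENNReal.ofReal |f x| := by
  set P := μ.toJordanDecomposition.posPart with hP
  set N := μ.toJordanDecomposition.negPart with hN
  have hfB := hf B hB hBΩ
  have hfin : ∫⁻ x in B, ENNReal.ofReal |f x| ≠ ⊤ := by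
    have := hfB.hasFiniteIntegral
    rw [hasFiniteIntegral_iff_norm] at this
    exact this.ne
  have hfp : ∫⁻ x in B, ENNReal.ofReal (f x) ≠ ⊤ :=
    ((lintegral_mono fun x => ENNReal.ofReal_le_ofReal (le_abs_self (f x))).trans_lt
      hfin.lt_top).ne
  have hfn : ∫⁻ x in B, ENNReal.ofReal (-f x) ≠ ⊤ :=
    ((lintegral_mono fun x => ENNReal.ofReal_le_ofReal (neg_le_abs (f x))).trans_lt
      hfin.lt_top).ne
  set α : Measure (Rn n) := P.restrict B +
    (volume.restrict B).withDensity fun x => ENNReal.ofReal (-f x) with hα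
  set β : Measure (Rn n) := N.restrict B +
    (volume.restrict B).withDensity fun x => ENNReal.ofReal (f x) with hβ
  have hfα : IsFiniteMeasure ((volume.restrict B).withDensity fun x => ENNReal.ofReal (-f x)) :=
    isFiniteMeasure_withDensity hfn
  have hfβ : IsFiniteMeasure ((volume.restrict B).withDensity fun x => ENNReal.ofReal (f x)) :=
    isFiniteMeasure_withDensity hfp
  have hclosed : ∀ F : Set (Rn n), IsClosed F → α F = β F := by
    intro F hF
    have hFB : IsCompact (F ∩ B) := hB.inter_left hF
    have h1 := posPart_sub_negPart_eq_integral hΩ hFB (inter_subset_right.trans hBΩ) hf hd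
    have hfF : IntegrableOn f (F ∩ B) := hfB.mono_set inter_subset_right
    rw [integral_eq_lintegral_pos_part_sub_lintegral_neg_part hfF] at h1
    have e1 : α F = P (F ∩ B) + ∫⁻ x in F ∩ B, ENNReal.ofReal (-f x) := by
      rw [hα, Measure.add_apply, Measure.restrict_apply hF.measurableSet,
        withDensity_apply _ hF.measurableSet, Measure.restrict_restrict hF.measurableSet]
    have e2 : β F = N (F ∩ B) + ∫⁻ x in F ∩ B, ENNReal.ofReal (f x) := by
      rw [hβ, Measure.add_apply, Measure.restrict_apply hF.measurableSet,
        withDensity_apply _ hF.measurableSet, Measure.restrict_restrict hF.measurableSet]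
    have t1 : ∫⁻ x in F ∩ B, ENNReal.ofReal (-f x) ≠ ⊤ :=
      ((lintegral_mono_set inter_subset_right).trans_lt hfn.lt_top).ne
    have t2 : ∫⁻ x in F ∩ B, ENNReal.ofReal (f x) ≠ ⊤ :=
      ((lintegral_mono_set inter_subset_right).trans_lt hfp.lt_top).ne
    rw [e1, e2, ← ENNReal.toReal_eq_toReal_iff' (by finiteness) (by finiteness),
      ENNReal.toReal_add (by finiteness) t1, ENNReal.toReal_add (by finiteness) t2]
    simp only [Measure.real] at h1
    linarith
  have hαβ : α = β := by
    refine ext_of_generate_finite {s | IsClosed s} ?_ isPiSystem_isClosed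
      (fun F hF => hclosed F hF) (hclosed univ isClosed_univ)
    rw [← borel_eq_generateFrom_isClosed]
    exact BorelSpace.measurable_eq
  obtain ⟨S, hS, hPS, hNS⟩ := μ.toJordanDecomposition.mutuallySingular
  have hBm := hB.measurableSet
  have b1 : P B ≤ ∫⁻ x in Sᶜ ∩ B, ENNReal.ofReal (f x) := by
    calc P B ≤ P (S ∪ Sᶜ ∩ B) := by
          apply measure_mono
          intro x hx
          by_cases h : x ∈ S
          · exact Or.inl h
          · exact Or.inr ⟨h, hx⟩
      _ ≤ P S + P (Sᶜ ∩ B) := measure_union_le _ _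
      _ = P (Sᶜ ∩ B) := by rw [hPS, zero_add]
      _ = P.restrict B Sᶜ := (Measure.restrict_apply hS.compl).symm
      _ ≤ α Sᶜ := by rw [hα, Measure.add_apply]; exact le_self_add
      _ = N (Sᶜ ∩ B) + ∫⁻ x in Sᶜ ∩ B, ENNReal.ofReal (f x) := by
          rw [hαβ, hβ, Measure.add_apply, Measure.restrict_apply hS.compl,
            withDensity_apply _ hS.compl, Measure.restrict_restrict hS.compl]
      _ = _ := by rw [measure_mono_null inter_subset_left hNS, zero_add]
  have b2 : N B ≤ ∫⁻ x in S ∩ B, ENNReal.ofReal (-f x) := by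
    calc N B ≤ N (Sᶜ ∪ S ∩ B) := by
          apply measure_mono
          intro x hx
          by_cases h : x ∈ S
          · exact Or.inr ⟨h, hx⟩
          · exact Or.inl h
      _ ≤ N Sᶜ + N (S ∩ B) := measure_union_le _ _
      _ = N (S ∩ B) := by rw [hNS, zero_add]
      _ = N.restrict B S := (Measure.restrict_apply hS).symm
      _ ≤ β S := by rw [hβ, Measure.add_apply]; exact le_self_add
      _ = P (S ∩ B) + ∫⁻ x in S ∩ B, ENNReal.ofReal (-f x) := by
          rw [← hαβ, hα, Measure.add_apply, Measure.restrict_apply hS,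
            withDensity_apply _ hS, Measure.restrict_restrict hS]
      _ = _ := by rw [measure_mono_null inter_subset_left hPS, zero_add]
  calc μ.totalVariation B = P B + N B := by
        rw [SignedMeasure.totalVariation, Measure.add_apply]
    _ ≤ (∫⁻ x in Sᶜ ∩ B, ENNReal.ofReal |f x|) + ∫⁻ x in S ∩ B, ENNReal.ofReal |f x| := by
        refine add_le_add (b1.trans (lintegral_mono fun x => ?_))
          (b2.trans (lintegral_mono fun x => ?_))
        · exact ENNReal.ofReal_le_ofReal (le_abs_self _)
        · exact ENNReal.ofReal_le_ofReal (neg_le_abs _)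
    _ = ∫⁻ x in B, ENNReal.ofReal |f x| := by
        rw [inter_comm, inter_comm S, ← sdiff_eq]
        rw [add_comm, lintegral_inter_add_sdiff _ _ hS]

lemma ae_tendsto_lintegral_sub_div {n : ℕ} (hn : 2 ≤ n) {u : Rn n → ℝ} {V : Set (Rn n)}
    (hV : IsOpen V) (hu : IntegrableOn u V) :
    ∀ᵐ x : Rn n, x ∈ V → Tendsto (fun ρ => (∫⁻ y in ball x ρ, ENNReal.ofReal |u y - u x|) /
      volume (ball x ρ)) (𝓝[>] 0) (𝓝 0) := by
  have : Nonempty (Fin n) := ⟨⟨0, by omega⟩⟩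
  have : Nontrivial (Rn n) := inferInstance
  have hw : LocallyIntegrable (V.indicator u) (volume : Measure (Rn n)) :=
    ((integrable_indicator_iff hV.measurableSet).2 hu).locallyIntegrable
  filter_upwards [(Besicovitch.vitaliFamily (volume : Measure (Rn n))).ae_tendsto_lintegral_enorm_sub_div
    hw] with x hx hxV
  have h1 := hx.comp (Besicovitch.tendsto_filterAt volume x)
  obtain ⟨ε, hε, hεV⟩ := Metric.isOpen_iff.1 hV x hxV
  refine tendsto_of_tendsto_of_tendsto_of_le_of_le' tendsto_const_nhds h1
    (Eventually.of_forall fun _ => zero_le) ?_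
  have hmem : Ioo (0 : ℝ) ε ∈ 𝓝[>] (0 : ℝ) := Ioo_mem_nhdsGT hε
  filter_upwards [hmem] with ρ hρ
  simp only [Function.comp]
  rw [Measure.addHaar_closedBall_eq_addHaar_ball]
  refine ENNReal.div_le_div_right ?_ _
  calc ∫⁻ y in ball x ρ, ENNReal.ofReal |u y - u x|
      = ∫⁻ y in ball x ρ, ‖V.indicator u y - V.indicator u x‖ₑ := by
        refine setLIntegral_congr_fun measurableSet_ball fun y hy => ?_
        have hy' : y ∈ V := hεV (ball_subset_ball hρ.2.le hy)
        simp only [indicator_of_mem hy', indicator_of_mem hxV]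
        rw [← ofReal_norm, Real.norm_eq_abs]
    _ ≤ _ := lintegral_mono_set ball_subset_closedBall

lemma lintegral_closedBall_le_holder {n : ℕ} (hn : 2 ≤ n) {q : ℝ} (hq : 1 < q) {g : Rn n → ℝ}
    (hg : Measurable g) (hg0 : ∀ x, 0 ≤ g x)
    (hgq : ∫⁻ x, ENNReal.ofReal (g x ^ q) ≠ ⊤) :
    ∃ H : ℝ, 0 ≤ H ∧ ∀ (x : Rn n) (ρ : ℝ), 0 < ρ → ∫⁻ y in closedBall x ρ, ENNReal.ofReal (g y) ≤
      ENNReal.ofReal (H * ρ ^ ((n : ℝ) - n / q)) := by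
  have : Nonempty (Fin n) := ⟨⟨0, by omega⟩⟩
  have : Nontrivial (Rn n) := inferInstance
  have hq0 : 0 < q := by linarith
  set I := ∫⁻ x, ENNReal.ofReal (g x ^ q) with hI
  set ω : ℝ := volume.real (ball (0 : Rn n) 1) with hω
  have hω0 : 0 ≤ ω := measureReal_nonneg
  have hconj : q.HolderConjugate (Real.conjExponent q) := Real.HolderConjugate.conjExponent hq
  set q' := Real.conjExponent q with hq'
  have hq1 : 1 / q' = 1 - 1 / q := by
    have := hconj.inv_add_inv_eq_one
    rw [one_div, one_div]; linarith
  have hq'0 : 0 ≤ 1 / q' := by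
    have := hconj.symm.pos; positivity
  refine ⟨I.toReal ^ (1 / q) * ω ^ (1 / q'), by positivity, fun x ρ hρ => ?_⟩
  calc ∫⁻ y in closedBall x ρ, ENNReal.ofReal (g y)
      = ∫⁻ y in closedBall x ρ, ((fun y => ENNReal.ofReal (g y) : Rn n → ℝ≥0∞) * (fun _ => 1 : Rn n → ℝ≥0∞)) y := by
        simp
    _ ≤ (∫⁻ y in closedBall x ρ, ENNReal.ofReal (g y) ^ q) ^ (1 / q) *
        (∫⁻ y in closedBall x ρ, (1 : ℝ≥0∞) ^ q') ^ (1 / q') :=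
        ENNReal.lintegral_mul_le_Lp_mul_Lq _ hconj hg.ennreal_ofReal.aemeasurable
          aemeasurable_const
    _ ≤ I ^ (1 / q) * (volume (closedBall x ρ)) ^ (1 / q') := by
        refine mul_le_mul' (ENNReal.rpow_le_rpow ?_ (by positivity))
          (ENNReal.rpow_le_rpow ?_ hq'0)
        · refine (setLIntegral_le_lintegral _ _).trans (le_of_eq ?_)
          congr 1; funext y
          rw [ENNReal.ofReal_rpow_of_nonneg (hg0 y) hq0.le]
        · simp
    _ = _ := by
        rw [Measure.addHaar_closedBall volume x hρ.le, finrank_euclideanSpace_fin,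
          ← ofReal_measureReal (μ := volume) (s := ball (0 : Rn n) 1) measure_ball_lt_top.ne, ← hω,
          ← ENNReal.ofReal_toReal hgq, ENNReal.toReal_ofReal ENNReal.toReal_nonneg,
          ← ENNReal.ofReal_mul (by positivity),
          ENNReal.ofReal_rpow_of_nonneg ENNReal.toReal_nonneg (by positivity),
          ENNReal.ofReal_rpow_of_nonneg (by positivity) hq'0,
          ← ENNReal.ofReal_mul (by positivity), Real.mul_rpow (by positivity) hω0]
        congr 1
        have e : ((ρ ^ n : ℝ)) ^ (1 / q') = ρ ^ ((n : ℝ) - n / q) := by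
          rw [← Real.rpow_natCast, ← Real.rpow_mul hρ.le, hq1]
          congr 1; ring
        rw [e]; ring

lemma exists_pos_le_mul_rpow {c₁ c₂ e₁ e₂ a b : ℝ} (hc₁ : 0 < c₁) (hc₂ : 0 < c₂) (he₁ : 0 < e₁)
    (he₂ : 0 < e₂) : ∃ d : ℝ, 0 < d ∧ a ≤ c₁ * d ^ e₁ ∧ b ≤ c₂ * d ^ e₂ := by
  have h1 := (tendsto_rpow_atTop he₁).const_mul_atTop hc₁
  have h2 := (tendsto_rpow_atTop he₂).const_mul_atTop hc₂
  obtain ⟨d, h⟩ := ((eventually_gt_atTop (0 : ℝ)).and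
    ((h1.eventually_ge_atTop a).and (h2.eventually_ge_atTop b))).exists
  exact ⟨d, h.1, h.2.1, h.2.2⟩

/-- The tail around varying centres in a bounded set is controlled by the global tail. -/
lemma lintegral_tail_le_of_bounded {n : ℕ} {e R r : ℝ} (he : 0 ≤ e) (hR : 0 ≤ R) (hr : 0 < r)
    {w : Rn n → ℝ} (hw : ∀ y, 0 ≤ w y) {x₀ : Rn n} (hx₀ : ‖x₀‖ ≤ R) :
    ∫⁻ y in (ball x₀ r)ᶜ, ENNReal.ofReal (w y / ‖y - x₀‖ ^ e) ≤
      ENNReal.ofReal (((1 + R) / r + 1) ^ e) *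
        ∫⁻ y, ENNReal.ofReal (w y / (1 + ‖y‖) ^ e) := by
  rw [← lintegral_const_mul' _ _ ENNReal.ofReal_ne_top]
  refine (setLIntegral_mono' measurableSet_ball.compl fun y hy => ?_).trans
    (setLIntegral_le_lintegral (ball x₀ r)ᶜ _)
  rw [← ENNReal.ofReal_mul (by positivity)]
  apply ENNReal.ofReal_le_ofReal
  have hy' : r ≤ ‖y - x₀‖ := by
    rw [← dist_eq_norm]; simpa using hy
  have h0 : 0 < ‖y - x₀‖ := hr.trans_le hy'
  have h1 : 1 + ‖y‖ ≤ ((1 + R) / r + 1) * ‖y - x₀‖ := by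
    have h2 : ‖y‖ ≤ ‖y - x₀‖ + ‖x₀‖ := by
      simpa using norm_add_le (y - x₀) x₀
    have h3 : 1 + R ≤ (1 + R) / r * ‖y - x₀‖ := by
      rw [div_mul_eq_mul_div, le_div_iff₀ hr]; gcongr
    linarith
  have h4 : (1 + ‖y‖) ^ e ≤ ((1 + R) / r + 1) ^ e * ‖y - x₀‖ ^ e := by
    rw [← Real.mul_rpow (by positivity) (by positivity)]
    gcongr
  have h5 : 0 < ‖y - x₀‖ ^ e := Real.rpow_pos_of_pos h0 _
  have h6 : 0 < (1 + ‖y‖) ^ e := by positivity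
  rw [← mul_div_assoc, div_le_div_iff₀ h5 h6]
  calc _ ≤ w y * (((1 + R) / r + 1) ^ e * ‖y - x₀‖ ^ e) := by gcongr; exact hw y
    _ = _ := by ring

lemma toReal_lintegral_closedBall_eq {n : ℕ} (hn : 2 ≤ n) (g : Rn n → ℝ) (x : Rn n) {r : ℝ}
    (hr : 0 < r) :
    (∫⁻ y in closedBall x r, ENNReal.ofReal (g y)).toReal =
      ballMean n g x r * (volume.real (ball (0 : Rn n) 1) * r ^ (n : ℝ)) := by
  have : Nonempty (Fin n) := ⟨⟨0, by omega⟩⟩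
  have : Nontrivial (Rn n) := inferInstance
  have h1 : (volume (closedBall x r)).toReal = volume.real (ball (0 : Rn n) 1) * r ^ (n : ℝ) := by
    rw [Measure.addHaar_closedBall volume x hr.le, finrank_euclideanSpace_fin, ENNReal.toReal_mul,
      ENNReal.toReal_ofReal (by positivity), Real.rpow_natCast, mul_comm]
    rfl
  have h0 : (volume (closedBall x r)).toReal ≠ 0 :=
    (ENNReal.toReal_pos (measure_closedBall_pos _ _ hr).ne' measure_closedBall_lt_top.ne).ne'
  rw [← h1, ballMean, ENNReal.coe_toNNReal_eq_toReal, ENNReal.toReal_div, div_mul_cancel₀ _ h0]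

lemma integrableOn_of_lintegral_rpow_ne_top {X : Type*} [MeasurableSpace X] {μ : Measure X}
    {u : X → ℝ} {V : Set X} {m : ℝ} (hm : 1 ≤ m) (hu : AEStronglyMeasurable u (μ.restrict V))
    (hV : μ V ≠ ⊤) (h : ∫⁻ x in V, ENNReal.ofReal (|u x| ^ m) ∂μ ≠ ⊤) : IntegrableOn u V μ := by
  refine ⟨hu, ?_⟩
  calc ∫⁻ x in V, ‖u x‖ₑ ∂μ
      ≤ ∫⁻ x in V, (ENNReal.ofReal (|u x| ^ m) + 1) ∂μ := by
        refine lintegral_mono fun x => ?_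
        rw [← ofReal_norm, Real.norm_eq_abs, ← ENNReal.ofReal_one,
          ← ENNReal.ofReal_add (by positivity) zero_le_one]
        apply ENNReal.ofReal_le_ofReal
        rcases le_total (|u x|) 1 with h1 | h1
        · have : 0 ≤ |u x| ^ m := by positivity
          linarith
        · have := Real.rpow_le_rpow_of_exponent_le h1 hm
          rw [Real.rpow_one] at this
          linarith
    _ < ⊤ := by
        rw [lintegral_add_right _ measurable_const, lintegral_const, one_mul,
          Measure.restrict_apply_univ]
        exact ENNReal.add_lt_top.2 ⟨h.lt_top, hV.lt_top⟩

lemma lintegral_iSup_sup_ballMean_lt_top {n : ℕ} (hn : 2 ≤ n) {q : ℝ} (hq : 1 < q)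
    {g : Rn n → ℝ} (hg : Measurable g) (hg0 : ∀ x, 0 ≤ g x)
    (hgq : ∫⁻ x, ENNReal.ofReal (g x ^ q) ≠ ⊤) {r : ℕ → ℝ} (hr : ∀ k, 0 < r k)
    {S : Set (Rn n)} (hS : volume S ≠ ⊤) :
    ∫⁻ x in S, ⨆ N : ℕ, ENNReal.ofReal ((((Finset.range N).sup fun k =>
      ballMean n g x (r k) : ℝ≥0) + 1 : ℝ) ^ q) < ⊤ := by
  obtain ⟨C, hC, hCM⟩ := lintegral_sup_ballMean_le hn hq
  have hmeas : ∀ N : ℕ, Measurable fun x => (Finset.range N).sup fun k =>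
      ballMean n g x (r k) := by
    intro N
    have : ∀ s : Finset ℕ, Measurable fun x => s.sup fun k => ballMean n g x (r k) := by
      intro s
      induction s using Finset.induction_on with
      | empty => simp
      | insert a s _ ih =>
        simp only [Finset.sup_insert]
        exact (measurable_ballMean hg (hr a).le).sup ih
    exact this _
  have hq0 : 0 < q := by linarith
  have hm1 : ∀ N : ℕ, Measurable fun x => ENNReal.ofReal ((((Finset.range N).sup fun k =>
      ballMean n g x (r k) : ℝ≥0) + 1 : ℝ) ^ q) := fun N =>
    (((hmeas N).coe_nnreal_real.add_const 1).pow_const q).ennreal_ofReal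
  rw [lintegral_iSup hm1]
  · refine lt_of_le_of_lt (b := ENNReal.ofReal (2 ^ q) *
      (ENNReal.ofReal C * ∫⁻ x, ENNReal.ofReal (g x ^ q)) + ENNReal.ofReal (2 ^ q) * volume S)
      (iSup_le fun N => ?_) ?_
    · calc _ ≤ ∫⁻ x in S, (ENNReal.ofReal (2 ^ q) * ENNReal.ofReal ((((Finset.range N).sup fun k =>
              ballMean n g x (r k) : ℝ≥0) : ℝ) ^ q) + ENNReal.ofReal (2 ^ q)) := by
            refine lintegral_mono fun x => ?_
            rw [← ENNReal.ofReal_mul (by positivity),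
              ← ENNReal.ofReal_add (by positivity) (by positivity)]
            apply ENNReal.ofReal_le_ofReal
            generalize (Finset.range N).sup (fun k => ballMean n g x (r k)) = t
            have ht : (0 : ℝ) ≤ t := t.2
            rw [← Real.mul_rpow (by positivity) ht]
            rcases le_total (t : ℝ) 1 with h1 | h1
            · have h2 : ((t : ℝ) + 1) ^ q ≤ (2 : ℝ) ^ q := by gcongr; linarith
              have h3 : 0 ≤ (2 * (t : ℝ)) ^ q := by positivity
              linarith
            · have h2 : ((t : ℝ) + 1) ^ q ≤ (2 * (t : ℝ)) ^ q := by gcongr; linarith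
              have h3 : (0 : ℝ) ≤ 2 ^ q := by positivity
              linarith
        _ ≤ _ := by
            rw [lintegral_add_right _ measurable_const, lintegral_const_mul' _ _ ENNReal.ofReal_ne_top,
              lintegral_const, Measure.restrict_apply_univ]
            gcongr
            exact (setLIntegral_le_lintegral _ _).trans (hCM g r N hg hg0 hr)
    · exact ENNReal.add_lt_top.2 ⟨ENNReal.mul_lt_top ENNReal.ofReal_lt_top
        (ENNReal.mul_lt_top ENNReal.ofReal_lt_top hgq.lt_top),
        ENNReal.mul_lt_top ENNReal.ofReal_lt_top hS.lt_top⟩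
  · intro N N' hNN x
    apply ENNReal.ofReal_le_ofReal
    have h1 : (Finset.range N).sup (fun k => ballMean n g x (r k)) ≤
        (Finset.range N').sup (fun k => ballMean n g x (r k)) :=
      Finset.sup_mono (Finset.range_mono hNN)
    have h2 : (((Finset.range N).sup (fun k => ballMean n g x (r k)) : ℝ≥0) : ℝ) ≤
        (((Finset.range N').sup (fun k => ballMean n g x (r k)) : ℝ≥0) : ℝ) :=
      NNReal.coe_le_coe.2 h1
    gcongr

/-- Local integrability of the positive part with the Calderón–Zygmund exponent. -/
lemma ApproxSol.lintegral_posPart_rpow_lt_top {n : ℕ} (hn : 2 ≤ n) {Λ s p τ m q : ℝ} (hs : 0 < s)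
    (hs1 : s < 1) (hΛ : 1 ≤ Λ) (hp : 1 < p) (hτ : 0 < τ) (hτp : τ < p - 1)
    (hm : (1 + τ) * (p - 1) ≤ m) (hmζ : m ≤ p - 1 - τ + m * (s * p / n)) (hm1 : 1 ≤ m)
    (hq : 1 < q) (hspq : s * p * q < n)
    {Ω : Set (Rn n)} {ν : Measure (Rn n)} {u : Rn n → ℝ} {Φ : ℝ → ℝ} {K : Rn n → Rn n → ℝ}
    {uj fj : ℕ → Rn n → ℝ} (h : ApproxSol n Λ s p m Ω ν u Φ K uj fj)
    {g : Rn n → ℝ} (hg : Measurable g) (hg0 : ∀ x, 0 ≤ g x)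
    (hgq : ∫⁻ x, ENNReal.ofReal (g x ^ q) ≠ ⊤)
    {Kc : Set (Rn n)} (hKc : IsCompact Kc) {δ : ℝ} (hδ : 0 < δ) (hΩ : cthickening δ Kc ⊆ Ω)
    (hν : ∀ x ∈ Kc, ∀ r, 0 < r → r ≤ δ →
      ν (closedBall x r) ≤ ∫⁻ y in closedBall x r, ENNReal.ofReal (g y))
    (hu : ∫⁻ x in cthickening δ Kc, ENNReal.ofReal (|u x| ^ m) ≠ ⊤)
    (hT : ∫⁻ y, ENNReal.ofReal (max (u y) 0 ^ (p - 1) / (1 + ‖y‖) ^ ((n : ℝ) + s * p)) ≠ ⊤) :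
    ∫⁻ x in Kc, ENNReal.ofReal (max (u x) 0 ^ ((n : ℝ) * q * (p - 1) / ((n : ℝ) - s * p * q)))
      < ⊤ := by
  have : Nonempty (Fin n) := ⟨⟨0, by omega⟩⟩
  have : Nontrivial (Rn n) := inferInstance
  obtain ⟨σ, κ, A, hσ0, hσ4, hκ0, hA0, hmain⟩ :=
    ApproxSol.le_of_sum_le hn hs hs1 hΛ hp hτ hτp hm hmζ
  obtain ⟨H, hH0, hH⟩ := lintegral_closedBall_le_holder hn hq hg hg0 hgq
  set ω : ℝ := volume.real (ball (0 : Rn n) 1) with hω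
  have hω0 : 0 < ω := ENNReal.toReal_pos (measure_ball_pos _ _ one_pos).ne' measure_ball_lt_top.ne
  have hsp : 0 < s * p := by positivity
  obtain ⟨C, hC, hhed⟩ := hedberg_sum_le (H := H) hσ0 (by linarith : σ < 1) hsp hp hq hspq hκ0 hω0
  have hn0 : (0 : ℝ) < n := by positivity
  have hp1 : 0 < p - 1 := by linarith
  set Q := (n : ℝ) * q * (p - 1) / ((n : ℝ) - s * p * q) with hQ
  have hQ0 : 0 < Q := by
    have : 0 < (n : ℝ) - s * p * q := by linarith
    have : 0 < q := by linarith
    positivity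
  obtain ⟨R, hR0, hR⟩ := hKc.isBounded.exists_pos_norm_le
  set T := ∫⁻ y, ENNReal.ofReal (max (u y) 0 ^ (p - 1) / (1 + ‖y‖) ^ ((n : ℝ) + s * p)) with hTdef
  set I := ∫⁻ x in cthickening δ Kc, ENNReal.ofReal (|u x| ^ m) with hI
  set c := ((1 + R) / δ + 1) ^ ((n : ℝ) + s * p) with hc
  have hc0 : 0 < c := by positivity
  obtain ⟨d, hd0, hd1, hd2⟩ := exists_pos_le_mul_rpow (c₁ := κ * δ ^ (n : ℝ))
    (c₂ := A * δ ^ (-(s * p))) (e₁ := m) (e₂ := p - 1) (a := I.toReal) (b := c * T.toReal)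
    (by positivity) (by positivity) (by linarith) hp1
  set Z : Rn n → ℝ≥0∞ := fun x => ⨆ N : ℕ, ENNReal.ofReal ((((Finset.range N).sup fun k =>
      ballMean n g x (σ ^ k * δ) : ℝ≥0) + 1 : ℝ) ^ q) with hZ
  have hKfin : volume Kc ≠ ⊤ := hKc.measure_lt_top.ne
  have hZint : ∫⁻ x in Kc, Z x < ⊤ :=
    lintegral_iSup_sup_ballMean_lt_top hn hq hg hg0 hgq (r := fun k => σ ^ k * δ)
      (fun k => by positivity) hKfin
  have hI1 : IntegrableOn u (cthickening δ Kc) := integrableOn_of_lintegral_rpow_ne_top hm1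
    h.measurable_limit.aestronglyMeasurable hKc.cthickening.measure_lt_top.ne hu
  have hleb := ae_tendsto_lintegral_sub_div hn isOpen_thickening
    (hI1.mono_set (thickening_subset_cthickening δ Kc))
  have hpt : ∀ x ∈ Kc, Tendsto (fun ρ => (∫⁻ y in ball x ρ, ENNReal.ofReal |u y - u x|) /
      volume (ball x ρ)) (𝓝[>] 0) (𝓝 0) →
      ENNReal.ofReal (max (u x) 0 ^ Q) ≤
        ENNReal.ofReal ((4 * d) ^ Q) + ENNReal.ofReal (4 ^ Q * (C + 1)) * Z x := by
    intro x hx hLx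
    rcases eq_or_ne (Z x) ⊤ with hZx | hZx
    · rw [hZx, ENNReal.mul_top (by simpa using by positivity)]
      simp
    have hrk : ∀ k : ℕ, 0 < σ ^ k * δ := fun k => by positivity
    have hrk' : ∀ k : ℕ, σ ^ k * δ ≤ δ := fun k =>
      mul_le_of_le_one_left hδ.le (pow_le_one₀ hσ0.le (by linarith))
    set b : ℕ → ℝ := fun k => (∫⁻ y in closedBall x (σ ^ k * δ), ENNReal.ofReal (g y)).toReal
      with hb
    have hbtop : ∀ k : ℕ, ∫⁻ y in closedBall x (σ ^ k * δ), ENNReal.ofReal (g y) ≠ ⊤ := fun k =>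
      ((hH x _ (hrk k)).trans_lt ENNReal.ofReal_lt_top).ne
    have hb0 : ∀ k, 0 ≤ b k := fun k => ENNReal.toReal_nonneg
    set M : ℕ → ℝ := fun k => (b k * (σ ^ k * δ) ^ (s * p - n) / κ) ^ (1 / (p - 1)) with hM
    have hMsum : ∀ N, ∑ k ∈ Finset.range N, M k ≤ (C * (Z x).toReal) ^ (1 / Q) := by
      intro N
      set t : ℝ≥0 := (Finset.range N).sup fun k => ballMean n g x (σ ^ k * δ) with ht
      have h1 := hhed δ (t + 1) b N hδ (by positivity) hb0 (fun k hk => by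
        rw [hb]; dsimp only
        rw [toReal_lintegral_closedBall_eq hn g x (hrk k)]
        have h2 : ballMean n g x (σ ^ k * δ) ≤ t :=
          Finset.le_sup (f := fun k => ballMean n g x (σ ^ k * δ)) (Finset.mem_range.2 hk)
        have h3 : (ballMean n g x (σ ^ k * δ) : ℝ) ≤ t := NNReal.coe_le_coe.2 h2
        have h4 : 0 ≤ ω * (σ ^ k * δ) ^ (n : ℝ) := by
          have := hrk k; positivity
        exact mul_le_mul_of_nonneg_right (by linarith) h4) (fun k _ => by
          have h5 := hH x _ (hrk k)
          rw [← ENNReal.ofReal_toReal (hbtop k)] at h5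
          have h6 := hrk k
          exact (ENNReal.ofReal_le_ofReal_iff (by positivity)).1 h5)
      have hsum0 : 0 ≤ ∑ k ∈ Finset.range N, M k := Finset.sum_nonneg fun k _ => by
        have := hrk k; have := hb0 k; positivity
      have h2 : ((t : ℝ) + 1) ^ q ≤ (Z x).toReal := by
        have h3 : ENNReal.ofReal (((t : ℝ) + 1) ^ q) ≤ Z x :=
          le_iSup (fun N : ℕ => ENNReal.ofReal ((((Finset.range N).sup fun k =>
            ballMean n g x (σ ^ k * δ) : ℝ≥0) + 1 : ℝ) ^ q)) N
        have h4 := ENNReal.toReal_mono hZx h3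
        rwa [ENNReal.toReal_ofReal (by positivity)] at h4
      have h3 : (∑ k ∈ Finset.range N, M k) ^ Q ≤ C * (Z x).toReal :=
        h1.trans (mul_le_mul_of_nonneg_left h2 hC)
      calc ∑ k ∈ Finset.range N, M k = ((∑ k ∈ Finset.range N, M k) ^ Q) ^ (1 / Q) := by
            rw [← Real.rpow_mul hsum0, mul_one_div_cancel hQ0.ne', Real.rpow_one]
        _ ≤ _ := by
            have : 0 ≤ (∑ k ∈ Finset.range N, M k) ^ Q := by positivity
            gcongr
    set S : ℝ := (C * (Z x).toReal) ^ (1 / Q) with hS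
    have hS0 : 0 ≤ S := by positivity
    have hball : closedBall x δ ⊆ cthickening δ Kc := closedBall_subset_cthickening hx δ
    have hux := hmain Ω ν u Φ K uj fj h x δ d S M hδ (hball.trans hΩ) hd0
      (fun k => by have := hrk k; have := hb0 k; positivity)
      (fun k => by
        refine (hν x hx _ (hrk k) (hrk' k)).trans ?_
        rw [← ENNReal.ofReal_toReal (hbtop k)]
        apply ENNReal.ofReal_le_ofReal
        apply le_of_eq
        change b k = κ * M k ^ (p - 1) * (σ ^ k * δ) ^ ((n : ℝ) - s * p)
        have h0 := hrk k
        have h1 := hb0 k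
        rw [hM]; dsimp only
        rw [← Real.rpow_mul (by positivity), one_div_mul_cancel hp1.ne', Real.rpow_one,
          mul_div_cancel₀ _ hκ0.ne', mul_assoc, ← Real.rpow_add h0]
        simp)
      hMsum
      (by
        calc ∫⁻ x in ball x δ, ENNReal.ofReal (max (u x) 0 ^ m)
            ≤ ∫⁻ x in ball x δ, ENNReal.ofReal (|u x| ^ m) := by
              refine lintegral_mono fun y => ENNReal.ofReal_le_ofReal ?_
              have h1 : 0 ≤ max (u y) 0 := le_max_right _ _
              have h2 : max (u y) 0 ≤ |u y| := max_le (le_abs_self _) (abs_nonneg _)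
              exact Real.rpow_le_rpow h1 h2 (by linarith)
          _ ≤ I := lintegral_mono_set (ball_subset_closedBall.trans hball)
          _ = ENNReal.ofReal I.toReal := (ENNReal.ofReal_toReal hu).symm
          _ ≤ _ := ENNReal.ofReal_le_ofReal (hd1.trans (le_of_eq (by ring))))
      (by
        refine (lintegral_tail_le_of_bounded (by positivity) hR0.le hδ
          (fun y => by have := le_max_right (u y) 0; positivity) (hR x hx)).trans ?_
        rw [← hTdef, ← ENNReal.ofReal_toReal hT, ← ENNReal.ofReal_mul hc0.le]
        exact ENNReal.ofReal_le_ofReal (hd2.trans (le_of_eq (by ring))))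
      hLx
    rw [← ENNReal.ofReal_toReal hZx, ← ENNReal.ofReal_mul (by positivity),
      ← ENNReal.ofReal_add (by positivity) (by positivity)]
    apply ENNReal.ofReal_le_ofReal
    have hSQ : (4 * S) ^ Q = 4 ^ Q * (C * (Z x).toReal) := by
      rw [Real.mul_rpow (by norm_num) hS0, hS, ← Real.rpow_mul (by positivity),
        one_div_mul_cancel hQ0.ne', Real.rpow_one]
    have hZ0 : 0 ≤ (4 : ℝ) ^ Q * (Z x).toReal := by positivity
    have hm0 : max (u x) 0 ≤ 2 * d + 2 * S := max_le hux (by positivity)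
    have hm00 : 0 ≤ max (u x) 0 := le_max_right _ _
    have hd00 : 0 ≤ (4 * d) ^ Q := by positivity
    have hS00 : 0 ≤ (4 * S) ^ Q := by positivity
    have h7 : max (u x) 0 ^ Q ≤ (4 * d) ^ Q + (4 * S) ^ Q := by
      rcases le_total S d with h8 | h8
      · have := Real.rpow_le_rpow hm00 (hm0.trans (by linarith : _ ≤ 4 * d)) hQ0.le
        linarith
      · have := Real.rpow_le_rpow hm00 (hm0.trans (by linarith : _ ≤ 4 * S)) hQ0.le
        linarith
    rw [hSQ] at h7
    linarith
  calc _ ≤ ∫⁻ x in Kc, (ENNReal.ofReal ((4 * d) ^ Q) +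
        ENNReal.ofReal (4 ^ Q * (C + 1)) * Z x) := by
        refine setLIntegral_mono_ae' hKc.measurableSet ?_
        filter_upwards [hleb] with x hx hxK
        exact hpt x hxK (hx (self_subset_thickening hδ Kc hxK))
    _ < ⊤ := by
        rw [lintegral_add_left measurable_const, lintegral_const_mul' _ _ ENNReal.ofReal_ne_top,
          lintegral_const, Measure.restrict_apply_univ]
        exact ENNReal.add_lt_top.2 ⟨ENNReal.mul_lt_top ENNReal.ofReal_lt_top hKfin.lt_top,
          ENNReal.mul_lt_top ENNReal.ofReal_lt_top hZint⟩

lemma exists_energy_exponents {n : ℕ} {s p : ℝ} (hn : 2 ≤ n) (hs : 0 < s) (hs1 : s < 1)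
    (hp : 2 - s / (n : ℝ) < p) :
    ∃ m τ : ℝ, qStar p ≤ m ∧ m < qBar n s p ∧ p - 1 < m ∧ 0 < τ ∧ τ < p - 1 ∧
      (1 + τ) * (p - 1) ≤ m ∧ m ≤ p - 1 - τ + m * (s * p / n) := by
  have hn2 : (2 : ℝ) ≤ n := by exact_mod_cast hn
  have hn0 : (0 : ℝ) < n := by linarith
  have hsn : s / n < 1 := (div_lt_one hn0).2 (by linarith)
  have hp1 : 0 < p - 1 := by linarith
  have hns : 0 < (n : ℝ) - s := by linarith
  have h1 : 1 < (n : ℝ) * (p - 1) / (n - s) := by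
    rw [lt_div_iff₀ hns]
    have : (n : ℝ) * (2 - s / n) < n * p := by gcongr
    have e : (n : ℝ) * (2 - s / n) = 2 * n - s := by field_simp
    linarith
  have h2 : p - 1 < (n : ℝ) * (p - 1) / (n - s) := by
    rw [lt_div_iff₀ hns]; nlinarith
  have hlt : qStar p < qBar n s p := by
    unfold qStar qBar
    exact lt_min (max_lt h1 h2) (max_lt (by linarith) (by linarith))
  obtain ⟨m, hm1, hm2⟩ := exists_between hlt
  have hpm : p - 1 < m := (le_max_right _ _).trans_lt hm1
  have hmn : m * (n - s) < n * (p - 1) := by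
    have := hm2.trans_le (min_le_left _ _)
    rwa [lt_div_iff₀ hns] at this
  have hgap : 0 < p - 1 - m + m * (s * p / n) := by
    have h3 : m * (n - s * p) < n * (p - 1) := by
      have h4 : m * (n - s * p) ≤ m * (n - s) := by
        have : s ≤ s * p := by nlinarith
        have : 0 < m := by linarith
        gcongr
      linarith
    have e : (n : ℝ) * (p - 1 - m + m * (s * p / n)) = n * (p - 1) - m * (n - s * p) := by
      field_simp; ring
    have h5 : 0 < (n : ℝ) * (p - 1 - m + m * (s * p / n)) := by rw [e]; linarith
    exact (mul_pos_iff_of_pos_left hn0).1 h5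
  have hgap' : 0 < m / (p - 1) - 1 := by
    rw [sub_pos, lt_div_iff₀ hp1]; linarith
  refine ⟨m, min ((p - 1) / 2) (min (m / (p - 1) - 1) (p - 1 - m + m * (s * p / n))),
    hm1.le, hm2, hpm, lt_min (by linarith) (lt_min hgap' hgap),
    (min_le_left _ _).trans_lt (by linarith), ?_, ?_⟩
  · have h6 : min ((p - 1) / 2) (min (m / (p - 1) - 1) (p - 1 - m + m * (s * p / n))) ≤
        m / (p - 1) - 1 := (min_le_right _ _).trans (min_le_left _ _)
    calc _ ≤ (1 + (m / (p - 1) - 1)) * (p - 1) := by gcongr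
      _ = m := by field_simp; ring
  · have h6 : min ((p - 1) / 2) (min (m / (p - 1) - 1) (p - 1 - m + m * (s * p / n))) ≤
        p - 1 - m + m * (s * p / n) := (min_le_right _ _).trans (min_le_right _ _)
    linarith

lemma tendsto_lintegral_rpow_of_lt {X : Type*} [MeasurableSpace X] {μ : Measure X} {V : Set X}
    (hV : μ V ≠ ⊤) {a m : ℝ} (ha : 0 < a) (ham : a < m) {w : ℕ → X → ℝ}
    (hw : ∀ j, Measurable (w j))
    (h : Tendsto (fun j => ∫⁻ x in V, ENNReal.ofReal (|w j x| ^ m) ∂μ) atTop (𝓝 0)) :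
    Tendsto (fun j => ∫⁻ x in V, ENNReal.ofReal (|w j x| ^ a) ∂μ) atTop (𝓝 0) := by
  have h1 : 1 < m / a := (one_lt_div ha).2 ham
  have hconj := Real.HolderConjugate.conjExponent h1
  set c := (m / a).conjExponent with hc
  have hc0 : 0 ≤ 1 / c := by have := hconj.symm.pos; positivity
  have h2 : Tendsto (fun j => (∫⁻ x in V, ENNReal.ofReal (|w j x| ^ m) ∂μ) ^ (1 / (m / a)) *
      (μ V) ^ (1 / c)) atTop (𝓝 0) := by
    have h3 := ENNReal.Tendsto.mul_const (h.ennrpow_const (1 / (m / a)))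
      (Or.inr (ENNReal.rpow_ne_top_of_nonneg hc0 hV))
    rwa [ENNReal.zero_rpow_of_pos (by positivity), zero_mul] at h3
  refine tendsto_of_tendsto_of_tendsto_of_le_of_le tendsto_const_nhds h2 (fun _ => zero_le)
    fun j => ?_
  dsimp only
  calc ∫⁻ x in V, ENNReal.ofReal (|w j x| ^ a) ∂μ
      = ∫⁻ x in V, ((fun x => ENNReal.ofReal (|w j x| ^ a) : X → ℝ≥0∞) *
          (fun _ => 1 : X → ℝ≥0∞)) x ∂μ := by simp
    _ ≤ (∫⁻ x in V, ENNReal.ofReal (|w j x| ^ a) ^ (m / a) ∂μ) ^ (1 / (m / a)) *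
        (∫⁻ x in V, (1 : ℝ≥0∞) ^ c ∂μ) ^ (1 / c) :=
        ENNReal.lintegral_mul_le_Lp_mul_Lq _ hconj
          (((hw j).abs.pow_const a).ennreal_ofReal.aemeasurable) aemeasurable_const
    _ = _ := by
        have e : ∀ x, ENNReal.ofReal (|w j x| ^ a) ^ (m / a) = ENNReal.ofReal (|w j x| ^ m) := by
          intro x
          rw [ENNReal.ofReal_rpow_of_nonneg (by positivity) (by positivity),
            ← Real.rpow_mul (abs_nonneg _), mul_div_cancel₀ _ ha.ne']
        simp [e]

lemma tendsto_lintegral_of_tendsto_tailFn {n : ℕ} {s p : ℝ} (hp : 1 < p) {w : ℕ → Rn n → ℝ}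
    {z : Rn n} {r : ℝ} (hr : 0 < r)
    (h : Tendsto (fun j => tailFn n s p (w j) z r) atTop (𝓝 0)) :
    Tendsto (fun j => ∫⁻ x in (ball z r)ᶜ, ENNReal.ofReal (|w j x| ^ (p - 1) /
      ‖x - z‖ ^ ((n : ℝ) + s * p))) atTop (𝓝 0) := by
  have hp1 : 0 < p - 1 := by linarith
  have h1 := ENNReal.Tendsto.const_mul (a := (ENNReal.ofReal (r ^ (s * p)))⁻¹)
    (h.ennrpow_const (p - 1)) (Or.inr (by simpa using by positivity))
  rw [ENNReal.zero_rpow_of_pos hp1, mul_zero] at h1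
  refine h1.congr fun j => ?_
  rw [tailFn, ← ENNReal.rpow_mul, one_div_mul_cancel hp1.ne', ENNReal.rpow_one, ← mul_assoc,
    ENNReal.inv_mul_cancel (by simpa using by positivity) ENNReal.ofReal_ne_top, one_mul]

lemma gagliardo_congr_ae {n : ℕ} {s p : ℝ} {v w : Rn n → ℝ} (h : v =ᵐ[volume] w) :
    gagliardo n s p univ v = gagliardo n s p univ w := by
  unfold gagliardo
  simp only [Measure.restrict_univ]
  refine lintegral_congr_ae ?_
  filter_upwards [h] with x hx
  refine lintegral_congr_ae ?_
  filter_upwards [h] with y hy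
  rw [hx, hy]

lemma nonlocalForm_congr_ae {n : ℕ} {Φ : ℝ → ℝ} {K : Rn n → Rn n → ℝ} {v w φ : Rn n → ℝ}
    (h : v =ᵐ[volume] w) : nonlocalForm n Φ K v φ = nonlocalForm n Φ K w φ := by
  unfold nonlocalForm
  refine integral_congr_ae ?_
  filter_upwards [h] with x hx
  refine integral_congr_ae ?_
  filter_upwards [h] with y hy
  rw [hx, hy]

lemma ApproxSol.neg {n : ℕ} {Λ s p m : ℝ} {Ω : Set (Rn n)} {ν : Measure (Rn n)} {u : Rn n → ℝ}
    {Φ : ℝ → ℝ} {K : Rn n → Rn n → ℝ} {uj fj : ℕ → Rn n → ℝ}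
    (h : ApproxSol n Λ s p m Ω ν u Φ K uj fj) :
    ApproxSol n Λ s p m Ω ν (fun x => -u x) (fun t => -Φ (-t)) K (fun j x => -uj j x)
      (fun j x => -fj j x) where
  phi := h.phi.neg_comp_neg
  kernel := h.kernel
  isOpen := h.isOpen
  measurable_limit := h.measurable_limit.neg
  measurable j := (h.measurable j).neg
  gagliardo_lt_top j := by
    have := h.gagliardo_lt_top j
    unfold gagliardo at this ⊢
    simpa only [← neg_sub', abs_neg] using this
  continuous j := (h.continuous j).neg
  hasCompactSupport j := (h.hasCompactSupport j).neg
  weak j ψ hψ := by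
    have := h.weak j ψ hψ
    unfold nonlocalForm at this ⊢
    simp only [mul_neg, integral_neg, ← this]
    rw [← integral_neg]
    congr 1; funext x
    rw [← integral_neg]
    congr 1; funext y
    rw [show -(-uj j x - -uj j y) = uj j x - uj j y by ring]
    ring
  ae_tendsto := by
    filter_upwards [h.ae_tendsto] with x hx using hx.neg
  tendsto_ball z r hr := by
    simpa only [← neg_sub', abs_neg] using h.tendsto_ball z r hr
  tendsto_tail z r hr := by
    simpa only [← neg_sub', abs_neg] using h.tendsto_tail z r hr
  limsup_le z r hr := by
    simpa only [abs_neg] using h.limsup_le z r hr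

lemma IsSOLA.exists_approxSol {n : ℕ} {s p Λ m : ℝ} {Φ : ℝ → ℝ} {K : Rn n → Rn n → ℝ}
    {Ω : Set (Rn n)} {μ : SignedMeasure (Rn n)} {g u : Rn n → ℝ} (hs : 0 < s) (hp : 1 < p)
    (hm1 : qStar p ≤ m) (hm2 : m < qBar n s p) (hpm : p - 1 < m)
    (hK : KernelBounds n Λ s p K) (hΦ : PhiBounds Λ p Φ) (hΩo : IsOpen Ω)
    (hΩb : Bornology.IsBounded Ω) (hu : IsSOLA n Φ K s p Ω μ g u) :
    ∃ (v : Rn n → ℝ) (vj fj : ℕ → Rn n → ℝ), u =ᵐ[volume] v ∧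
      ApproxSol n Λ s p m Ω μ.totalVariation v Φ K vj fj := by
  obtain ⟨-, -, hug, uj, μj, gj, hμj, -, hws, hae, hball, -, hlim, hgj⟩ := hu
  have hp1 : 0 < p - 1 := by linarith
  have huj : ∀ j, AEMeasurable (uj j) volume := fun j => by
    simpa only [Measure.restrict_univ] using (hws j).1.1
  have hum : AEMeasurable u volume := aemeasurable_of_tendsto_metrizable_ae atTop huj hae
  have hvm := hum.measurable_mk
  have hvjm := fun j => (huj j).measurable_mk
  have hv := hum.ae_eq_mk
  have hvj := fun j => (huj j).ae_eq_mk
  set v := hum.mk u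
  set vj : ℕ → Rn n → ℝ := fun j => (huj j).mk (uj j)
  have hball' : ∀ z : Rn n, ∀ r : ℝ, 0 < r →
      Tendsto (fun j => ∫⁻ x in ball z r, ENNReal.ofReal (|vj j x - v x| ^ m)) atTop (𝓝 0) := by
    intro z r hr
    refine (hball m hm1 hm2 z r hr).congr fun j => ?_
    refine setLIntegral_congr_fun_ae measurableSet_ball ?_
    filter_upwards [hv, hvj j] with x h1 h2 _
    rw [h1, h2]
  refine ⟨v, vj, μj, hv, ⟨hΦ, hK, hΩo, hvm, hvjm, fun j => ?_, fun j => (hμj j).1.continuous,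
    fun j => (hμj j).2, fun j ψ hψ => ?_, ?_, hball', fun z r hr => ?_, hlim⟩⟩
  · rw [← gagliardo_congr_ae (hvj j)]
    exact (hws j).1.2.2
  · rw [← nonlocalForm_congr_ae (hvj j)]
    exact (hws j).2.2 ψ hψ
  · filter_upwards [hae, hv, ae_all_iff.2 hvj] with x h1 h2 h3
    rw [← h2]
    exact h1.congr h3
  · obtain ⟨R, hrR, hR⟩ : ∃ R, r ≤ R ∧ Ω ⊆ ball z R := by
      obtain ⟨R, hR⟩ := hΩb.subset_ball z
      exact ⟨max r R, le_max_left _ _, hR.trans (ball_subset_ball (le_max_right _ _))⟩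
    have hR0 : 0 < R := hr.trans_le hrR
    have h1 := tendsto_lintegral_of_tendsto_tailFn hp hR0 (hgj z R hR0).2
    have h2 := tendsto_lintegral_rpow_of_lt (measure_ball_lt_top (x := z) (r := R)).ne hp1 hpm
      (fun j => (hvjm j).sub hvm) (hball' z R hR0)
    have h3 := ENNReal.Tendsto.const_mul (a := ENNReal.ofReal (1 / r ^ ((n : ℝ) + s * p))) h2
      (Or.inr ENNReal.ofReal_ne_top)
    have h4 := h1.add h3
    rw [mul_zero, add_zero] at h4
    refine tendsto_of_tendsto_of_tendsto_of_le_of_le tendsto_const_nhds h4 (fun _ => zero_le)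
      fun j => ?_
    dsimp only
    have hsub : (ball z r)ᶜ ⊆ (ball z R)ᶜ ∪ (ball z R ∩ (ball z r)ᶜ) := by
      intro x hx
      by_cases hxR : x ∈ ball z R
      · exact Or.inr ⟨hxR, hx⟩
      · exact Or.inl hxR
    refine (lintegral_mono_set hsub).trans ((lintegral_union_le _ _ _).trans (add_le_add ?_ ?_))
    · refine le_of_eq (setLIntegral_congr_fun_ae measurableSet_ball.compl ?_)
      filter_upwards [hv, hvj j, hug, (hws j).2.1] with x e1 e2 e3 e4 hx
      have hxΩ : x ∉ Ω := fun hx' => hx (hR hx')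
      rw [← e1, ← show uj j x = vj j x from e2, e3 hxΩ, e4 hxΩ]
    · rw [← lintegral_const_mul' _ _ ENNReal.ofReal_ne_top]
      refine (setLIntegral_mono' (measurableSet_ball.inter measurableSet_ball.compl)
        fun x hx => ?_).trans (lintegral_mono_set inter_subset_left)
      rw [← ENNReal.ofReal_mul (by positivity)]
      apply ENNReal.ofReal_le_ofReal
      have hx' : r ≤ ‖x - z‖ := by
        rw [← dist_eq_norm]; simpa using hx.2
      rw [one_div_mul_eq_div]
      change |vj j x - v x| ^ (p - 1) / _ ≤ |vj j x - v x| ^ (p - 1) / _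
      gcongr

lemma lintegral_rpow_div_lt_top {n : ℕ} {s p m : ℝ} (hs : 0 < s) (hp : 1 < p) (hpm : p - 1 ≤ m)
    {Ω : Set (Rn n)} (hΩo : IsOpen Ω) (hΩb : Bornology.IsBounded Ω) {g u : Rn n → ℝ}
    (hg : memTailSpace n s p g) (hug : ∀ᵐ x : Rn n, x ∉ Ω → u x = g x)
    (hum : ∫⁻ x in Ω, ENNReal.ofReal (|u x| ^ m) < ⊤) :
    ∫⁻ y, ENNReal.ofReal (|u y| ^ (p - 1) / (1 + ‖y‖) ^ ((n : ℝ) + s * p)) < ⊤ := by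
  have hp1 : 0 < p - 1 := by linarith
  have hsp : 0 < s * p := by positivity
  have h1 : ∫⁻ y in Ω, ENNReal.ofReal (|u y| ^ (p - 1) / (1 + ‖y‖) ^ ((n : ℝ) + s * p)) < ⊤ := by
    calc _ ≤ ∫⁻ y in Ω, (ENNReal.ofReal (|u y| ^ m) + 1) := by
          refine lintegral_mono fun y => ?_
          rw [← ENNReal.ofReal_one, ← ENNReal.ofReal_add (by positivity) zero_le_one]
          apply ENNReal.ofReal_le_ofReal
          have h2 : 1 ≤ (1 + ‖y‖) ^ ((n : ℝ) + s * p) :=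
            Real.one_le_rpow (by linarith [norm_nonneg y]) (by positivity)
          have h3 : 0 ≤ |u y| ^ (p - 1) := by positivity
          refine (div_le_self h3 h2).trans ?_
          rcases le_total (|u y|) 1 with h4 | h4
          · have := Real.rpow_le_one (abs_nonneg (u y)) h4 hp1.le
            have : 0 ≤ |u y| ^ m := by positivity
            linarith
          · have := Real.rpow_le_rpow_of_exponent_le h4 hpm
            linarith
      _ < ⊤ := by
          rw [lintegral_add_right _ measurable_const, lintegral_const, one_mul,
            Measure.restrict_apply_univ]
          exact ENNReal.add_lt_top.2 ⟨hum, hΩb.measure_lt_top⟩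
  have h2 : ∫⁻ y in Ωᶜ, ENNReal.ofReal (|u y| ^ (p - 1) / (1 + ‖y‖) ^ ((n : ℝ) + s * p)) < ⊤ := by
    have h3 : ∫⁻ y in (ball (0 : Rn n) 1)ᶜ,
        ENNReal.ofReal (|g y| ^ (p - 1) / ‖y - 0‖ ^ ((n : ℝ) + s * p)) < ⊤ := by
      have h4 := hg.2.2 0 1 one_pos
      unfold tailFn at h4
      rw [Real.one_rpow, ENNReal.ofReal_one, one_mul] at h4
      exact (ENNReal.rpow_lt_top_iff_of_pos (by positivity)).1 h4
    calc _ = ∫⁻ y in Ωᶜ, ENNReal.ofReal (|g y| ^ (p - 1) / (1 + ‖y‖) ^ ((n : ℝ) + s * p)) := by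
          refine setLIntegral_congr_fun_ae hΩo.measurableSet.compl ?_
          filter_upwards [hug] with y hy hyΩ
          rw [hy hyΩ]
      _ ≤ ∫⁻ y, ENNReal.ofReal (|g y| ^ (p - 1) / (1 + ‖y‖) ^ ((n : ℝ) + s * p)) :=
          setLIntegral_le_lintegral _ _
      _ = (∫⁻ y in ball (0 : Rn n) 1,
            ENNReal.ofReal (|g y| ^ (p - 1) / (1 + ‖y‖) ^ ((n : ℝ) + s * p))) +
          ∫⁻ y in (ball (0 : Rn n) 1)ᶜ,
            ENNReal.ofReal (|g y| ^ (p - 1) / (1 + ‖y‖) ^ ((n : ℝ) + s * p)) :=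
          (lintegral_add_compl _ measurableSet_ball).symm
      _ ≤ (∫⁻ y in ball (0 : Rn n) 1, ENNReal.ofReal (|g y| ^ (p - 1))) +
          ∫⁻ y in (ball (0 : Rn n) 1)ᶜ,
            ENNReal.ofReal (|g y| ^ (p - 1) / ‖y - 0‖ ^ ((n : ℝ) + s * p)) := by
          refine add_le_add (lintegral_mono fun y => ENNReal.ofReal_le_ofReal ?_)
            (setLIntegral_mono' measurableSet_ball.compl fun y hy => ENNReal.ofReal_le_ofReal ?_)
          · exact div_le_self (by positivity)
              (Real.one_le_rpow (by linarith [norm_nonneg y]) (by positivity))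
          · have h5 : 1 ≤ ‖y‖ := by simpa using hy
            rw [sub_zero]
            have h6 : 0 < ‖y‖ := by linarith
            gcongr
            linarith
      _ < ⊤ := ENNReal.add_lt_top.2 ⟨hg.2.1 1, h3⟩
  rw [← lintegral_add_compl _ hΩo.measurableSet]
  exact ENNReal.add_lt_top.2 ⟨h1, h2⟩

/-- Corollary 1.1, Calderón–Zygmund type estimate. -/
theorem SOLA_calderon_zygmund
    (n : ℕ) (s p Λ q : ℝ) (Φ : ℝ → ℝ) (K : Rn n → Rn n → ℝ)
    (Ω : Set (Rn n)) (μ : MeasureTheory.SignedMeasure (Rn n)) (f g u : Rn n → ℝ)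
    (hn : 2 ≤ n) (hs : 0 < s) (hs1 : s < 1) (hp : 2 - s / (n : ℝ) < p) (hΛ : 1 ≤ Λ)
    (hq : 1 < q) (hspq : s * p * q < n)
    (hK : KernelBounds n Λ s p K) (hΦ : PhiBounds Λ p Φ)
    (hΩo : IsOpen Ω) (hΩb : Bornology.IsBounded Ω)
    (hg : BoundaryDatum n s p g)
    -- the restriction of μ to Ω has density f
    (hfmeas : AEMeasurable f (volume : Measure (Rn n)))
    (hfdens : ∀ φ : Rn n → ℝ, IsTestFun n Ω φ →
      sintegral n μ φ = ∫ x : Rn n, φ x * f x)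
    -- f ∈ L^q_loc(Ω)
    (hfloc : ∀ Kc : Set (Rn n), IsCompact Kc → Kc ⊆ Ω →
      (∫⁻ x in Kc, ENNReal.ofReal (|f x| ^ q)) < ⊤)
    (hu : IsSOLA n Φ K s p Ω μ g u) :
    -- u ∈ L^{nq(p-1)/(n-spq)}_loc(Ω)
    ∀ Kc : Set (Rn n), IsCompact Kc → Kc ⊆ Ω →
      (∫⁻ x in Kc,
          ENNReal.ofReal (|u x| ^ ((n : ℝ) * q * (p - 1) / ((n : ℝ) - s * p * q)))) < ⊤ := by
  intro Kc hKc hKcΩ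
  have hn0 : (0 : ℝ) < n := by positivity
  have hp1 : 1 < p := by
    have : s / (n : ℝ) < 1 := by
      rw [div_lt_one hn0]
      have : (2 : ℝ) ≤ n := by exact_mod_cast hn
      linarith
    linarith
  obtain ⟨m, τ, hm1, hm2, hpm, hτ, hτp, hmτ, hmζ⟩ := exists_energy_exponents hn hs hs1 hp
  have hm1' : 1 ≤ m := (le_max_left _ _).trans hm1
  have hmp : 0 < m := by linarith
  have hq0 : 0 < q := by linarith
  obtain ⟨v, vj, fj, huv, hv⟩ := hu.exists_approxSol hs hp1 hm1 hm2 hpm hK hΦ hΩo hΩb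
  obtain ⟨δ, hδ, hδΩ⟩ := hKc.exists_cthickening_subset_open hΩo hKcΩ
  have hUc : IsCompact (cthickening δ Kc) := hKc.cthickening
  set U := cthickening δ Kc with hU
  have hum : ∫⁻ x in Ω, ENNReal.ofReal (|u x| ^ m) < ⊤ :=
    (hu.1 (s / 2) m (by linarith) (by linarith) hm1 hm2).2.1
  have hvU : ∫⁻ x in U, ENNReal.ofReal (|v x| ^ m) ≠ ⊤ := by
    refine ((lintegral_mono_set hδΩ).trans_lt ?_).ne
    rwa [lintegral_congr_ae (g := fun x => ENNReal.ofReal (|u x| ^ m))]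
    filter_upwards [ae_restrict_of_ae huv] with x hx
    rw [hx]
  have htail : ∫⁻ y, ENNReal.ofReal (|v y| ^ (p - 1) / (1 + ‖y‖) ^ ((n : ℝ) + s * p)) < ⊤ := by
    rw [lintegral_congr_ae
      (g := fun y => ENNReal.ofReal (|u y| ^ (p - 1) / (1 + ‖y‖) ^ ((n : ℝ) + s * p)))]
    · exact lintegral_rpow_div_lt_top hs hp1 hpm.le hΩo hΩb hg.2 hu.2.2.1 hum
    · filter_upwards [huv] with x hx
      rw [hx]
  have htail' : ∀ w : Rn n → ℝ, (∀ y, w y ≤ |v y|) →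
      ∫⁻ y, ENNReal.ofReal (max (w y) 0 ^ (p - 1) / (1 + ‖y‖) ^ ((n : ℝ) + s * p)) ≠ ⊤ := by
    intro w hw
    refine ((lintegral_mono fun y => ENNReal.ofReal_le_ofReal ?_).trans_lt htail).ne
    have h1 : max (w y) 0 ≤ |v y| := max_le (hw y) (abs_nonneg _)
    have h2 : 0 ≤ max (w y) 0 := le_max_right _ _
    have h3 : 0 ≤ p - 1 := by linarith
    gcongr
  have hf' := hfmeas.measurable_mk
  have hff' := hfmeas.ae_eq_mk
  set f' := hfmeas.mk f
  set G : Rn n → ℝ := U.indicator fun x => |f' x| with hG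
  have hGm : Measurable G := hf'.abs.indicator hUc.measurableSet
  have hG0 : ∀ x, 0 ≤ G x := fun x => indicator_nonneg (fun _ _ => abs_nonneg _) x
  have hGq : ∫⁻ x, ENNReal.ofReal (G x ^ q) ≠ ⊤ := by
    have e : ∀ x, ENNReal.ofReal (G x ^ q) =
        U.indicator (fun x => ENNReal.ofReal (|f' x| ^ q)) x := by
      intro x
      by_cases hx : x ∈ U
      · simp [hG, hx]
      · simp [hG, hx, Real.zero_rpow hq0.ne']
    simp_rw [e]
    rw [lintegral_indicator hUc.measurableSet,
      lintegral_congr_ae (g := fun x => ENNReal.ofReal (|f x| ^ q))]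
    · exact (hfloc U hUc hδΩ).ne
    · filter_upwards [ae_restrict_of_ae hff'] with x hx
      rw [hx]
  have hν : ∀ x ∈ Kc, ∀ r, 0 < r → r ≤ δ →
      μ.totalVariation (closedBall x r) ≤ ∫⁻ y in closedBall x r, ENNReal.ofReal (G y) := by
    intro x hx r _ hrδ
    have hsub : closedBall x r ⊆ U :=
      (closedBall_subset_closedBall hrδ).trans (closedBall_subset_cthickening hx δ)
    refine (totalVariation_le_lintegral hΩo (isCompact_closedBall x r) (hsub.trans hδΩ)
      (fun K' hK' hK'Ω => integrableOn_of_lintegral_rpow_ne_top hq.le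
        hfmeas.aestronglyMeasurable.restrict hK'.measure_lt_top.ne
        (hfloc K' hK' hK'Ω).ne) hfdens).trans (le_of_eq ?_)
    refine setLIntegral_congr_fun_ae measurableSet_closedBall ?_
    filter_upwards [hff'] with y hy hyb
    rw [hG, indicator_of_mem (hsub hyb), hy]
  have hpos := hv.lintegral_posPart_rpow_lt_top hn hs hs1 hΛ hp1 hτ hτp hmτ hmζ hm1' hq hspq
    hGm hG0 hGq hKc hδ hδΩ hν hvU (htail' v fun y => le_abs_self _)
  have hneg := hv.neg.lintegral_posPart_rpow_lt_top hn hs hs1 hΛ hp1 hτ hτp hmτ hmζ hm1' hq hspq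
    hGm hG0 hGq hKc hδ hδΩ hν (by simpa only [abs_neg] using hvU)
    (htail' (fun y => -v y) fun y => neg_le_abs _)
  set Q := (n : ℝ) * q * (p - 1) / ((n : ℝ) - s * p * q)
  have hmeas : Measurable fun x => ENNReal.ofReal (max (v x) 0 ^ Q) :=
    ((hv.measurable_limit.max measurable_const).pow_const Q).ennreal_ofReal
  calc ∫⁻ x in Kc, ENNReal.ofReal (|u x| ^ Q)
      ≤ ∫⁻ x in Kc, (ENNReal.ofReal (max (v x) 0 ^ Q) + ENNReal.ofReal (max (-v x) 0 ^ Q)) := by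
        refine lintegral_mono_ae ?_
        filter_upwards [ae_restrict_of_ae huv] with x hx
        rw [hx]
        rcases le_total 0 (v x) with h | h
        · rw [abs_of_nonneg h, max_eq_left h]
          exact le_self_add
        · rw [abs_of_nonpos h, max_eq_left (neg_nonneg.2 h)]
          exact le_add_self
    _ < ⊤ := by
        rw [lintegral_add_left hmeas]
        exact ENNReal.add_lt_top.2 ⟨hpos, hneg⟩
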